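/- arXiv:2002.05118 — 4 statements merged into one kernel-verified Lean document; each statement's English description precedes it below -/
import Mathlib

section
/- Fourth-order expansion of the Bessel function on the real line: let N ≥ 20, let n be an integer with 0 ≤ n ≤ N, and let z be real with z > 2 · N^{3/2} · ln(N). Set ω := z − π/4 − nπ/2 and define a := cos(ω), b := −sin(ω)·(n²−1/4)/2, c := −cos(ω)·(n²−1/4)(n²−9/4)/8, d := sin(ω)·(n²−1/4)(n²−9/4)(n²−25/4)/48. Then | (πz/2)^{1/2} · J_n^+(z) − (a + b/z + c/z² + d/z³) | ≤ 0.0043 · N⁸ / z⁴, where J_n^+(z) := ((z/2)^n / (Γ(n+1/2) Γ(1/2))) ∫_{−1}^{1} e^{i z t} (1−t²)^{n−1/2} dt. -/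
open Complex Real

/-- The half Bessel function `J_n^+`, defined via the Poisson-type integral
`J_n^+(z) = ((z/2)^n/(Γ(n+1/2)Γ(1/2))) ∫_{−1}^{1} e^{izt}(1−t²)^{n−1/2} dt`; for real `z`
it coincides with the Bessel function `J_n(z)`. -/
noncomputable def besselJPlus (n : ℕ) (z : ℂ) : ℂ :=
  ((z / 2) ^ n / ((Real.Gamma ((n : ℝ) + 1 / 2) : ℂ) * (Real.Gamma (1 / 2) : ℂ))) *
    ∫ t in (-1:ℝ)..1, Complex.exp (Complex.I * z * (t : ℂ)) *
      ((1 : ℂ) - (t : ℂ) ^ 2) ^ ((((n : ℝ) - 1 / 2 : ℝ)) : ℂ)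

/-- The generalized binomial coefficient `ν (ν - 1) ⋯ (ν - k + 1) / k!`. -/
noncomputable def binomCoeff (ν : ℝ) (k : ℕ) : ℝ :=
  (∏ j ∈ Finset.range k, (ν - j)) / k.factorial

lemma binomCoeff_zero (ν : ℝ) : binomCoeff ν 0 = 1 := by simp [binomCoeff]

lemma succ_mul_binomCoeff_succ (ν : ℝ) (k : ℕ) :
    (k + 1 : ℝ) * binomCoeff ν (k + 1) = ν * binomCoeff (ν - 1) k := by
  have h : ∏ j ∈ Finset.range k, (ν - ((j + 1 : ℕ) : ℝ)) = ∏ j ∈ Finset.range k, (ν - 1 - j) :=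
    Finset.prod_congr rfl fun j _ => by push_cast; ring
  rw [binomCoeff, binomCoeff, Finset.prod_range_succ', h, Nat.factorial_succ]
  have := Nat.factorial_ne_zero k
  push_cast
  field_simp
  ring

lemma one_add_I_mul_mem_slitPlane (s : ℝ) : 1 + I * (s : ℂ) ∈ slitPlane :=
  Or.inl (by simp)

lemma hasDerivAt_one_add_I_mul_cpow (ν s : ℝ) :
    HasDerivAt (fun τ : ℝ => (1 + I * (τ : ℂ)) ^ (ν : ℂ))
      (I * ν * (1 + I * (s : ℂ)) ^ ((ν - 1 : ℝ) : ℂ)) s := by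
  have h1 : HasDerivAt (fun τ : ℂ => 1 + I * τ) I (s : ℂ) := by
    simpa using ((hasDerivAt_id (s : ℂ)).const_mul I).const_add 1
  have h2 := (h1.cpow_const (c := (ν : ℂ)) (one_add_I_mul_mem_slitPlane s)).comp_ofReal
  convert h2 using 1
  push_cast
  ring

/-- The Taylor remainder of order `m` of `s ↦ (1 + i s)^ν` at `0`. -/
noncomputable def taylorRemainder (m : ℕ) (ν s : ℝ) : ℂ :=
  (1 + I * (s : ℂ)) ^ (ν : ℂ) - ∑ k ∈ Finset.range m, (binomCoeff ν k : ℂ) * (I * (s : ℂ)) ^ k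

lemma hasDerivAt_taylorRemainder_succ (m : ℕ) (ν s : ℝ) :
    HasDerivAt (taylorRemainder (m + 1) ν) (I * ν * taylorRemainder m (ν - 1) s) s := by
  have hterm (k : ℕ) : HasDerivAt (fun τ : ℝ => (binomCoeff ν k : ℂ) * (I * (τ : ℂ)) ^ k)
      ((binomCoeff ν k : ℂ) * (k * (I * (s : ℂ)) ^ (k - 1) * I)) s := by
    have h1 : HasDerivAt (fun τ : ℝ => I * (τ : ℂ)) I s := by
      simpa using (HasDerivAt.ofReal_comp (hasDerivAt_id s)).const_mul I
    exact (h1.pow k).const_mul _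
  have h := (hasDerivAt_one_add_I_mul_cpow ν s).sub
    (HasDerivAt.fun_sum (u := Finset.range (m + 1)) fun k _ => hterm k)
  refine h.congr_deriv ?_
  rw [taylorRemainder, mul_sub, Finset.sum_range_succ', Finset.mul_sum]
  congr 1
  simp only [Nat.cast_zero, zero_mul, mul_zero, add_zero, Nat.add_sub_cancel]
  refine Finset.sum_congr rfl fun k _ => ?_
  have := congrArg (fun x : ℝ => (x : ℂ)) (succ_mul_binomCoeff_succ ν k)
  push_cast at this ⊢
  linear_combination (I * (s : ℂ)) ^ k * I * this

lemma norm_taylorRemainder_le (m : ℕ) (ν s B : ℝ)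
    (hB : ∀ τ ∈ Set.Icc 0 s, ‖(1 + I * (τ : ℂ)) ^ ((ν - m : ℝ) : ℂ)‖ ≤ B) {τ : ℝ}
    (hτ : τ ∈ Set.Icc 0 s) :
    ‖taylorRemainder m ν τ‖ ≤ |binomCoeff ν m| * τ ^ m * B := by
  induction m generalizing ν τ with
  | zero => simpa [taylorRemainder, binomCoeff_zero] using hB τ hτ
  | succ m ih =>
    have hderiv : ∀ x, HasDerivAt (fun x : ℝ => |binomCoeff ν (m + 1)| * x ^ (m + 1) * B)
        (|binomCoeff ν (m + 1)| * ((m + 1 : ℕ) * x ^ m) * B) x := fun x =>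
      ((hasDerivAt_pow (m + 1) x).const_mul _).mul_const B
    refine image_norm_le_of_norm_deriv_right_le_deriv_boundary
      (fun x _ => (hasDerivAt_taylorRemainder_succ m ν x).continuousAt.continuousWithinAt)
      (fun x _ => (hasDerivAt_taylorRemainder_succ m ν x).hasDerivWithinAt) ?_ hderiv ?_ hτ
    · simp [taylorRemainder, Finset.sum_range_succ', binomCoeff_zero]
    · intro x hx
      have hx' := ih (ν - 1) (fun t ht => by
        convert! hB t ht using 4
        push_cast
        ring) (Set.Ico_subset_Icc_self hx)
      have habs : (m + 1 : ℝ) * |binomCoeff ν (m + 1)| = |ν| * |binomCoeff (ν - 1) m| := by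
        rw [← abs_mul, ← succ_mul_binomCoeff_succ, abs_mul,
          abs_of_nonneg (by positivity : (0 : ℝ) ≤ m + 1)]
      rw [norm_mul, norm_mul, norm_I, one_mul, norm_real, Real.norm_eq_abs]
      calc |ν| * ‖taylorRemainder m (ν - 1) x‖
          ≤ |ν| * (|binomCoeff (ν - 1) m| * x ^ m * B) := by gcongr
        _ = |binomCoeff ν (m + 1)| * ((m + 1 : ℕ) * x ^ m) * B := by
          push_cast
          linear_combination -(x ^ m * B) * habs

lemma norm_one_add_I_mul_cpow_le {n : ℕ} {μ s τ : ℝ} (hμ : μ ≤ n) (hτ : τ ∈ Set.Icc 0 s) :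
    ‖(1 + I * (τ : ℂ)) ^ (μ : ℂ)‖ ≤ (1 + s ^ 2) ^ n := by
  have h0 : 1 + I * (τ : ℂ) ≠ 0 := slitPlane_ne_zero (one_add_I_mul_mem_slitPlane τ)
  have hsq : ‖1 + I * (τ : ℂ)‖ ^ 2 = 1 + τ ^ 2 := by
    rw [← normSq_eq_norm_sq, normSq_apply]; simp; ring
  have h1 : 1 ≤ ‖1 + I * (τ : ℂ)‖ := by
    nlinarith [norm_nonneg (1 + I * (τ : ℂ)), sq_nonneg τ]
  have h2 : ‖1 + I * (τ : ℂ)‖ ≤ 1 + s ^ 2 := by nlinarith [hτ.1, hτ.2]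
  rw [norm_cpow_real]
  calc ‖1 + I * (τ : ℂ)‖ ^ μ ≤ ‖1 + I * (τ : ℂ)‖ ^ (n : ℝ) :=
        Real.rpow_le_rpow_of_exponent_le h1 hμ
    _ = ‖1 + I * (τ : ℂ)‖ ^ n := Real.rpow_natCast _ _
    _ ≤ _ := by gcongr

open MeasureTheory Filter Topology in
lemma tendsto_intervalIntegral_one_div_Ioi {f : ℝ → ℂ} (hf : IntegrableOn f (Set.Ioi 0)) :
    Tendsto (fun k : ℕ => ∫ y in (1 / (k + 1 : ℝ))..(k + 1), f y) atTop
      (𝓝 (∫ y in Set.Ioi 0, f y)) := by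
  have hcov : AECover (volume.restrict (Set.Ioi (0 : ℝ))) atTop
      fun k : ℕ => Set.Ioi (1 / (k + 1 : ℝ)) ∩ Set.Iic (k + 1 : ℝ) :=
    (aecover_Ioi_of_Ioi tendsto_one_div_add_atTop_nhds_zero_nat).inter
      ((aecover_Iic (tendsto_natCast_atTop_atTop.atTop_add tendsto_const_nhds)).restrict)
  refine (hcov.integral_tendsto_of_countably_generated hf).congr fun k => ?_
  have hk : (1 / (k + 1 : ℝ)) ≤ k + 1 := by
    have : (0 : ℝ) ≤ k := k.cast_nonneg
    rw [div_le_iff₀ (by positivity)]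
    nlinarith
  rw [intervalIntegral.integral_of_le hk, Set.Ioi_inter_Iic,
    Measure.restrict_restrict measurableSet_Ioc, Set.inter_eq_left.mpr]
  intro y hy
  exact lt_trans (by positivity) hy.1

lemma mul_cpow_of_arg_add_mem {x y : ℂ} (hx : x ≠ 0) (hy : y ≠ 0)
    (h : x.arg + y.arg ∈ Set.Ioc (-π) π) (r : ℂ) : (x * y) ^ r = x ^ r * y ^ r := by
  rw [cpow_def_of_ne_zero (mul_ne_zero hx hy), cpow_def_of_ne_zero hx, cpow_def_of_ne_zero hy,
    log_mul hx hy h, add_mul, Complex.exp_add]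

lemma ofReal_mul_cpow {x : ℝ} {y : ℂ} (hx : 0 < x) (hy : y ≠ 0) (r : ℂ) :
    ((x : ℂ) * y) ^ r = (x : ℂ) ^ r * y ^ r :=
  mul_cpow_of_arg_add_mem (ofReal_ne_zero.mpr hx.ne') hy
    (by simpa [arg_ofReal_of_nonneg hx.le] using arg_mem_Ioc y) r

/-- The integrand of `besselJPlus`, as a function of a complex variable. -/
noncomputable def poissonIntegrand (n : ℕ) (z : ℝ) (t : ℂ) : ℂ :=
  exp (I * z * t) * (1 - t ^ 2) ^ (((n : ℝ) - 1 / 2 : ℝ) : ℂ)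

/-- The integrand of the Hankel representation obtained from `poissonIntegrand` by
contour rotation. -/
noncomputable def hankelIntegrand (n : ℕ) (z y : ℝ) : ℂ :=
  ((Real.exp (-(z * y)) * (2 * y) ^ ((n : ℝ) - 1 / 2) : ℝ) : ℂ) *
    (1 + I * ((y / 2 : ℝ) : ℂ)) ^ (((n : ℝ) - 1 / 2 : ℝ) : ℂ)

lemma one_sub_sq_re (x y : ℝ) : (1 - ((x : ℂ) + y * I) ^ 2).re = 1 - x ^ 2 + y ^ 2 := by
  simp [sq]; ring

lemma one_sub_sq_re_pos {x y : ℝ} (hx : x ∈ Set.Icc (-1) 1) (hy : 0 < y) :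
    0 < (1 - ((x : ℂ) + y * I) ^ 2).re := by
  rw [one_sub_sq_re]
  nlinarith [hx.1, hx.2]

lemma poissonIntegrand_one_add (n : ℕ) (z : ℝ) {y : ℝ} (hy : 0 < y) :
    poissonIntegrand n z (((1 : ℝ) : ℂ) + y * I) =
      exp (I * (z - ((n : ℝ) - 1 / 2 : ℝ) * π / 2)) * hankelIntegrand n z y := by
  set ν : ℝ := (n : ℝ) - 1 / 2 with hν
  have h1 : (1 - (((1 : ℝ) : ℂ) + y * I) ^ 2) =
      ((2 * y : ℝ) : ℂ) * (-I * (1 + I * ((y / 2 : ℝ) : ℂ))) := by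
    push_cast
    linear_combination (2 * (y : ℂ) * (y / 2) - (y : ℂ) ^ 2) * I_sq
  have harg : arg (1 + I * ((y / 2 : ℝ) : ℂ)) ∈ Set.Ioo (-(π / 2)) (π / 2) :=
    Set.mem_Ioo.mpr (abs_lt.mp (abs_arg_lt_pi_div_two_iff.mpr (Or.inl (by simp))))
  have hne : 1 + I * ((y / 2 : ℝ) : ℂ) ≠ 0 := slitPlane_ne_zero (one_add_I_mul_mem_slitPlane _)
  have h2 : (-I * (1 + I * ((y / 2 : ℝ) : ℂ))) ^ (ν : ℂ) =
      (-I) ^ (ν : ℂ) * (1 + I * ((y / 2 : ℝ) : ℂ)) ^ (ν : ℂ) := by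
    have hpos : 0 ≤ arg (1 + I * ((y / 2 : ℝ) : ℂ)) := by
      rw [arg_nonneg_iff]; simp; positivity
    refine mul_cpow_of_arg_add_mem (by simp) hne ⟨?_, ?_⟩ _ <;> rw [arg_neg_I] <;>
      linarith [harg.1, harg.2, pi_pos]
  have h3 : (-I) ^ (ν : ℂ) = exp (-(I * (ν * π / 2))) := by
    rw [cpow_def_of_ne_zero (by simp), log_neg_I]
    congr 1; ring
  rw [poissonIntegrand, hankelIntegrand, h1, ← hν, ofReal_mul_cpow (by positivity)
    (mul_ne_zero (by simp) hne), h2, h3,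
    ofReal_mul (Real.exp _), ofReal_cpow (by positivity), ofReal_exp]
  have h4 : exp (I * z * (((1 : ℝ) : ℂ) + y * I)) = exp (I * z) * exp ((-(z * y) : ℝ) : ℂ) := by
    rw [← Complex.exp_add]; congr 1; push_cast
    linear_combination ((z : ℂ) * y) * I_sq
  have h5 : exp (I * (z - ν * π / 2)) = exp (I * z) * exp (-(I * (ν * π / 2))) := by
    rw [← Complex.exp_add]; congr 1; ring
  rw [h4, h5]
  ring

lemma poissonIntegrand_neg_one_add (n : ℕ) (z : ℝ) {y : ℝ} (hy : 0 < y) :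
    poissonIntegrand n z (((-1 : ℝ) : ℂ) + y * I) =
      (starRingEnd ℂ) (poissonIntegrand n z (((1 : ℝ) : ℂ) + y * I)) := by
  have hre := one_sub_sq_re_pos (x := 1) (by simp) hy
  have harg : arg (1 - (((1 : ℝ) : ℂ) + y * I) ^ 2) ≠ π :=
    (mem_slitPlane_iff_arg.mp (Or.inl hre)).1
  have h1 : (1 - (((-1 : ℝ) : ℂ) + y * I) ^ 2) =
      (starRingEnd ℂ) (1 - (((1 : ℝ) : ℂ) + y * I) ^ 2) := by
    simp; ring
  have h2 : I * z * (((-1 : ℝ) : ℂ) + y * I) =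
      (starRingEnd ℂ) (I * z * (((1 : ℝ) : ℂ) + y * I)) := by
    simp; ring
  rw [poissonIntegrand, poissonIntegrand, h1, h2, exp_conj, conj_cpow _ _ harg, conj_ofReal,
    ← map_mul]

open MeasureTheory in
lemma integrableOn_exp_mul_rpow {z p : ℝ} (hz : 0 < z) (hp : -1 < p) :
    IntegrableOn (fun y : ℝ => Real.exp (-(z * y)) * y ^ p) (Set.Ioi 0) := by
  simpa [mul_comm] using integrableOn_rpow_mul_exp_neg_mul_rpow hp one_pos hz

lemma integral_exp_mul_rpow {z p : ℝ} (hz : 0 < z) (hp : -1 < p) :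
    ∫ y in Set.Ioi (0 : ℝ), Real.exp (-(z * y)) * y ^ p =
      Real.Gamma (p + 1) / z ^ (p + 1) := by
  have h := Real.integral_rpow_mul_exp_neg_mul_Ioi (a := p + 1) (by linarith) hz
  rw [add_sub_cancel_right, one_div, Real.inv_rpow hz.le] at h
  simp_rw [mul_comm (Real.exp _)]
  rw [h, div_eq_mul_inv, mul_comm]

lemma Gamma_add_natCast {a : ℝ} (ha : 0 < a) (k : ℕ) :
    Real.Gamma (a + k) = (∏ j ∈ Finset.range k, (a + j)) * Real.Gamma a := by
  induction k with
  | zero => simp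
  | succ k ih =>
    rw [Nat.cast_succ, ← add_assoc, Real.Gamma_add_one (by positivity), ih,
      Finset.prod_range_succ]
    ring

/-- The moments of the weight `e^{-zy} (2y)^ν`. -/
lemma integral_exp_mul_rpow_mul_pow {z ν : ℝ} (hz : 0 < z) (hν : -1 < ν) (k : ℕ) :
    ∫ y in Set.Ioi (0 : ℝ), Real.exp (-(z * y)) * (2 * y) ^ ν * y ^ k =
      2 ^ ν * Real.Gamma (ν + 1) / z ^ (ν + 1) *
        ((∏ j ∈ Finset.range k, (ν + 1 + j)) / z ^ k) := by
  have h1 : ∀ y ∈ Set.Ioi (0 : ℝ), Real.exp (-(z * y)) * (2 * y) ^ ν * y ^ k =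
      2 ^ ν * (Real.exp (-(z * y)) * y ^ (ν + k)) := fun y hy => by
    rw [Real.mul_rpow two_pos.le (le_of_lt hy), Real.rpow_add_natCast (ne_of_gt hy)]
    ring
  rw [MeasureTheory.setIntegral_congr_fun measurableSet_Ioi h1,
    MeasureTheory.integral_const_mul,
    integral_exp_mul_rpow hz (by linarith [k.cast_nonneg (α := ℝ)]),
    show ν + k + 1 = ν + 1 + k by ring, Gamma_add_natCast (by linarith),
    Real.rpow_add_natCast hz.ne']
  field_simp

open MeasureTheory in
lemma integrableOn_exp_mul_rpow_mul_pow {z ν : ℝ} (hz : 0 < z) (hν : -1 < ν) (k : ℕ) :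
    IntegrableOn (fun y : ℝ => Real.exp (-(z * y)) * (2 * y) ^ ν * y ^ k) (Set.Ioi 0) := by
  have h1 : ∀ y ∈ Set.Ioi (0 : ℝ), 2 ^ ν * (Real.exp (-(z * y)) * y ^ (ν + k)) =
      Real.exp (-(z * y)) * (2 * y) ^ ν * y ^ k := fun y hy => by
    rw [Real.mul_rpow two_pos.le (le_of_lt hy), Real.rpow_add_natCast (ne_of_gt hy)]
    ring
  exact IntegrableOn.congr_fun (Integrable.const_mul
    (integrableOn_exp_mul_rpow hz (by linarith [k.cast_nonneg (α := ℝ)])) _) h1 measurableSet_Ioi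

lemma exp_mul_rpow_mul_pow_mul_one_add_sq_pow (z ν y : ℝ) (m n : ℕ) :
    Real.exp (-(z * y)) * (2 * y) ^ ν * y ^ m * (1 + (y / 2) ^ 2) ^ n =
      ∑ j ∈ Finset.range (n + 1), (n.choose j : ℝ) / 4 ^ j *
        (Real.exp (-(z * y)) * (2 * y) ^ ν * y ^ (m + 2 * j)) := by
  rw [add_comm 1, add_pow, Finset.mul_sum]
  refine Finset.sum_congr rfl fun j _ => ?_
  rw [pow_add, pow_mul, div_pow, div_pow]
  norm_num
  ring

open MeasureTheory in
lemma integrableOn_exp_mul_rpow_mul_pow_mul_one_add_sq_pow {z ν : ℝ} (hz : 0 < z) (hν : -1 < ν)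
    (m n : ℕ) :
    IntegrableOn (fun y : ℝ => Real.exp (-(z * y)) * (2 * y) ^ ν * y ^ m * (1 + (y / 2) ^ 2) ^ n)
      (Set.Ioi 0) := by
  simp_rw [exp_mul_rpow_mul_pow_mul_one_add_sq_pow]
  exact integrable_finsetSum _ fun j _ =>
    (integrableOn_exp_mul_rpow_mul_pow hz hν _).const_mul _

lemma integral_exp_mul_rpow_mul_pow_mul_one_add_sq_pow_le {z ν : ℝ} (hz : 0 < z) (hν : -1 < ν)
    (m n : ℕ) :
    ∫ y in Set.Ioi (0 : ℝ),
        Real.exp (-(z * y)) * (2 * y) ^ ν * y ^ m * (1 + (y / 2) ^ 2) ^ n ≤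
      2 ^ ν * Real.Gamma (ν + 1) / z ^ (ν + 1) *
        ((∏ j ∈ Finset.range m, (ν + 1 + j)) / z ^ m) *
          (1 + ((ν + 1 + m + 2 * n) / (2 * z)) ^ 2) ^ n := by
  have hG : 0 ≤ 2 ^ ν * Real.Gamma (ν + 1) / z ^ (ν + 1) := by
    have := Real.Gamma_pos_of_pos (s := ν + 1) (by linarith)
    positivity
  have hpos (j : ℕ) : 0 ≤ ν + 1 + j := by linarith [j.cast_nonneg (α := ℝ)]
  simp_rw [exp_mul_rpow_mul_pow_mul_one_add_sq_pow]
  rw [MeasureTheory.integral_finsetSum _ fun j _ =>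
    (integrableOn_exp_mul_rpow_mul_pow hz hν _).const_mul _]
  rw [add_comm (1 : ℝ) (_ ^ 2), add_pow, Finset.mul_sum]
  refine Finset.sum_le_sum fun j hj => ?_
  have hj' : (j : ℝ) ≤ n := by exact_mod_cast Nat.lt_succ_iff.mp (Finset.mem_range.mp hj)
  rw [MeasureTheory.integral_const_mul, integral_exp_mul_rpow_mul_pow hz hν,
    Finset.prod_range_add]
  have hprod : ∏ i ∈ Finset.range (2 * j), (ν + 1 + ((m + i : ℕ) : ℝ)) ≤
      (ν + 1 + m + 2 * n) ^ (2 * j) := by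
    refine (Finset.prod_le_prod (fun i _ => hpos _) fun i hi => ?_).trans_eq
      ((Finset.prod_const _).trans (by rw [Finset.card_range]))
    have : ((i + 1 : ℕ) : ℝ) ≤ ((2 * j : ℕ) : ℝ) := by
      exact_mod_cast Finset.mem_range.mp hi
    push_cast at this ⊢
    linarith
  have hP : 0 ≤ ∏ j ∈ Finset.range m, (ν + 1 + j) := Finset.prod_nonneg fun i _ => hpos i
  calc _ ≤ (n.choose j : ℝ) / 4 ^ j * (2 ^ ν * Real.Gamma (ν + 1) / z ^ (ν + 1) *
        ((∏ j ∈ Finset.range m, (ν + 1 + j)) * (ν + 1 + m + 2 * n) ^ (2 * j) /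
          z ^ (m + 2 * j))) := by gcongr
    _ = _ := by
      rw [← pow_mul, div_pow, mul_pow, pow_add, pow_mul (2 : ℝ) 2 j]
      norm_num
      field_simp

lemma norm_hankelIntegrand_le (n : ℕ) (z : ℝ) {y : ℝ} (hy : 0 < y) :
    ‖hankelIntegrand n z y‖ ≤
      Real.exp (-(z * y)) * (2 * y) ^ ((n : ℝ) - 1 / 2) * y ^ 0 * (1 + (y / 2) ^ 2) ^ n := by
  rw [hankelIntegrand, norm_mul, norm_real, Real.norm_of_nonneg (by positivity), pow_zero, mul_one]
  gcongr
  exact norm_one_add_I_mul_cpow_le (by linarith) ⟨by positivity, le_rfl⟩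

lemma measurable_hankelIntegrand (n : ℕ) (z : ℝ) : Measurable (hankelIntegrand n z) := by
  unfold hankelIntegrand
  fun_prop

lemma measurable_poissonIntegrand (n : ℕ) (z : ℝ) : Measurable (poissonIntegrand n z) := by
  unfold poissonIntegrand
  fun_prop

open MeasureTheory in
lemma integrableOn_hankelIntegrand (n : ℕ) {z : ℝ} (hz : 0 < z) :
    IntegrableOn (hankelIntegrand n z) (Set.Ioi 0) := by
  have h := integrableOn_exp_mul_rpow_mul_pow_mul_one_add_sq_pow hz
    (ν := (n : ℝ) - 1 / 2) (by linarith [n.cast_nonneg (α := ℝ)]) 0 n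
  exact Integrable.mono' h (measurable_hankelIntegrand n z).aestronglyMeasurable
    ((ae_restrict_mem measurableSet_Ioi).mono fun y hy => norm_hankelIntegrand_le n z hy)

lemma differentiableAt_poissonIntegrand (n : ℕ) (z : ℝ) {t : ℂ} (ht : 1 - t ^ 2 ∈ slitPlane) :
    DifferentiableAt ℂ (poissonIntegrand n z) t := by
  unfold poissonIntegrand
  have h : DifferentiableAt ℂ (fun t : ℂ => 1 - t ^ 2) t := by fun_prop
  exact DifferentiableAt.mul (by fun_prop) (h.cpow_const ht)

lemma poissonIntegrand_contour (n : ℕ) (z : ℝ) {δ H : ℝ} (hδ : 0 < δ) (hH : δ ≤ H) :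
    (∫ x : ℝ in (-1)..1, poissonIntegrand n z (x + δ * I)) =
      (∫ x : ℝ in (-1)..1, poissonIntegrand n z (x + H * I)) -
        I * (∫ y : ℝ in δ..H, poissonIntegrand n z ((1 : ℝ) + y * I)) +
        I * (∫ y : ℝ in δ..H, poissonIntegrand n z ((-1 : ℝ) + y * I)) := by
  have h := integral_boundary_rect_eq_zero_of_differentiableOn (poissonIntegrand n z)
    ⟨-1, δ⟩ ⟨1, H⟩ (fun t ht => by
      refine (differentiableAt_poissonIntegrand n z (Or.inl ?_)).differentiableWithinAt
      rw [Set.uIcc_of_le (by norm_num), Set.uIcc_of_le (by exact hH), mem_reProdIm] at ht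
      rw [← re_add_im t]
      exact one_sub_sq_re_pos ht.1 (hδ.trans_le ht.2.1))
  simp only [smul_eq_mul] at h
  linear_combination h

lemma norm_poissonIntegrand_le (n : ℕ) (z : ℝ) {x y : ℝ} (hx : x ∈ Set.Ioo (-1) 1) :
    ‖poissonIntegrand n z (x + y * I)‖ ≤
      Real.exp (-(z * y)) * (2 + y ^ 2) ^ n *
        ((1 - x) ^ (-1 / 2 : ℝ) + (1 + x) ^ (-1 / 2 : ℝ)) := by
  have hx1 : 0 < 1 - x := by linarith [hx.2]
  have hx2 : 0 < 1 + x := by linarith [hx.1]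
  set w : ℂ := 1 - ((x : ℂ) + y * I) ^ 2 with hw
  have hre : 1 - x ^ 2 ≤ w.re := by rw [one_sub_sq_re]; nlinarith
  have hlow : (1 - x) * (1 + x) ≤ ‖w‖ := by linarith [re_le_norm w]
  have hwpos : 0 < ‖w‖ := lt_of_lt_of_le (by positivity) hlow
  have hup : ‖w‖ ≤ 2 + y ^ 2 := by
    have h1 : ‖(x : ℂ) + y * I‖ ^ 2 = x ^ 2 + y ^ 2 := by
      rw [← normSq_eq_norm_sq, normSq_add_mul_I]
    calc ‖w‖ ≤ ‖(1 : ℂ)‖ + ‖((x : ℂ) + y * I) ^ 2‖ := norm_sub_le _ _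
      _ = 1 + (x ^ 2 + y ^ 2) := by rw [norm_one, norm_pow, h1]
      _ ≤ 2 + y ^ 2 := by nlinarith [hx.1, hx.2]
  have hexp : ‖exp (I * z * ((x : ℂ) + y * I))‖ = Real.exp (-(z * y)) := by
    rw [norm_exp]; congr 1; simp
  have hpow : ‖w‖ ^ (-1 / 2 : ℝ) ≤ (1 - x) ^ (-1 / 2 : ℝ) + (1 + x) ^ (-1 / 2 : ℝ) := by
    rcases le_total 0 x with h | h
    · have : 1 - x ≤ ‖w‖ := by nlinarith
      have h2 := Real.rpow_le_rpow_of_nonpos hx1 this (by norm_num : (-1 / 2 : ℝ) ≤ 0)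
      linarith [Real.rpow_nonneg hx2.le (-1 / 2 : ℝ)]
    · have : 1 + x ≤ ‖w‖ := by nlinarith
      have h2 := Real.rpow_le_rpow_of_nonpos hx2 this (by norm_num : (-1 / 2 : ℝ) ≤ 0)
      linarith [Real.rpow_nonneg hx1.le (-1 / 2 : ℝ)]
  rw [poissonIntegrand, norm_mul, hexp, norm_cpow_real, ← hw, mul_assoc,
    show (n : ℝ) - 1 / 2 = -1 / 2 + n by ring, Real.rpow_add_natCast hwpos.ne',
    mul_comm (‖w‖ ^ (-1 / 2 : ℝ))]
  gcongr

open MeasureTheory in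
lemma intervalIntegrable_one_sub_rpow_add_one_add_rpow :
    IntervalIntegrable (fun x : ℝ => (1 - x) ^ (-1 / 2 : ℝ) + (1 + x) ^ (-1 / 2 : ℝ))
      volume (-1) 1 := by
  have h : IntervalIntegrable (fun x : ℝ => x ^ (-1 / 2 : ℝ)) volume 0 2 :=
    intervalIntegral.intervalIntegrable_rpow' (by norm_num)
  have h1 := h.comp_sub_left 1
  have h2 := h.comp_add_left 1
  norm_num at h1 h2 ⊢
  exact h1.symm.add h2

open MeasureTheory Filter Topology in
lemma tendsto_integral_poissonIntegrand (n : ℕ) {z C : ℝ} {f : ℝ → ℂ} {u : ℕ → ℝ}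
    (hC : ∀ k, Real.exp (-(z * u k)) * (2 + u k ^ 2) ^ n ≤ C)
    (hf : ∀ x ∈ Set.Ioo (-1 : ℝ) 1,
      Tendsto (fun k => poissonIntegrand n z (x + u k * I)) atTop (𝓝 (f x))) :
    Tendsto (fun k => ∫ x : ℝ in (-1)..1, poissonIntegrand n z (x + u k * I)) atTop
      (𝓝 (∫ x : ℝ in (-1)..1, f x)) := by
  have hae : ∀ᵐ x : ℝ, x ∈ Set.uIoc (-1 : ℝ) 1 → x ∈ Set.Ioo (-1 : ℝ) 1 := by
    filter_upwards [Measure.ae_ne volume (1 : ℝ)] with x hx hx'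
    rw [Set.uIoc_of_le (by norm_num)] at hx'
    exact ⟨hx'.1, lt_of_le_of_ne hx'.2 hx⟩
  refine intervalIntegral.tendsto_integral_filter_of_dominated_convergence
    (fun x => C * ((1 - x) ^ (-1 / 2 : ℝ) + (1 + x) ^ (-1 / 2 : ℝ))) ?_ ?_
    (intervalIntegrable_one_sub_rpow_add_one_add_rpow.const_mul C) ?_
  · refine Eventually.of_forall fun k => Measurable.aestronglyMeasurable ?_
    exact (measurable_poissonIntegrand n z).comp (by fun_prop)
  · refine Eventually.of_forall fun k => hae.mono fun x hx hx' => ?_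
    have hx1 : 0 ≤ 1 - x := by linarith [(hx hx').2]
    have hx2 : 0 ≤ 1 + x := by linarith [(hx hx').1]
    refine (norm_poissonIntegrand_le n z (hx hx')).trans ?_
    gcongr
    exact hC k
  · exact hae.mono fun x hx hx' => hf x (hx hx')

open Filter Topology in
lemma tendsto_exp_neg_mul_two_add_sq_pow (n : ℕ) {z : ℝ} (hz : 0 < z) :
    Tendsto (fun x : ℝ => Real.exp (-(z * x)) * (2 + x ^ 2) ^ n) atTop (𝓝 0) := by
  have h := ((isLittleO_pow_exp_pos_mul_atTop (k := 2 * n) hz).tendsto_div_nhds_zero).const_mul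
    ((3 : ℝ) ^ n)
  rw [mul_zero] at h
  refine squeeze_zero' (Eventually.of_forall fun x => by positivity) ?_ h
  filter_upwards [eventually_ge_atTop 1] with x hx
  calc Real.exp (-(z * x)) * (2 + x ^ 2) ^ n ≤ Real.exp (-(z * x)) * (3 * x ^ 2) ^ n := by
        gcongr; nlinarith
    _ = 3 ^ n * (x ^ (2 * n) / Real.exp (z * x)) := by
        rw [Real.exp_neg, mul_pow, ← pow_mul]; field_simp

open Filter Topology in
lemma tendsto_integral_poissonIntegrand_top (n : ℕ) {z : ℝ} (hz : 0 < z) :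
    Tendsto (fun k : ℕ => ∫ x : ℝ in (-1)..1, poissonIntegrand n z (x + (k + 1 : ℝ) * I)) atTop
      (𝓝 0) := by
  have hu : Tendsto (fun k : ℕ => (k + 1 : ℝ)) atTop atTop :=
    tendsto_natCast_atTop_atTop.atTop_add tendsto_const_nhds
  have h0 := (tendsto_exp_neg_mul_two_add_sq_pow n hz).comp hu
  obtain ⟨C, hC⟩ := h0.bddAbove_range
  have h := tendsto_integral_poissonIntegrand n (z := z) (u := fun k : ℕ => (k + 1 : ℝ))
    (f := fun _ => 0) (fun k => hC ⟨k, rfl⟩) fun x hx => by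
      have h1 := h0.mul_const ((1 - x) ^ (-1 / 2 : ℝ) + (1 + x) ^ (-1 / 2 : ℝ))
      rw [zero_mul] at h1
      exact squeeze_zero_norm (fun k => norm_poissonIntegrand_le n z hx) h1
  simpa using h

open Filter Topology in
lemma tendsto_integral_poissonIntegrand_bot (n : ℕ) {z : ℝ} (hz : 0 < z) :
    Tendsto (fun k : ℕ => ∫ x : ℝ in (-1)..1,
      poissonIntegrand n z (x + (1 / (k + 1) : ℝ) * I)) atTop
      (𝓝 (∫ x : ℝ in (-1)..1, poissonIntegrand n z x)) := by
  have hu : Tendsto (fun k : ℕ => 1 / (k + 1 : ℝ)) atTop (𝓝 0) :=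
    tendsto_one_div_add_atTop_nhds_zero_nat
  refine tendsto_integral_poissonIntegrand n (z := z) (u := fun k : ℕ => 1 / (k + 1 : ℝ))
    (C := 1 * 3 ^ n) (fun k => ?_) fun x hx => ?_
  · have hk : 1 / (k + 1 : ℝ) ≤ 1 := by
      rw [div_le_one (by positivity)]; linarith [k.cast_nonneg (α := ℝ)]
    have hk0 : 0 ≤ 1 / (k + 1 : ℝ) := by positivity
    gcongr
    · rw [Real.exp_le_one_iff, neg_nonpos]; positivity
    · nlinarith
  · have hc : ContinuousAt (poissonIntegrand n z) (x : ℂ) := by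
      refine (differentiableAt_poissonIntegrand n z (Or.inl ?_)).continuousAt
      rw [← ofReal_pow, ← ofReal_one, ← ofReal_sub, ofReal_re]
      nlinarith [hx.1, hx.2]
    refine hc.tendsto.comp ?_
    have h1 : Tendsto (fun k : ℕ => (x : ℂ) + ((1 / (k + 1 : ℝ) : ℝ) : ℂ) * I) atTop
        (𝓝 ((x : ℂ) + ((0 : ℝ) : ℂ) * I)) :=
      (((continuous_ofReal.tendsto 0).comp hu).mul_const I).const_add _
    simpa using h1

open Filter Topology in
/-- The integral defining `J_n` in terms of the integral defining the Hankel functions. -/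
lemma integral_poissonIntegrand (n : ℕ) {z : ℝ} (hz : 0 < z) :
    ∫ x : ℝ in (-1)..1, poissonIntegrand n z x =
      ((2 * (exp (I * (z - π / 4 - n * π / 2 : ℝ)) *
        ∫ y in Set.Ioi 0, hankelIntegrand n z y).re : ℝ) : ℂ) := by
  set K := ∫ y in Set.Ioi 0, hankelIntegrand n z y
  set e := exp (I * (z - ((n : ℝ) - 1 / 2 : ℝ) * π / 2)) with he
  have hK := tendsto_intervalIntegral_one_div_Ioi (integrableOn_hankelIntegrand n hz)
  have hright (k : ℕ) : (∫ y in (1 / (k + 1 : ℝ))..(k + 1 : ℝ),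
      poissonIntegrand n z ((1 : ℝ) + y * I)) =
        e * ∫ y in (1 / (k + 1 : ℝ))..(k + 1 : ℝ), hankelIntegrand n z y := by
    rw [← intervalIntegral.integral_const_mul]
    refine intervalIntegral.integral_congr fun y hy => poissonIntegrand_one_add n z ?_
    exact lt_of_lt_of_le (lt_min (by positivity) (by positivity)) hy.1
  have hleft (k : ℕ) : (∫ y in (1 / (k + 1 : ℝ))..(k + 1 : ℝ),
      poissonIntegrand n z ((-1 : ℝ) + y * I)) =
        (starRingEnd ℂ) (e * ∫ y in (1 / (k + 1 : ℝ))..(k + 1 : ℝ), hankelIntegrand n z y) := by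
    rw [← hright, ← intervalIntegral.intervalIntegral_conj]
    refine intervalIntegral.integral_congr fun y hy => poissonIntegrand_neg_one_add n z ?_
    exact lt_of_lt_of_le (lt_min (by positivity) (by positivity)) hy.1
  have hlim : Tendsto (fun k : ℕ => ∫ x : ℝ in (-1)..1,
      poissonIntegrand n z (x + (1 / (k + 1) : ℝ) * I)) atTop
      (𝓝 (0 - I * (e * K) + I * (starRingEnd ℂ) (e * K))) := by
    have hK' := hK.const_mul e
    refine (((tendsto_integral_poissonIntegrand_top n hz).sub (hK'.const_mul I)).add
      (((continuous_conj.tendsto _).comp hK').const_mul I)).congr fun k => ?_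
    have hk : (1 / (k + 1 : ℝ)) ≤ k + 1 := by
      have : (0 : ℝ) ≤ k := k.cast_nonneg
      rw [div_le_iff₀ (by positivity)]
      nlinarith
    have h := poissonIntegrand_contour n z (by positivity) hk
    rw [hright, hleft] at h
    rw [h]
    simp
  have hphase : exp (I * (z - π / 4 - n * π / 2 : ℝ)) = -I * e := by
    rw [he, ← exp_neg_pi_div_two_mul_I, ← Complex.exp_add]
    congr 1
    push_cast
    ring
  rw [tendsto_nhds_unique (tendsto_integral_poissonIntegrand_bot n hz) hlim, hphase]
  apply Complex.ext
  · simp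
    ring
  · simp

open MeasureTheory in
/-- Hankel's expansion with the remainder controlled by the first neglected term. -/
lemma norm_integral_hankelIntegrand_sub_le (n m : ℕ) {z ν : ℝ} (hz : 0 < z)
    (hν : ν = (n : ℝ) - 1 / 2) :
    ‖(∫ y in Set.Ioi 0, hankelIntegrand n z y) -
        ((2 ^ ν * Real.Gamma (ν + 1) / z ^ (ν + 1) : ℝ) : ℂ) *
          ∑ k ∈ Finset.range m, (binomCoeff ν k : ℂ) * (I / 2) ^ k *
            (((∏ j ∈ Finset.range k, (ν + 1 + j)) / z ^ k : ℝ) : ℂ)‖ ≤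
      2 ^ ν * Real.Gamma (ν + 1) / z ^ (ν + 1) *
        (|binomCoeff ν m| / 2 ^ m * ((∏ j ∈ Finset.range m, (ν + 1 + j)) / z ^ m) *
          (1 + ((ν + 1 + m + 2 * n) / (2 * z)) ^ 2) ^ n) := by
  have hν' : -1 < ν := by linarith [n.cast_nonneg (α := ℝ)]
  have hint (k : ℕ) : IntegrableOn (fun y : ℝ => (binomCoeff ν k : ℂ) * (I / 2) ^ k *
      ((Real.exp (-(z * y)) * (2 * y) ^ ν * y ^ k : ℝ) : ℂ)) (Set.Ioi 0) :=
    ((integrableOn_exp_mul_rpow_mul_pow hz hν' k).ofReal).const_mul _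
  have hsum : ((2 ^ ν * Real.Gamma (ν + 1) / z ^ (ν + 1) : ℝ) : ℂ) *
      ∑ k ∈ Finset.range m, (binomCoeff ν k : ℂ) * (I / 2) ^ k *
        (((∏ j ∈ Finset.range k, (ν + 1 + j)) / z ^ k : ℝ) : ℂ) =
      ∫ y in Set.Ioi (0 : ℝ), ∑ k ∈ Finset.range m, (binomCoeff ν k : ℂ) * (I / 2) ^ k *
        ((Real.exp (-(z * y)) * (2 * y) ^ ν * y ^ k : ℝ) : ℂ) := by
    rw [integral_finsetSum _ fun k _ => hint k, Finset.mul_sum]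
    refine Finset.sum_congr rfl fun k _ => ?_
    rw [integral_const_mul, integral_complex_ofReal, integral_exp_mul_rpow_mul_pow hz hν' k,
      ofReal_mul]
    ring
  rw [hsum, ← integral_sub (integrableOn_hankelIntegrand n hz)
    (integrable_finsetSum _ fun k _ => hint k)]
  have hbound : ∀ y ∈ Set.Ioi (0 : ℝ), ‖hankelIntegrand n z y -
      ∑ k ∈ Finset.range m, (binomCoeff ν k : ℂ) * (I / 2) ^ k *
        ((Real.exp (-(z * y)) * (2 * y) ^ ν * y ^ k : ℝ) : ℂ)‖ ≤
      |binomCoeff ν m| / 2 ^ m *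
        (Real.exp (-(z * y)) * (2 * y) ^ ν * y ^ m * (1 + (y / 2) ^ 2) ^ n) := by
    intro y (hy : 0 < y)
    have heq : hankelIntegrand n z y -
        ∑ k ∈ Finset.range m, (binomCoeff ν k : ℂ) * (I / 2) ^ k *
          ((Real.exp (-(z * y)) * (2 * y) ^ ν * y ^ k : ℝ) : ℂ) =
        ((Real.exp (-(z * y)) * (2 * y) ^ ν : ℝ) : ℂ) * taylorRemainder m ν (y / 2) := by
      rw [hankelIntegrand, taylorRemainder, ← hν, mul_sub, Finset.mul_sum]
      congr 1
      refine Finset.sum_congr rfl fun k _ => ?_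
      push_cast
      rw [div_pow, mul_pow, div_pow]
      ring
    have hT := norm_taylorRemainder_le m ν (y / 2) ((1 + (y / 2) ^ 2) ^ n)
      (fun τ hτ => norm_one_add_I_mul_cpow_le (by linarith [m.cast_nonneg (α := ℝ)]) hτ)
      (τ := y / 2) ⟨by positivity, le_rfl⟩
    rw [heq, norm_mul, norm_real, Real.norm_of_nonneg (by positivity)]
    refine (mul_le_mul_of_nonneg_left hT (by positivity)).trans_eq ?_
    rw [div_pow]
    ring
  refine (norm_integral_le_of_norm_le
    ((integrableOn_exp_mul_rpow_mul_pow_mul_one_add_sq_pow hz hν' m n).const_mul _)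
    ((ae_restrict_mem measurableSet_Ioi).mono hbound)).trans ?_
  rw [integral_const_mul]
  refine (mul_le_mul_of_nonneg_left (integral_exp_mul_rpow_mul_pow_mul_one_add_sq_pow_le
    hz hν' m n) (by positivity)).trans_eq ?_
  ring

lemma sqrt_mul_besselJPlus (n : ℕ) {z ν : ℝ} (hz : 0 < z) (hν : ν = (n : ℝ) - 1 / 2) :
    (Real.sqrt (π * z / 2) : ℂ) * besselJPlus n (z : ℂ) =
      (((exp (I * (z - π / 4 - n * π / 2 : ℝ)) *
        ∫ y in Set.Ioi 0, hankelIntegrand n z y).re /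
          (2 ^ ν * Real.Gamma (ν + 1) / z ^ (ν + 1)) : ℝ) : ℂ) := by
  have hG : 0 < Real.Gamma ((n : ℝ) + 1 / 2) := Real.Gamma_pos_of_pos (by positivity)
  have h := integral_poissonIntegrand n hz
  unfold poissonIntegrand at h
  rw [besselJPlus, h]
  set J := (exp (I * (z - π / 4 - n * π / 2 : ℝ)) * ∫ y in Set.Ioi 0, hankelIntegrand n z y).re
  have h2 : (2 : ℝ) ^ ν = 2 ^ n / √2 := by
    rw [hν, Real.rpow_sub two_pos, Real.rpow_natCast, Real.sqrt_eq_rpow]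
  have hz2 : z ^ (ν + 1) = z ^ n * √z := by
    rw [show ν + 1 = 1 / 2 + n by rw [hν]; ring, Real.rpow_add_natCast hz.ne',
      Real.sqrt_eq_rpow, mul_comm]
  have hs : √(π * z / 2) = √π * √z / √2 := by
    rw [Real.sqrt_div' _ two_pos.le, Real.sqrt_mul pi_pos.le]
  have hΓ : ν + 1 = (n : ℝ) + 1 / 2 := by rw [hν]; ring
  rw [hs, h2, hz2, Real.Gamma_one_half_eq, hΓ]
  have hπ := Real.sqrt_pos.mpr pi_pos
  have hzs := Real.sqrt_pos.mpr hz
  norm_cast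
  have h22 : √2 * √2 = (2 : ℝ) := Real.mul_self_sqrt two_pos.le
  rw [div_pow]
  field_simp
  push_cast
  linear_combination -(2 ^ n * J) * h22

lemma re_hankel_sum {n : ℕ} {z ν ω : ℝ} (hz : 0 < z) (hν : ν = (n : ℝ) - 1 / 2) :
    (exp (I * ω) * ∑ k ∈ Finset.range 4, (binomCoeff ν k : ℂ) * (I / 2) ^ k *
      (((∏ j ∈ Finset.range k, (ν + 1 + j)) / z ^ k : ℝ) : ℂ)).re =
    Real.cos ω + -Real.sin ω * ((n : ℝ) ^ 2 - 1 / 4) / 2 / z +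
      -Real.cos ω * (((n : ℝ) ^ 2 - 1 / 4) * ((n : ℝ) ^ 2 - 9 / 4)) / 8 / z ^ 2 +
      Real.sin ω *
        (((n : ℝ) ^ 2 - 1 / 4) * ((n : ℝ) ^ 2 - 9 / 4) * ((n : ℝ) ^ 2 - 25 / 4)) / 48 / z ^ 3 := by
  have hI3 : (I / 2) ^ 3 = -I / 8 := by
    rw [div_pow, I_pow_three]; norm_num
  have hI2 : (I / 2) ^ 2 = ((-1 / 4 : ℝ) : ℂ) := by
    rw [div_pow, I_sq]; norm_num
  have hexp : exp (I * ω) = (Real.cos ω : ℂ) + (Real.sin ω : ℂ) * I := by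
    rw [mul_comm, exp_mul_I, ofReal_cos, ofReal_sin]
  have hform (C A B D E : ℝ) : ((C : ℂ) + (D : ℂ) * I) *
      ((1 : ℂ) + (A : ℂ) * (I / 2) + (B : ℂ) * ((-1 / 4 : ℝ) : ℂ) + (E : ℂ) * (-I / 8)) =
      ((C - D * A / 2 - C * B / 4 + D * E / 8 : ℝ) : ℂ) +
        ((D + C * A / 2 - D * B / 4 - C * E / 8 : ℝ) : ℂ) * I := by
    push_cast
    linear_combination ((D : ℂ) * A / 2 - (D : ℂ) * E / 8) * I_sq
  have hsum : ∑ k ∈ Finset.range 4, (binomCoeff ν k : ℂ) * (I / 2) ^ k *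
      (((∏ j ∈ Finset.range k, (ν + 1 + j)) / z ^ k : ℝ) : ℂ) =
      (1 : ℂ) + ((ν * (ν + 1) / z : ℝ) : ℂ) * (I / 2) +
        ((ν * (ν - 1) / 2 * ((ν + 1) * (ν + 2)) / z ^ 2 : ℝ) : ℂ) * ((-1 / 4 : ℝ) : ℂ) +
        ((ν * (ν - 1) * (ν - 2) / 6 * ((ν + 1) * (ν + 2) * (ν + 3)) / z ^ 3 : ℝ) : ℂ) *
          (-I / 8) := by
    simp only [Finset.sum_range_succ, Finset.prod_range_succ, Finset.sum_range_zero,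
      Finset.prod_range_zero, binomCoeff, hI3, hI2, Nat.factorial]
    push_cast
    ring
  rw [hsum, hexp, hform]
  simp only [add_re, ofReal_re, mul_re, I_re, ofReal_im, I_im, mul_zero, sub_zero, add_zero,
    mul_one]
  rw [hν]
  field_simp
  ring

lemma abs_sq_sub_le {n N c : ℝ} (hn : 0 ≤ n) (hnN : n ≤ N) (hc : 0 ≤ c) (hcN : c ≤ N ^ 2) :
    |n ^ 2 - c| ≤ N ^ 2 := by
  rw [abs_le]
  constructor <;> nlinarith

lemma abs_binomCoeff_four_mul_le {n N : ℕ} (hN : 20 ≤ N) (hn : n ≤ N) {ν : ℝ}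
    (hν : ν = (n : ℝ) - 1 / 2) :
    |binomCoeff ν 4| / 2 ^ 4 * ∏ j ∈ Finset.range 4, (ν + 1 + j) ≤ (N : ℝ) ^ 8 / 384 := by
  have hnN : (n : ℝ) ≤ N := by exact_mod_cast hn
  have hN' : (20 : ℝ) ≤ N := by exact_mod_cast hN
  have hN2 : (400 : ℝ) ≤ (N : ℝ) ^ 2 := by nlinarith
  have hn0 : (0 : ℝ) ≤ n := n.cast_nonneg
  have hP : 0 ≤ ∏ j ∈ Finset.range 4, (ν + 1 + (j : ℝ)) :=
    Finset.prod_nonneg fun j _ => by linarith [j.cast_nonneg (α := ℝ)]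
  have heq : binomCoeff ν 4 * ∏ j ∈ Finset.range 4, (ν + 1 + (j : ℝ)) =
      ((n : ℝ) ^ 2 - 1 / 4) * ((n : ℝ) ^ 2 - 9 / 4) * ((n : ℝ) ^ 2 - 25 / 4) *
        ((n : ℝ) ^ 2 - 49 / 4) / 24 := by
    simp only [binomCoeff, Finset.prod_range_succ, Finset.prod_range_zero, Nat.factorial, hν]
    push_cast
    ring
  rw [div_mul_eq_mul_div, ← abs_of_nonneg hP, ← abs_mul, heq, abs_div, abs_mul,
    abs_mul, abs_mul]
  have h1 := abs_sq_sub_le hn0 hnN (c := 1 / 4) (by norm_num) (by linarith)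
  have h2 := abs_sq_sub_le hn0 hnN (c := 9 / 4) (by norm_num) (by linarith)
  have h3 := abs_sq_sub_le hn0 hnN (c := 25 / 4) (by norm_num) (by linarith)
  have h4 := abs_sq_sub_le hn0 hnN (c := 49 / 4) (by norm_num) (by linarith)
  calc _ ≤ (N : ℝ) ^ 2 * (N : ℝ) ^ 2 * (N : ℝ) ^ 2 * (N : ℝ) ^ 2 / |24| / 2 ^ 4 := by gcongr
    _ = _ := by norm_num; ring

lemma sixteen_mul_pow_three_le_sq {N : ℕ} (hN : 20 ≤ N) {z : ℝ}
    (hz : 2 * (N : ℝ) ^ ((3 : ℝ) / 2) * Real.log N < z) :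
    0 < z ∧ 16 * (N : ℝ) ^ 3 ≤ z ^ 2 := by
  have hN' : (20 : ℝ) ≤ N := by exact_mod_cast hN
  have hlog : 2 ≤ Real.log N := by
    rw [Real.le_log_iff_exp_le (by linarith), show (2 : ℝ) = 1 + 1 by norm_num, Real.exp_add]
    nlinarith [Real.exp_one_lt_d9, Real.exp_pos 1]
  have hpow : 0 < (N : ℝ) ^ ((3 : ℝ) / 2) := Real.rpow_pos_of_pos (by linarith) _
  have hsq : ((N : ℝ) ^ ((3 : ℝ) / 2)) ^ 2 = (N : ℝ) ^ 3 := by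
    rw [← Real.rpow_mul_natCast (by linarith), ← Real.rpow_natCast]
    norm_num
  have h4 : 4 * (N : ℝ) ^ ((3 : ℝ) / 2) ≤ z := by nlinarith
  exact ⟨by linarith, by nlinarith⟩

lemma one_add_sq_pow_le {N n : ℕ} (hN : 20 ≤ N) (hn : n ≤ N) {z ν : ℝ} (hz : 0 < z)
    (hzN : 16 * (N : ℝ) ^ 3 ≤ z ^ 2) (hν : ν = (n : ℝ) - 1 / 2) :
    (1 + ((ν + 1 + (4 : ℕ) + 2 * n) / (2 * z)) ^ 2) ^ n ≤ 1.65 := by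
  have hnN : (n : ℝ) ≤ N := by exact_mod_cast hn
  have hN' : (20 : ℝ) ≤ N := by exact_mod_cast hN
  have hn0 : (0 : ℝ) ≤ n := n.cast_nonneg
  have hsq : (ν + 1 + (4 : ℕ) + 2 * n) ^ 2 ≤ 12 * (N : ℝ) ^ 2 := by
    push_cast
    have : ν + 1 + 4 + 2 * n ≤ 3.25 * N := by rw [hν]; linarith
    have h0 : 0 ≤ ν + 1 + 4 + 2 * n := by rw [hν]; linarith
    nlinarith
  have hx : ((ν + 1 + (4 : ℕ) + 2 * n) / (2 * z)) ^ 2 ≤ 0.2 / N := by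
    rw [div_pow, div_le_div_iff₀ (by positivity) (by positivity)]
    calc _ ≤ 12 * (N : ℝ) ^ 2 * N := by gcongr
      _ ≤ _ := by nlinarith [pow_nonneg (N.cast_nonneg (α := ℝ)) 3]
  have hone := Real.add_one_le_exp (((ν + 1 + (4 : ℕ) + 2 * n) / (2 * z)) ^ 2)
  calc (1 + ((ν + 1 + (4 : ℕ) + 2 * n) / (2 * z)) ^ 2) ^ n
      ≤ Real.exp (((ν + 1 + (4 : ℕ) + 2 * n) / (2 * z)) ^ 2) ^ n := by
        gcongr; linarith
    _ = Real.exp (n * ((ν + 1 + (4 : ℕ) + 2 * n) / (2 * z)) ^ 2) := (Real.exp_nat_mul _ _).symm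
    _ ≤ Real.exp 0.2 := by
        gcongr
        calc (n : ℝ) * ((ν + 1 + (4 : ℕ) + 2 * n) / (2 * z)) ^ 2 ≤ N * (0.2 / N) := by gcongr
          _ = 0.2 := by field_simp
    _ ≤ 1.65 := by
        have h1 : Real.exp (-0.2) * Real.exp 0.2 = 1 := by rw [← Real.exp_add]; norm_num
        have h2 := Real.add_one_le_exp (-0.2)
        nlinarith [Real.exp_pos 0.2]

/-- Fourth-order expansion of the Bessel function on the real line: for `N ≥ 20`,
`0 ≤ n ≤ N`, and real `z > 2 N^{3/2} ln N`, with `ω = z − π/4 − nπ/2`,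
`a = cos ω`, `b = −sin ω (n²−1/4)/2`, `c = −cos ω (n²−1/4)(n²−9/4)/8`,
`d = sin ω (n²−1/4)(n²−9/4)(n²−25/4)/48`, one has
`|(πz/2)^{1/2} J_n^+(z) − (a + b/z + c/z² + d/z³)| ≤ 0.0043 N⁸/z⁴`. -/
theorem besselJPlus_fourth_order (N : ℕ) (hN : 20 ≤ N) (n : ℕ) (hn : n ≤ N) (z : ℝ)
    (hz : 2 * (N : ℝ) ^ ((3 : ℝ) / 2) * Real.log N < z) (ω a b c d : ℝ)
    (hω : ω = z - Real.pi / 4 - n * Real.pi / 2)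
    (ha : a = Real.cos ω)
    (hb : b = -Real.sin ω * ((n : ℝ) ^ 2 - 1 / 4) / 2)
    (hc : c = -Real.cos ω * (((n : ℝ) ^ 2 - 1 / 4) * ((n : ℝ) ^ 2 - 9 / 4)) / 8)
    (hd : d = Real.sin ω *
      (((n : ℝ) ^ 2 - 1 / 4) * ((n : ℝ) ^ 2 - 9 / 4) * ((n : ℝ) ^ 2 - 25 / 4)) / 48) :
    ‖(Real.sqrt (Real.pi * z / 2) : ℂ) * besselJPlus n (z : ℂ) -
        ((a + b / z + c / z ^ 2 + d / z ^ 3 : ℝ) : ℂ)‖ ≤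
      0.0043 * (N : ℝ) ^ 8 / z ^ 4 := by
  obtain ⟨hz0, hzN⟩ := sixteen_mul_pow_three_le_sq hN hz
  obtain ⟨ν, hν⟩ : ∃ ν : ℝ, ν = (n : ℝ) - 1 / 2 := ⟨_, rfl⟩
  have hν0 : 0 < ν + 1 := by linarith [n.cast_nonneg (α := ℝ)]
  have hmain := norm_integral_hankelIntegrand_sub_le n 4 hz0 hν
  have hsum := re_hankel_sum (ω := ω) hz0 hν
  rw [← hd, ← hc, ← hb, ← ha] at hsum
  rw [sqrt_mul_besselJPlus n hz0 hν, ← hω, ← hsum]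
  set P := 2 ^ ν * Real.Gamma (ν + 1) / z ^ (ν + 1) with hPdef
  have hP : 0 < P := by
    have := Real.Gamma_pos_of_pos hν0
    positivity
  set K := ∫ y in Set.Ioi 0, hankelIntegrand n z y
  set S := ∑ k ∈ Finset.range 4, (binomCoeff ν k : ℂ) * (I / 2) ^ k *
    (((∏ j ∈ Finset.range k, (ν + 1 + j)) / z ^ k : ℝ) : ℂ)
  have hdiff : (exp (I * ω) * K).re / P - (exp (I * ω) * S).re =
      (exp (I * ω) * (K - P * S)).re / P := by
    rw [mul_sub, sub_re, show exp (I * ω) * (P * S) = P * (exp (I * ω) * S) by ring, re_ofReal_mul]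
    field_simp
  rw [← ofReal_sub, norm_real, Real.norm_eq_abs, hdiff, abs_div, abs_of_pos hP, div_le_iff₀ hP]
  have hnorm : |(exp (I * ω) * (K - P * S)).re| ≤ ‖K - P * S‖ := by
    refine (abs_re_le_norm _).trans_eq ?_
    rw [norm_mul, mul_comm I, norm_exp_ofReal_mul_I, one_mul]
  refine hnorm.trans (hmain.trans ?_)
  rw [mul_comm P]
  gcongr
  calc _ = (|binomCoeff ν 4| / 2 ^ 4 * ∏ j ∈ Finset.range 4, (ν + 1 + (j : ℝ))) / z ^ 4 *
        (1 + ((ν + 1 + (4 : ℕ) + 2 * n) / (2 * z)) ^ 2) ^ n := by ring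
    _ ≤ (N : ℝ) ^ 8 / 384 / z ^ 4 * 1.65 := by
        gcongr
        · exact abs_binomCoeff_four_mul_le hN hn hν
        · exact one_add_sq_pow_le hN hn hz0 hzN hν
    _ ≤ 0.0043 * (N : ℝ) ^ 8 / z ^ 4 := by
        have : 0 ≤ (N : ℝ) ^ 8 / z ^ 4 := by positivity
        rw [div_right_comm, mul_div_assoc]
        linarith
end

section
/- Oscillatory tail bound via parity: let n_1, …, n_6 be integers with n_1 + ⋯ + n_6 even, and for each j let φ_j be either the sine or the cosine function, with the number of indices j for which φ_j = sin being odd. Set ω_j(z) := z − π/4 − n_j π/2. Then for every T > 0, | ∫_T^∞ ∏_{j=1}^{6} φ_j(ω_j(z)) · z^{−5} dz | ≤ (π + 1) · T^{−5}. -/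
open Real

section TailBounds

open MeasureTheory Set Filter Topology

theorem integrableOn_Ioi_one_div_pow (k : ℕ) {T : ℝ} (hT : 0 < T) :
    IntegrableOn (fun z : ℝ => 1 / z ^ (k + 2)) (Ioi T) := by
  have h : (-((k + 2 : ℕ) : ℝ)) < -1 := by
    push_cast
    linarith [(Nat.cast_nonneg k : (0 : ℝ) ≤ k)]
  refine (integrableOn_Ioi_rpow_of_lt h hT).congr_fun (fun z hz => ?_) measurableSet_Ioi
  simp only [rpow_neg (hT.trans hz).le, rpow_natCast, one_div]

theorem integral_Ioi_one_div_pow (k : ℕ) {T : ℝ} (hT : 0 < T) :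
    ∫ z in Ioi T, 1 / z ^ (k + 2) = 1 / ((k + 1) * T ^ (k + 1)) := by
  have h : (-((k + 2 : ℕ) : ℝ)) < -1 := by
    push_cast
    linarith [(Nat.cast_nonneg k : (0 : ℝ) ≤ k)]
  have e : ∫ z in Ioi T, 1 / z ^ (k + 2) = ∫ z in Ioi T, z ^ (-((k + 2 : ℕ) : ℝ)) := by
    refine setIntegral_congr_fun measurableSet_Ioi (fun z hz => ?_)
    simp only [rpow_neg (hT.trans hz).le, rpow_natCast, one_div]
  have e2 : -((k + 2 : ℕ) : ℝ) + 1 = -((k + 1 : ℕ) : ℝ) := by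
    push_cast
    ring
  rw [e, integral_Ioi_rpow_of_lt h hT, e2, rpow_neg hT.le, rpow_natCast, neg_div_neg_eq]
  push_cast
  field_simp

theorem integrableOn_Ioi_div_pow_of_bounded (k : ℕ) {T C : ℝ} (hT : 0 < T) {f : ℝ → ℝ}
    (hf : Continuous f) (hC : ∀ z, |f z| ≤ C) :
    IntegrableOn (fun z => f z / z ^ (k + 2)) (Ioi T) := by
  have h := (integrableOn_Ioi_one_div_pow k hT).bdd_mul (c := C) hf.aestronglyMeasurable
    (Eventually.of_forall hC)
  simpa [IntegrableOn, div_eq_mul_inv] using h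

/-- A bounded primitive `F` of `f` controls the tails of `f z / z ^ (k + 2)`. -/
theorem abs_integral_Ioi_div_pow_le (k : ℕ) {T M C : ℝ} (hT : 0 < T) {f F : ℝ → ℝ}
    (hf : Continuous f) (hM : ∀ z, |f z| ≤ M) (hF : ∀ z, HasDerivAt F (f z) z)
    (hC : ∀ z, |F z| ≤ C) :
    |∫ z in Ioi T, f z / z ^ (k + 2)| ≤ 2 * C / T ^ (k + 2) := by
  have hFc : Continuous F := continuous_iff_continuousAt.2 fun z => (hF z).continuousAt
  have i1 := integrableOn_Ioi_div_pow_of_bounded k hT hf hM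
  have i2 := integrableOn_Ioi_div_pow_of_bounded (k + 1) hT hFc hC
  have hd : ∀ z ∈ Ici T, HasDerivAt (fun z => F z / z ^ (k + 2))
      (f z / z ^ (k + 2) - (k + 2) * (F z / z ^ (k + 1 + 2))) z := by
    intro z hz
    have hz0 : z ≠ 0 := (hT.trans_le hz).ne'
    refine ((hF z).div (hasDerivAt_pow (k + 2) z) (pow_ne_zero _ hz0)).congr_deriv ?_
    push_cast
    field_simp
    ring
  have hlim : Tendsto (fun z => F z / z ^ (k + 2)) atTop (𝓝 0) := by
    refine squeeze_zero_norm' (a := fun z => C / z ^ (k + 2)) ?_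
      ((tendsto_pow_atTop (by omega)).const_div_atTop C)
    filter_upwards [eventually_gt_atTop 0] with z hz
    rw [norm_div, norm_of_nonneg (pow_pos hz _).le]
    exact div_le_div_of_nonneg_right (hC z) (pow_pos hz _).le
  have key := integral_Ioi_of_hasDerivAt_of_tendsto' hd (i1.sub (i2.const_mul _)) hlim
  rw [integral_sub i1 (i2.const_mul _), integral_const_mul] at key
  have b1 : |F T / T ^ (k + 2)| ≤ C / T ^ (k + 2) := by
    rw [abs_div, abs_of_pos (pow_pos hT _)]
    exact div_le_div_of_nonneg_right (hC T) (pow_pos hT _).le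
  have b2 : |∫ z in Ioi T, F z / z ^ (k + 1 + 2)| ≤ C * (1 / ((k + 2) * T ^ (k + 2))) := by
    have e := integral_Ioi_one_div_pow (k + 1) hT
    have e' : ((k + 1 : ℕ) : ℝ) + 1 = k + 2 := by
      push_cast
      ring
    rw [e'] at e
    rw [← e, ← integral_const_mul, ← norm_eq_abs]
    refine norm_integral_le_of_norm_le ((integrableOn_Ioi_one_div_pow (k + 1) hT).const_mul C) ?_
    filter_upwards [ae_restrict_mem measurableSet_Ioi] with z hz
    have hz0 : 0 < z := hT.trans hz
    rw [norm_div, norm_of_nonneg (pow_pos hz0 _).le, mul_one_div]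
    exact div_le_div_of_nonneg_right (hC z) (pow_pos hz0 _).le
  have hk : (0 : ℝ) < k + 2 := by positivity
  have b3 : |(k + 2) * ∫ z in Ioi T, F z / z ^ (k + 1 + 2)| ≤ C / T ^ (k + 2) := by
    rw [abs_mul, abs_of_pos hk]
    calc _ ≤ (k + 2) * (C * (1 / ((k + 2) * T ^ (k + 2)))) := by gcongr
      _ = C / T ^ (k + 2) := by field_simp
  have e3 : 2 * C / T ^ (k + 2) = C / T ^ (k + 2) + C / T ^ (k + 2) := by ring
  rw [e3]
  rw [abs_le] at *
  constructor <;> linarith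

end TailBounds

/-- Shifting sine or cosine by `m` quarter periods exchanges them, up to sign, iff `m` is odd. -/
theorem exists_sign_sin_cos_sub_int_mul_pi_div_two (b : Bool) (m : ℤ) :
    ∃ ε : ℝ, |ε| = 1 ∧ ∃ t : Bool,
      (∀ u : ℝ, (if b then sin else cos) (u - m * π / 2) = ε * if t then sin u else cos u) ∧
      Even ((if t then 1 else 0 : ℤ) - (if b then 1 else 0) - m) := by
  obtain ⟨k, rfl | rfl⟩ := Int.even_or_odd' m
  · refine ⟨(-1) ^ k, by simp [abs_zpow], b, fun u => ?_, by simp⟩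
    have e : u - ((2 * k : ℤ) : ℝ) * π / 2 = u - k * π := by
      push_cast
      ring
    rw [e]
    cases b <;> simp [sin_sub_int_mul_pi, cos_sub_int_mul_pi]
  · have e (u : ℝ) : u - ((2 * k + 1 : ℤ) : ℝ) * π / 2 = u - π / 2 - k * π := by
      push_cast
      ring
    cases b
    · refine ⟨(-1) ^ k, by simp [abs_zpow], true, fun u => ?_, ⟨-k, by simp; ring⟩⟩
      rw [e]
      simp [cos_sub_int_mul_pi, cos_sub_pi_div_two]
    · refine ⟨-(-1) ^ k, by simp [abs_zpow], false, fun u => ?_, ⟨-k - 1, by simp; ring⟩⟩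
      rw [e]
      simp [sin_sub_int_mul_pi, sin_sub_pi_div_two]

theorem exists_bounded_primitive_sin_pow_mul_cos_pow {a : ℕ} (ha : Odd a) (h6 : a ≤ 6) :
    ∃ F : ℝ → ℝ, (∀ u, HasDerivAt F (sin u ^ a * cos u ^ (6 - a)) u) ∧ ∀ u, |F u| ≤ 1 := by
  have hs (u : ℝ) : 0 ≤ sin u ^ 2 ∧ sin u ^ 2 ≤ 1 := ⟨sq_nonneg _, sin_sq_le_one u⟩
  have hc (u : ℝ) : 0 ≤ cos u ^ 2 ∧ cos u ^ 2 ≤ 1 := ⟨sq_nonneg _, cos_sq_le_one u⟩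
  have h4 (u : ℝ) : 0 ≤ (sin u ^ 2) ^ 2 ∧ (sin u ^ 2) ^ 2 ≤ 1 :=
    ⟨by positivity, pow_le_one₀ (hs u).1 (hs u).2⟩
  have h6s (u : ℝ) : 0 ≤ (sin u ^ 2) ^ 3 ∧ (sin u ^ 2) ^ 3 ≤ 1 :=
    ⟨by positivity, pow_le_one₀ (hs u).1 (hs u).2⟩
  have h6c (u : ℝ) : 0 ≤ (cos u ^ 2) ^ 3 ∧ (cos u ^ 2) ^ 3 ≤ 1 :=
    ⟨by positivity, pow_le_one₀ (hc u).1 (hc u).2⟩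
  have hcases : a = 1 ∨ a = 3 ∨ a = 5 := by
    obtain ⟨k, rfl⟩ := ha
    omega
  rcases hcases with rfl | rfl | rfl
  · refine ⟨fun u => -(cos u ^ 6 / 6), fun u => ?_, fun u => ?_⟩
    · refine (((hasDerivAt_cos u).pow 6).div_const 6).neg.congr_deriv ?_
      norm_num
      ring
    · have := h6c u
      rw [abs_le]
      constructor <;> nlinarith
  · refine ⟨fun u => sin u ^ 4 / 4 - sin u ^ 6 / 6, fun u => ?_, fun u => ?_⟩
    · refine ((((hasDerivAt_sin u).pow 4).div_const 4).sub
        (((hasDerivAt_sin u).pow 6).div_const 6)).congr_deriv ?_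
      have e : cos u ^ (6 - 3) = (1 - sin u ^ 2) * cos u := by
        rw [← cos_sq']
        ring
      rw [e]
      norm_num
      ring
    · have := h6s u
      have := h4 u
      rw [abs_le]
      constructor <;> nlinarith
  · refine ⟨fun u => sin u ^ 6 / 6, fun u => ?_, fun u => ?_⟩
    · refine (((hasDerivAt_sin u).pow 6).div_const 6).congr_deriv ?_
      norm_num
      ring
    · have := h6s u
      rw [abs_le]
      constructor <;> nlinarith

/-- Oscillatory tail bound via parity: let `n_1, …, n_6` be integers with even sum, and for
each `j` let `φ_j` be sine (if `s j = true`) or cosine (if `s j = false`), with an odd number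
of sines. With `ω_j(z) = z − π/4 − n_j π/2`, for every `T > 0`,
`|∫_T^∞ ∏_j φ_j(ω_j(z)) z^{−5} dz| ≤ (π+1) T^{−5}`. -/
theorem oscillatory_tail_bound (n : Fin 6 → ℤ) (hsum : Even (∑ j, n j))
    (s : Fin 6 → Bool) (φ : Fin 6 → (ℝ → ℝ))
    (hφ : ∀ j, φ j = if s j then Real.sin else Real.cos)
    (hodd : Odd (Finset.univ.filter fun j => s j = true).card)
    (T : ℝ) (hT : 0 < T) :
    |∫ z in Set.Ioi T, (∏ j, φ j (z - Real.pi / 4 - n j * Real.pi / 2)) / z ^ 5| ≤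
      (Real.pi + 1) / T ^ 5 := by
  have hloc (j : Fin 6) := exists_sign_sin_cos_sub_int_mul_pi_div_two (s j) (n j)
  choose ε hε t ht hpar using hloc
  set a := (Finset.univ.filter fun j => t j = true).card with ha
  have hcard : Odd a := by
    have h1 : Even (∑ j, ((if t j then 1 else 0 : ℤ) - (if s j then 1 else 0) - n j)) :=
      Finset.even_sum _ fun j _ => hpar j
    rw [Finset.sum_sub_distrib, Finset.sum_sub_distrib, Finset.sum_boole, Finset.sum_boole] at h1
    have h2 : Odd ((Finset.univ.filter fun j => s j = true).card : ℤ) := by exact_mod_cast hodd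
    have h3 : Odd (a : ℤ) := by grind
    exact_mod_cast h3
  have h6 : a ≤ 6 := by simpa using Finset.card_le_univ (Finset.univ.filter fun j => t j = true)
  obtain ⟨F, hF, hF1⟩ := exists_bounded_primitive_sin_pow_mul_cos_pow hcard h6
  have hprod (z : ℝ) : ∏ j, φ j (z - π / 4 - n j * π / 2) =
      (∏ j, ε j) * (sin (z - π / 4) ^ a * cos (z - π / 4) ^ (6 - a)) := by
    have hb : (Finset.univ.filter fun j => ¬ t j = true).card = 6 - a := by
      have := Finset.card_filter_add_card_filter_not (s := Finset.univ) (fun j => t j = true)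
      simp only [Finset.card_univ, Fintype.card_fin] at this
      omega
    simp only [hφ, ht, Finset.prod_mul_distrib, Finset.prod_ite, Finset.prod_const, hb, ← ha]
  have hεp : |∏ j, ε j| = 1 := by simp [Finset.abs_prod, hε]
  simp only [hprod]
  have main := abs_integral_Ioi_div_pow_le 3 (M := 1) (C := 1) hT
    (f := fun z => (∏ j, ε j) * (sin (z - π / 4) ^ a * cos (z - π / 4) ^ (6 - a)))
    (F := fun z => (∏ j, ε j) * F (z - π / 4)) (by fun_prop)
    (fun z => by
      rw [abs_mul, hεp, one_mul, abs_mul, abs_pow, abs_pow]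
      exact mul_le_one₀ (pow_le_one₀ (abs_nonneg _) (abs_sin_le_one _)) (by positivity)
        (pow_le_one₀ (abs_nonneg _) (abs_cos_le_one _)))
    (fun z => ((hF (z - π / 4)).comp_sub_const z (π / 4)).const_mul _)
    (fun z => by simpa [abs_mul, hεp] using hF1 (z - π / 4))
  refine main.trans ?_
  gcongr
  linarith [pi_gt_three]
end

section
/- Tail approximation by the asymptotic expansion: let N ≥ 20, let T ≥ 10N², and let n_1, …, n_6 be integers with 0 ≤ n_j ≤ N for each j and n_1 + ⋯ + n_6 even. For real z set ω_j := z − π/4 − n_j π/2 and define A(z) := ∏_{j=1}^{6} cos(ω_j); B(z) := −Σ_{j'=1}^{6} ((n_{j'}²−1/4)/2) · sin(ω_{j'}) · ∏_{j≠j'} cos(ω_j); C(z) := Σ_{1≤j'<j''≤6} ((n_{j'}²−1/4)(n_{j''}²−1/4)/4) · sin(ω_{j'}) sin(ω_{j''}) · ∏_{j≠j', j≠j''} cos(ω_j) − (1/8)·[Σ_{j=1}^{6} (n_j²−1/4)(n_j²−9/4)] · ∏_{j=1}^{6} cos(ω_j). Then | ∫_T^∞ ∏_{j=1}^{6} J_{n_j}(z)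 · z dz − (2/π)³ ∫_T^∞ (A(z) z^{−2} + B(z) z^{−3} + C(z) z^{−4}) dz | ≤ 19 N⁶ T^{−5} + 0.68 N⁸ T^{−5} + 0.35 N^{10} T^{−6} + 0.13 N^{12} T^{−7} + 16 N^{14} T^{−8}. -/
open Real Complex

/-- The Bessel function of integer order `n`, defined by the integral representation
`J_n(z) = (1/(2π)) ∫_0^{2π} e^{i z sin θ} e^{i n θ} dθ`. -/
noncomputable def besselJ (n : ℤ) (z : ℂ) : ℂ :=
  (1 / (2 * (Real.pi : ℂ))) * ∫ θ in (0:ℝ)..(2 * Real.pi),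
    Complex.exp (Complex.I * z * (Real.sin θ : ℂ)) * Complex.exp (Complex.I * (n : ℂ) * (θ : ℂ))

open Filter Topology

/-- Differentiation of `∫ a(θ) cos(z sin θ + b(θ)) dθ` in the parameter `z`. -/
lemma hasDerivAt_integral_cos {a b : ℝ → ℝ} (ha : Continuous a) (hb : Continuous b) (z : ℝ) :
    HasDerivAt (fun z => ∫ θ in (0:ℝ)..(2 * π), a θ * Real.cos (z * Real.sin θ + b θ))
      (∫ θ in (0:ℝ)..(2 * π), a θ * Real.sin θ * Real.cos (z * Real.sin θ + (b θ + π / 2))) z := by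
  refine (intervalIntegral.hasDerivAt_integral_of_dominated_loc_of_deriv_le
    (F := fun z θ => a θ * Real.cos (z * Real.sin θ + b θ))
    (F' := fun z θ => a θ * Real.sin θ * Real.cos (z * Real.sin θ + (b θ + π / 2)))
    (bound := fun θ => |a θ|) (s := Set.univ) Filter.univ_mem ?_ ?_ ?_ ?_ ?_ ?_).2
  · exact .of_forall fun x => (by fun_prop : Continuous _).aestronglyMeasurable
  · exact (by fun_prop : Continuous _).intervalIntegrable _ _
  · exact (by fun_prop : Continuous _).aestronglyMeasurable
  · refine .of_forall fun θ _ x _ => ?_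
    rw [Real.norm_eq_abs, abs_mul, abs_mul, mul_assoc]
    exact mul_le_of_le_one_right (abs_nonneg _)
      (mul_le_one₀ (Real.abs_sin_le_one _) (abs_nonneg _) (Real.abs_cos_le_one _))
  · exact (by fun_prop : Continuous _).intervalIntegrable _ _
  · refine .of_forall fun θ _ x _ => ?_
    have h := ((((hasDerivAt_id x).mul_const (Real.sin θ)).add_const (b θ)).cos).const_mul (a θ)
    refine h.congr_deriv ?_
    rw [← add_assoc, Real.cos_add_pi_div_two]
    simp; ring

/-- The real form of the integral `besselJ n z` at real `z`. -/
noncomputable def realBesselJ (n : ℤ) (z : ℝ) : ℝ :=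
  (1 / (2 * π)) * ∫ θ in (0:ℝ)..(2 * π), Real.cos (z * Real.sin θ + n * θ)

/-- The derivative of `realBesselJ n`. -/
noncomputable def realBesselJDeriv (n : ℤ) (z : ℝ) : ℝ :=
  (1 / (2 * π)) * ∫ θ in (0:ℝ)..(2 * π), Real.sin θ * Real.cos (z * Real.sin θ + (n * θ + π / 2))

/-- The second derivative of `realBesselJ n`. -/
noncomputable def realBesselJDerivDeriv (n : ℤ) (z : ℝ) : ℝ :=
  (1 / (2 * π)) * ∫ θ in (0:ℝ)..(2 * π),
    Real.sin θ * Real.sin θ * Real.cos (z * Real.sin θ + (n * θ + π / 2 + π / 2))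

lemma hasDerivAt_realBesselJ (n : ℤ) (z : ℝ) :
    HasDerivAt (realBesselJ n) (realBesselJDeriv n z) z := by
  have h := hasDerivAt_integral_cos (a := fun _ => 1) (b := fun θ => n * θ)
    (by fun_prop) (by fun_prop) z
  simp only [one_mul] at h
  exact h.const_mul _

lemma hasDerivAt_realBesselJDeriv (n : ℤ) (z : ℝ) :
    HasDerivAt (realBesselJDeriv n) (realBesselJDerivDeriv n z) z :=
  (hasDerivAt_integral_cos (a := Real.sin) (b := fun θ => n * θ + π / 2)
    (by fun_prop) (by fun_prop) z).const_mul _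

/-- Bessel's differential equation. -/
lemma bessel_equation (n : ℤ) (z : ℝ) :
    z ^ 2 * realBesselJDerivDeriv n z + z * realBesselJDeriv n z
      + (z ^ 2 - n ^ 2) * realBesselJ n z = 0 := by
  have key : ∫ θ in (0:ℝ)..(2 * π), (z ^ 2 * (Real.sin θ * Real.sin θ *
        Real.cos (z * Real.sin θ + (n * θ + π / 2 + π / 2)))
      + z * (Real.sin θ * Real.cos (z * Real.sin θ + (n * θ + π / 2)))
      + (z ^ 2 - n ^ 2) * Real.cos (z * Real.sin θ + n * θ)) = 0 := by
    rw [intervalIntegral.integral_eq_sub_of_hasDerivAt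
      (f := fun θ => (z * Real.cos θ - n) * Real.sin (z * Real.sin θ + n * θ))]
    · have : Real.sin (n * (2 * π)) = 0 := by
        have := Real.sin_int_mul_pi (2 * n)
        push_cast at this
        rwa [mul_comm (2:ℝ), mul_assoc] at this
      simp [this]
    · intro θ _
      have h1 := ((Real.hasDerivAt_cos θ).const_mul z).sub_const (n : ℝ)
      have h2 := (((Real.hasDerivAt_sin θ).const_mul z).add
        ((hasDerivAt_id θ).const_mul (n : ℝ))).sin
      refine (h1.mul h2).congr_deriv ?_
      rw [show z * Real.sin θ + (n * θ + π / 2 + π / 2) = z * Real.sin θ + n * θ + π by ring,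
        ← add_assoc, Real.cos_add_pi_div_two, Real.cos_add_pi]
      simp only [id, Pi.add_apply]
      have := Real.sin_sq_add_cos_sq θ
      linear_combination (z ^ 2 * Real.cos (z * Real.sin θ + n * θ)) * this
    · exact (by fun_prop : Continuous _).intervalIntegrable _ _
  rw [intervalIntegral.integral_add, intervalIntegral.integral_add,
    intervalIntegral.integral_const_mul, intervalIntegral.integral_const_mul,
    intervalIntegral.integral_const_mul] at key
  · unfold realBesselJDerivDeriv realBesselJDeriv realBesselJ
    linear_combination (1 / (2 * π)) * key
  all_goals exact (by fun_prop : Continuous _).intervalIntegrable _ _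

/-- The normalised Bessel function `√z J_n(z)`. -/
noncomputable def besselU (n : ℤ) (z : ℝ) : ℝ := √z * realBesselJ n z

/-- The derivative of `besselU n` on the positive half-line. -/
noncomputable def besselUDeriv (n : ℤ) (z : ℝ) : ℝ :=
  √z * realBesselJDeriv n z + realBesselJ n z / (2 * √z)

lemma hasDerivAt_besselU (n : ℤ) {z : ℝ} (hz : 0 < z) :
    HasDerivAt (besselU n) (besselUDeriv n z) z := by
  refine ((Real.hasDerivAt_sqrt hz.ne').mul (hasDerivAt_realBesselJ n z)).congr_deriv ?_
  unfold besselUDeriv; ring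

lemma hasDerivAt_besselUDeriv (n : ℤ) {z : ℝ} (hz : 0 < z) :
    HasDerivAt (besselUDeriv n) (-(1 - (n ^ 2 - 1 / 4) / z ^ 2) * besselU n z) z := by
  have hs : √z ≠ 0 := (Real.sqrt_pos.2 hz).ne'
  have h1 := (Real.hasDerivAt_sqrt hz.ne').mul (hasDerivAt_realBesselJDeriv n z)
  have h2 := (hasDerivAt_realBesselJ n z).div ((Real.hasDerivAt_sqrt hz.ne').const_mul 2)
    (by positivity)
  refine (h1.add h2).congr_deriv ?_
  have hb := bessel_equation n z
  unfold besselU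
  obtain ⟨s, hs', rfl⟩ : ∃ s, s ≠ 0 ∧ s ^ 2 = z := ⟨√z, hs, Real.sq_sqrt hz.le⟩
  have : √(s ^ 2) ^ 2 = s ^ 2 := Real.sq_sqrt hz.le
  generalize √(s ^ 2) = r at *
  field_simp
  have h4 : r ^ 4 = s ^ 4 := by rw [show r ^ 4 = (r ^ 2) ^ 2 by ring, this]; ring
  have h3 : r ^ 3 = r * s ^ 2 := by rw [← this]; ring
  grind

lemma besselJ_ofReal (n : ℤ) (z : ℝ) : besselJ n z = realBesselJ n z := by
  unfold besselJ
  have h0 : ∀ θ : ℝ, Complex.exp (Complex.I * z * (Real.sin θ : ℂ)) *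
      Complex.exp (Complex.I * (n : ℂ) * (θ : ℂ)) =
      ((Real.cos (z * Real.sin θ + n * θ) : ℝ) : ℂ) +
        ((Real.sin (z * Real.sin θ + n * θ) : ℝ) : ℂ) * Complex.I := by
    intro θ
    rw [← Complex.exp_add, Complex.ofReal_cos (_ + _), Complex.ofReal_sin (_ + _),
      ← Complex.exp_mul_I]
    congr 1; push_cast; ring
  have h1 : ∫ θ in (0:ℝ)..(2 * π), Real.sin (z * Real.sin θ + n * θ) = 0 := by
    have h := intervalIntegral.integral_comp_sub_left (a := 0) (b := 2 * π)
      (fun θ => Real.sin (z * Real.sin θ + n * θ)) (2 * π)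
    have h2 : ∀ θ : ℝ, Real.sin (z * Real.sin (2 * π - θ) + n * (2 * π - θ)) =
        - Real.sin (z * Real.sin θ + n * θ) := by
      intro θ
      rw [Real.sin_two_pi_sub, ← Real.sin_neg (_ + _), ← Real.sin_sub_int_mul_two_pi _ n]
      congr 1; ring
    simp only [h2, intervalIntegral.integral_neg, sub_self, sub_zero] at h
    linarith
  simp_rw [h0]
  rw [intervalIntegral.integral_add, intervalIntegral.integral_mul_const,
    intervalIntegral.integral_ofReal, intervalIntegral.integral_ofReal, h1]
  · unfold realBesselJ; simp
  all_goals exact (by fun_prop : Continuous _).intervalIntegrable _ _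

/-- For `f'' + f = p`, the function `e^{-it}(f' + i f)` has derivative `e^{-it} p`. -/
lemma hasDerivAt_exp_mul_deriv_add {f f' : ℝ → ℝ} {p z : ℝ} (hf : HasDerivAt f (f' z) z)
    (hf' : HasDerivAt f' (-f z + p) z) :
    HasDerivAt (fun t : ℝ => cexp (-(I * t)) * ((f' t : ℂ) + I * f t)) (cexp (-(I * z)) * p) z := by
  have h1 : HasDerivAt (fun t : ℝ => cexp (-(I * t))) (cexp (-(I * z)) * (-(I * 1))) z :=
    (((Complex.ofRealCLM.hasDerivAt (x := z)).const_mul I).neg).cexp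
  refine (h1.mul (hf'.ofReal_comp.add (hf.ofReal_comp.const_mul I))).congr_deriv ?_
  simp only [Pi.add_apply]
  push_cast
  linear_combination (-(cexp (-(I * z)) * f z)) * Complex.I_sq

lemma norm_exp_neg_I_mul (z : ℝ) : ‖cexp (-(I * z))‖ = 1 := by
  rw [Complex.norm_exp]; simp

lemma abs_le_norm_exp_mul_deriv_add (a b z : ℝ) :
    |b| ≤ ‖cexp (-(I * z)) * ((a : ℂ) + I * b)‖ := by
  rw [norm_mul, norm_exp_neg_I_mul, one_mul]
  simpa using Complex.abs_im_le_norm ((a : ℂ) + I * b)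

lemma norm_exp_mul_deriv_add_le (a b z : ℝ) :
    ‖cexp (-(I * z)) * ((a : ℂ) + I * b)‖ ≤ |a| + |b| := by
  rw [norm_mul, norm_exp_neg_I_mul, one_mul]
  refine (norm_add_le _ _).trans ?_
  simp

/-- A function with `‖w'‖ ≤ k ‖w‖ / z²` converges at infinity. -/
lemma exists_tendsto_of_norm_deriv_le {w w' : ℝ → ℂ} {k z₀ : ℝ} (hz₀ : 0 < z₀) (hk : 0 ≤ k)
    (hw : ∀ z, z₀ ≤ z → HasDerivAt w (w' z) z)
    (hw'c : ContinuousOn w' (Set.Ici z₀))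
    (hw' : ∀ z, z₀ ≤ z → ‖w' z‖ ≤ k / z ^ 2 * ‖w z‖) :
    ∃ c, Filter.Tendsto w Filter.atTop (nhds c) := by
  set M := (‖w z₀‖ + 1) * Real.exp (2 * (k + 1) / z₀) with hM
  have hMpos : 0 < M := by positivity
  have hbd : ∀ z, z₀ ≤ z → ‖w z‖ ≤ M := by
    intro z hz
    have := image_norm_le_of_norm_deriv_right_lt_deriv_boundary' (f := w) (f' := w') (a := z₀)
      (b := z) (B := fun x => M * Real.exp (-(2 * (k + 1) * x⁻¹)))
      (B' := fun x => M * (Real.exp (-(2 * (k + 1) * x⁻¹)) * -(2 * (k + 1) * -(x ^ 2)⁻¹)))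
      (fun x hx => (hw x hx.1).continuousAt.continuousWithinAt)
      (fun x hx => (hw x hx.1).hasDerivWithinAt) ?_ ?_ ?_ ?_ (Set.right_mem_Icc.2 hz)
    · refine this.trans (mul_le_of_le_one_right hMpos.le (Real.exp_le_one_iff.2 ?_))
      have : 0 < z := hz₀.trans_le hz
      simp only [Left.neg_nonpos_iff]; positivity
    · simp only [hM]
      rw [mul_assoc, ← Real.exp_add]
      simp [div_eq_mul_inv]
    · intro x hx
      have : x ≠ 0 := (hz₀.trans_le hx.1).ne'
      fun_prop (disch := assumption)
    · intro x hx
      have : x ≠ 0 := (hz₀.trans_le hx.1).ne'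
      exact (((((hasDerivAt_inv this).const_mul _).neg).exp).const_mul _).hasDerivWithinAt
    · intro x hx he
      have hx0 : 0 < x := hz₀.trans_le hx.1
      refine (hw' x hx.1).trans_lt ?_
      rw [he]
      have : 0 < M * Real.exp (-(2 * (k + 1) * x⁻¹)) := by positivity
      have h2 : k / x ^ 2 < 2 * (k + 1) * (x ^ 2)⁻¹ := by
        rw [div_eq_mul_inv]
        exact mul_lt_mul_of_pos_right (by linarith) (by positivity)
      calc _ < 2 * (k + 1) * (x ^ 2)⁻¹ * (M * Real.exp (-(2 * (k + 1) * x⁻¹))) :=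
            mul_lt_mul_of_pos_right h2 this
        _ = _ := by ring
  have hf_int : MeasureTheory.IntegrableOn w' (Set.Ioi z₀) := by
    have h0 := (integrableOn_Ioi_rpow_of_lt (a := -2) (by norm_num) hz₀).const_mul (k * M)
    refine h0.mono' ((hw'c.mono Set.Ioi_subset_Ici_self).aestronglyMeasurable measurableSet_Ioi) ?_
    refine (MeasureTheory.ae_restrict_iff' measurableSet_Ioi).2 (.of_forall fun x hx => ?_)
    have hx0 : 0 < x := hz₀.trans hx
    refine (hw' x (le_of_lt hx)).trans ?_
    rw [Real.rpow_neg hx0.le, Real.rpow_two]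
    calc _ ≤ k / x ^ 2 * M := by gcongr; exact hbd x (le_of_lt hx)
      _ = _ := by ring
  exact ⟨_, MeasureTheory.tendsto_limUnder_of_hasDerivAt_of_integrableOn_Ioi
    (fun x hx => hw x (le_of_lt hx)) hf_int⟩

/-- Backward Gronwall estimate from infinity. -/
lemma norm_le_of_norm_deriv_le_of_tendsto_zero {w w' : ℝ → ℂ} {k R z₀ : ℝ} (hz₀ : 0 < z₀)
    (hk : 0 ≤ k) (hkz : 10 * k ≤ z₀) (hR : 0 ≤ R)
    (hw : ∀ z, z₀ ≤ z → HasDerivAt w (w' z) z)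
    (hw' : ∀ z, z₀ ≤ z → ‖w' z‖ ≤ k / z ^ 2 * ‖w z‖ + R / z ^ 5)
    (hlim : Filter.Tendsto w Filter.atTop (nhds 0)) :
    ‖w z₀‖ ≤ R / (3 * z₀ ^ 4) := by
  refine le_of_forall_pos_le_add fun δ hδ => ?_
  set E := Real.exp (2 * (k + 1) * z₀⁻¹) with hE
  set ε := δ / E with hε
  have hεpos : 0 < ε := by positivity
  obtain ⟨Z, hZ, hZ'⟩ : ∃ Z, z₀ ≤ Z ∧ ‖w Z‖ ≤ ε := by
    have h1 := (tendsto_zero_iff_norm_tendsto_zero.1 hlim).eventually_lt_const hεpos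
    obtain ⟨Z, h, h'⟩ := (h1.and (Filter.eventually_ge_atTop z₀)).exists
    exact ⟨Z, h', h.le⟩
  have := image_norm_le_of_norm_deriv_right_lt_deriv_boundary' (f := fun t => w (-t))
      (f' := fun t => -w' (-t)) (a := -Z)
      (b := -z₀) (B := fun x => R / 3 * (x⁻¹) ^ 4 + ε * Real.exp (2 * (k + 1) * -x⁻¹))
      (B' := fun x => R / 3 * ((4 : ℕ) * (x⁻¹) ^ 3 * -(x ^ 2)⁻¹) +
        ε * (Real.exp (2 * (k + 1) * -x⁻¹) * (2 * (k + 1) * -(-(x ^ 2)⁻¹)))) (x := -z₀)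
      ?_ ?_ ?_ ?_ ?_ ?_ ⟨by linarith, le_rfl⟩
  · simp only [neg_neg, inv_neg] at this
    rw [← hE] at this
    have h3 : ε * E = δ := div_mul_cancel₀ _ (Real.exp_pos _).ne'
    rw [h3] at this
    refine this.trans (le_of_eq ?_)
    field_simp
  · intro x hx
    have := hw (-x) (by linarith [hx.2])
    exact (this.continuousAt.comp continuous_neg.continuousAt).continuousWithinAt
  · intro x hx
    have := hw (-x) (by linarith [hx.2])
    have h := this.scomp x (hasDerivAt_neg x)
    exact (h.congr_deriv (by simp)).hasDerivWithinAt
  · rw [neg_neg]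
    have hZ0 : 0 < Z := hz₀.trans_le hZ
    have h1 : 0 ≤ R / 3 * ((-Z)⁻¹) ^ 4 := mul_nonneg (by positivity) (by positivity)
    have h2 : 1 ≤ Real.exp (2 * (k + 1) * -(-Z)⁻¹) := by
      apply Real.one_le_exp
      rw [inv_neg, neg_neg]; positivity
    nlinarith
  · intro x hx
    have : x ≠ 0 := by linarith [hx.2]
    fun_prop (disch := assumption)
  · intro x hx
    have : x ≠ 0 := by linarith [hx.2]
    exact ((((hasDerivAt_inv this).pow 4).const_mul _).add
      (((((hasDerivAt_inv this).neg).const_mul _).exp).const_mul _)).hasDerivWithinAt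
  · intro x hx he
    obtain ⟨y, rfl⟩ : ∃ y, x = -y := ⟨-x, by simp⟩
    have hy : z₀ ≤ y := by linarith [hx.2]
    have hy0 : 0 < y := hz₀.trans_le hy
    simp only [neg_neg, norm_neg] at he ⊢
    refine (hw' y hy).trans_lt ?_
    rw [he]
    simp only [inv_neg, neg_neg]
    have hpos : 0 < ε * Real.exp (2 * (k + 1) * y⁻¹) := by positivity
    set e := ε * Real.exp (2 * (k + 1) * y⁻¹) with he'
    have h2 : k / y ^ 2 < 2 * (k + 1) * (y ^ 2)⁻¹ := by
      rw [div_eq_mul_inv]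
      exact mul_lt_mul_of_pos_right (by linarith) (by positivity)
    have h3 := mul_lt_mul_of_pos_right h2 hpos
    have h4 : k / y ^ 2 * (R / 3 * (y⁻¹) ^ 4) + R / y ^ 5 ≤ R / 3 * (4 * (y⁻¹) ^ 5) := by
      have : k * y⁻¹ ≤ 1 / 10 := by
        rw [← div_eq_mul_inv, div_le_div_iff₀ hy0 (by norm_num)]; linarith
      have h5 : 0 ≤ R * (y⁻¹) ^ 5 := by positivity
      have : k / y ^ 2 * (R / 3 * (y⁻¹) ^ 4) + R / y ^ 5 =
        (k * y⁻¹) * (R * (y⁻¹) ^ 5) / 3 + R * (y⁻¹) ^ 5 := by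
        field_simp
      rw [this]
      nlinarith
    have h6 : R / 3 * ((4 : ℕ) * (-y⁻¹) ^ 3 * -((-y) ^ 2)⁻¹) = R / 3 * (4 * (y⁻¹) ^ 5) := by
      push_cast; field_simp
    have h7 : ε * (Real.exp (2 * (k + 1) * y⁻¹) * (2 * (k + 1) * ((-y) ^ 2)⁻¹)) =
        2 * (k + 1) * (y ^ 2)⁻¹ * e := by
      rw [he', neg_sq]; ring
    rw [h6, h7, show (-y⁻¹) ^ 4 = (y⁻¹) ^ 4 by ring]
    linarith

lemma realBesselJ_eq_complex (n : ℤ) (z : ℝ) : (realBesselJ n z : ℂ) =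
    (1 / (2 * (π : ℂ))) * ∫ θ in (0:ℝ)..(2 * π), cexp (I * z * (Real.sin θ : ℂ)) *
      cexp (I * (n : ℂ) * (θ : ℂ)) := (besselJ_ofReal n z).symm

lemma abs_realBesselJ_le_one (n : ℤ) (z : ℝ) : |realBesselJ n z| ≤ 1 := by
  have h := intervalIntegral.norm_integral_le_of_norm_le_const (a := 0) (b := 2 * π) (C := 1)
    (f := fun θ => Real.cos (z * Real.sin θ + n * θ)) (fun θ _ => Real.abs_cos_le_one _)
  have hp : 0 < 2 * π := by positivity
  rw [sub_zero, abs_of_pos hp, one_mul, Real.norm_eq_abs] at h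
  unfold realBesselJ
  rw [abs_mul, abs_of_pos (by positivity : 0 < 1 / (2 * π)), one_div, inv_mul_le_iff₀ hp]
  linarith

/-- A residue computation, via Cauchy's formula on the unit circle. -/
lemma integral_exp_div_sub_sin {s r : ℂ} (hr : r ^ 2 = s ^ 2 + 1) (hsr : ‖s - r‖ < 1) (n : ℕ) :
    ∫ θ in (0:ℝ)..(2 * π), cexp (I * n * θ) / (s - I * (Real.sin θ : ℂ)) =
      2 * π * ((s - r) ^ n / r) := by
  have hprod : (s - r) * (s + r) = -1 := by linear_combination -hr
  have h2 : 1 < ‖s + r‖ := by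
    have := congrArg norm hprod
    rw [norm_mul, norm_neg, norm_one] at this
    by_contra! h
    nlinarith [norm_nonneg (s - r), norm_nonneg (s + r)]
  have hne : ∀ z : ℂ, ‖z‖ ≤ 1 → z - (s + r) ≠ 0 := by
    intro z hz h
    rw [sub_eq_zero] at h
    rw [h] at hz; linarith
  have hd : DiffContOnCl ℂ (fun z : ℂ => z ^ n / (z - (s + r))) (Metric.ball 0 1) := by
    refine DifferentiableOn.diffContOnCl ?_
    intro z hz
    rw [closure_ball _ one_ne_zero, mem_closedBall_zero_iff] at hz
    have := hne z hz
    exact ((by fun_prop : DifferentiableAt ℂ (fun z : ℂ => z ^ n) z).fun_div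
      (by fun_prop : DifferentiableAt ℂ (fun z : ℂ => z - (s + r)) z) this).differentiableWithinAt
  have hw : s - r ∈ Metric.ball (0:ℂ) 1 := by simpa using hsr
  have hC := hd.circleIntegral_sub_inv_smul hw
  rw [circleIntegral] at hC
  have hr0 : r ≠ 0 := by
    have := hne (s - r) hsr.le
    intro h; apply this
    rw [h] at hsr h2 ⊢
    simp only [sub_zero, add_zero] at hsr h2
    linarith
  have h3 : ∀ θ : ℝ, deriv (circleMap 0 1) θ • (circleMap 0 1 θ - (s - r))⁻¹ •
      ((circleMap 0 1 θ) ^ n / (circleMap 0 1 θ - (s + r))) =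
      (-I / 2) * (cexp (I * n * θ) / (s - I * (Real.sin θ : ℂ))) := by
    intro θ
    rw [deriv_circleMap]
    simp only [circleMap, zero_add, ofReal_one, one_mul, smul_eq_mul]
    have he : cexp (I * n * θ) = cexp (θ * I) ^ n := by
      rw [← Complex.exp_nat_mul]; congr 1; ring
    rw [he, Complex.ofReal_sin, Complex.sin]
    have hinv : cexp (-θ * I) = (cexp (θ * I))⁻¹ := by rw [← Complex.exp_neg]; congr 1; ring
    have hn1 : ‖cexp (θ * I)‖ = 1 := Complex.norm_exp_ofReal_mul_I θ
    rw [hinv]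
    have he0 : cexp (θ * I) ≠ 0 := Complex.exp_ne_zero _
    generalize cexp (θ * I) = e at *
    have e1 : e - (s - r) ≠ 0 := by
      intro h; rw [sub_eq_zero] at h; rw [← h, hn1] at hsr; exact lt_irrefl _ hsr
    have e2 := hne e hn1.le
    have key : s - I * ((e⁻¹ - e) * I / 2) = -((e - (s - r)) * (e - (s + r))) / (2 * e) := by
      field_simp
      linear_combination -hr + (e ^ 2 - 1) * Complex.I_sq
    rw [key]
    field_simp
  simp_rw [h3] at hC
  rw [intervalIntegral.integral_const_mul, smul_eq_mul] at hC
  have h4 : (s - r - (s + r)) = -2 * r := by ring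
  rw [h4] at hC
  have : (I * 2) * ((-I / 2) * ∫ θ in (0:ℝ)..(2 * π), cexp (I * n * θ) / (s - I * (Real.sin θ : ℂ)))
      = ∫ θ in (0:ℝ)..(2 * π), cexp (I * n * θ) / (s - I * (Real.sin θ : ℂ)) := by
    linear_combination (-∫ θ in (0:ℝ)..(2 * π), cexp (I * n * θ) / (s - I * (Real.sin θ : ℂ))) *
      Complex.I_sq
  rw [← this, hC]
  field_simp
  linear_combination -(s - r) ^ n * Complex.I_sq

/-- The Laplace transform of a Bessel function, as an angular integral. -/
lemma integral_realBesselJ_mul_exp {s : ℂ} (hs : 0 < s.re) (n : ℕ) :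
    ∫ t in Set.Ioi (0:ℝ), (realBesselJ n t : ℂ) * cexp (-s * t) =
      1 / (2 * (π : ℂ)) *
        ∫ θ in (0:ℝ)..(2 * π), cexp (I * n * θ) / (s - I * (Real.sin θ : ℂ)) := by
  have h2 : (0:ℝ) ≤ 2 * π := by positivity
  simp_rw [realBesselJ_eq_complex, intervalIntegral.integral_of_le h2, mul_assoc (1 / (2 * (π:ℂ))),
    ← MeasureTheory.integral_mul_const]
  rw [MeasureTheory.integral_const_mul, MeasureTheory.integral_integral_swap]
  · congr 1
    refine MeasureTheory.integral_congr_ae (.of_forall fun θ => ?_)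
    have h3 : ∀ t : ℝ, cexp (I * t * (Real.sin θ : ℂ)) * cexp (I * ((n : ℤ) : ℂ) * (θ : ℂ)) *
        cexp (-s * t) = cexp (I * n * θ) * cexp ((I * (Real.sin θ : ℂ) - s) * t) := by
      intro t
      rw [← Complex.exp_add, ← Complex.exp_add, ← Complex.exp_add]
      congr 1; push_cast; ring
    have h4 : (I * (Real.sin θ : ℂ) - s).re < 0 := by
      simp only [sub_re, mul_re, I_re, ofReal_re, I_im, ofReal_im]; linarith
    simp only [h3]
    rw [MeasureTheory.integral_const_mul, integral_exp_mul_complex_Ioi h4]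
    have h5 : I * (Real.sin θ : ℂ) - s ≠ 0 := by
      intro h; rw [h] at h4; simp at h4
    have h6 : s - I * (Real.sin θ : ℂ) ≠ 0 := by
      intro h; apply h5; rw [← neg_sub, h, neg_zero]
    rw [ofReal_zero, mul_zero, Complex.exp_zero, ← neg_sub s, neg_div_neg_eq]
    rw [mul_one_div]
  · have hb : MeasureTheory.Integrable (fun p : ℝ × ℝ => Real.exp (-s.re * p.1) * 1)
        ((MeasureTheory.volume.restrict (Set.Ioi 0)).prod
          (MeasureTheory.volume.restrict (Set.Ioc 0 (2 * π)))) := by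
      refine MeasureTheory.Integrable.mul_prod (f := fun t : ℝ => Real.exp (-s.re * t))
        (g := fun _ => (1:ℝ)) ?_ ?_
      · exact integrableOn_exp_mul_Ioi (by linarith) 0
      · exact MeasureTheory.integrable_const _
    refine hb.mono' (by fun_prop : Continuous _).aestronglyMeasurable (.of_forall fun p => ?_)
    simp only [Function.uncurry, norm_mul, Complex.norm_exp]
    simp

/-- The real part of a square root of `l + 2i`. -/
lemma exists_laplace_root {l : ℝ} (hl : 0 < l) :
    ∃ a : ℝ, 0 < a ∧ a ^ 2 - (a⁻¹) ^ 2 = l ∧ a ≤ 1 + l ∧ 1 ≤ a := by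
  set x := (l + √(l ^ 2 + 4)) / 2 with hx
  have h4 : √(l ^ 2 + 4) ^ 2 = l ^ 2 + 4 := Real.sq_sqrt (by positivity)
  have h5 : 2 ≤ √(l ^ 2 + 4) := Real.le_sqrt_of_sq_le (by nlinarith)
  have h6 : √(l ^ 2 + 4) ≤ 2 + l := Real.sqrt_le_iff.2 ⟨by linarith, by nlinarith⟩
  have hx1 : 1 ≤ x := by rw [hx]; linarith
  have hxx : x ^ 2 - 1 = l * x := by rw [hx]; nlinarith
  refine ⟨√x, by positivity, ?_, ?_, Real.one_le_sqrt.2 hx1⟩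
  · rw [inv_pow, Real.sq_sqrt (by linarith)]
    have : x ≠ 0 := by linarith
    field_simp; linarith
  · refine Real.sqrt_le_iff.2 ⟨by linarith, ?_⟩
    nlinarith

lemma continuous_realBesselJ (n : ℤ) : Continuous (realBesselJ n) :=
  continuous_iff_continuousAt.2 fun z => (hasDerivAt_realBesselJ n z).continuousAt

lemma continuous_besselU (n : ℤ) : Continuous (besselU n) :=
  Real.continuous_sqrt.mul (continuous_realBesselJ n)

lemma integral_gamma_mul_besselU {l a : ℝ} (hl : 0 < l) (ha : 0 < a)
    (hal : a ^ 2 - (a⁻¹) ^ 2 = l⁻¹) (n : ℕ) :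
    ∫ x in Set.Ioi (0:ℝ), ((Real.exp (-x) * x ^ ((1:ℝ) / 2 - 1) : ℝ) : ℂ) *
        (cexp (-(I * (l * x : ℝ))) * (besselU n (l * x) : ℂ)) =
      ((l⁻¹ : ℝ) + I - (√l⁻¹ : ℝ) * (a + I * (a⁻¹ : ℝ))) ^ n / (a + I * (a⁻¹ : ℝ)) := by
  set s : ℂ := (l⁻¹ : ℝ) + I with hs
  set q : ℂ := a + I * (a⁻¹ : ℝ) with hq
  have hli : 0 < l⁻¹ := by positivity
  have hsq : √l⁻¹ ^ 2 = l⁻¹ := Real.sq_sqrt hli.le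
  have hslpos : 0 < √l⁻¹ := Real.sqrt_pos.2 hli
  have hai : 0 < a⁻¹ := by positivity
  have hq2 : q ^ 2 = (l⁻¹ : ℝ) + 2 * I := by
    have h1 : (a : ℂ) * ((a⁻¹ : ℝ) : ℂ) = 1 := by
      rw [← ofReal_mul, mul_inv_cancel₀ ha.ne', ofReal_one]
    have h2 : (a : ℂ) ^ 2 - ((a⁻¹ : ℝ) : ℂ) ^ 2 = (l⁻¹ : ℝ) := by
      rw [← hal]; push_cast; rfl
    rw [hq]
    linear_combination h2 + 2 * I * h1 + ((a⁻¹ : ℝ) : ℂ) ^ 2 * I_sq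
  have hr : ((√l⁻¹ : ℝ) * q) ^ 2 = s ^ 2 + 1 := by
    have h3 : ((√l⁻¹ : ℝ) : ℂ) ^ 2 = (l⁻¹ : ℝ) := by rw [← ofReal_pow, hsq]
    rw [mul_pow, h3, hq2, hs]
    linear_combination -I_sq
  have hsr : ‖s - (√l⁻¹ : ℝ) * q‖ < 1 := by
    have hprod : (s - (√l⁻¹ : ℝ) * q) * (s + (√l⁻¹ : ℝ) * q) = -1 := by linear_combination -hr
    have h5 : ‖s - (√l⁻¹ : ℝ) * q‖ < ‖s + (√l⁻¹ : ℝ) * q‖ := by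
      rw [Complex.norm_def, Complex.norm_def]
      apply Real.sqrt_lt_sqrt (Complex.normSq_nonneg _)
      simp only [hs, hq, Complex.normSq_apply, sub_re, add_re, ofReal_re, I_re, mul_re, ofReal_im,
        I_im, sub_im, add_im, mul_im]
      have : 0 < √l⁻¹ * (l⁻¹ * a) := by positivity
      have : 0 < √l⁻¹ * a⁻¹ := by positivity
      nlinarith
    have h6 := congrArg norm hprod
    rw [norm_mul, norm_neg, norm_one] at h6
    by_contra! h
    nlinarith [norm_nonneg (s - (√l⁻¹ : ℝ) * q), norm_nonneg (s + (√l⁻¹ : ℝ) * q)]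
  have hsre : 0 < s.re := by simpa [hs] using hl
  have h7 := integral_realBesselJ_mul_exp hsre n
  rw [integral_exp_div_sub_sin hr hsr] at h7
  have h8 := MeasureTheory.integral_comp_mul_left_Ioi
    (fun t : ℝ => (realBesselJ n t : ℂ) * cexp (-s * t)) 0 hl
  rw [mul_zero, h7] at h8
  have hq0 : q ≠ 0 := by
    intro h
    have := congrArg Complex.re h
    simp [hq] at this; exact ha.ne' this
  have hsc : ((√l⁻¹ : ℝ) : ℂ) ≠ 0 := by exact_mod_cast hslpos.ne'
  have h9 : ∀ x ∈ Set.Ioi (0:ℝ), ((Real.exp (-x) * x ^ ((1:ℝ) / 2 - 1) : ℝ) : ℂ) *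
        (cexp (-(I * (l * x : ℝ))) * (besselU n (l * x) : ℂ)) =
      (√l : ℝ) * ((realBesselJ n (l * x) : ℂ) * cexp (-s * (l * x : ℝ))) := by
    intro x hx
    have hx0 : 0 < x := hx
    have h10 : x ^ ((1:ℝ) / 2 - 1) * √(l * x) = √l := by
      rw [Real.sqrt_mul hl.le, Real.sqrt_eq_rpow x, mul_left_comm, ← Real.rpow_add hx0]
      norm_num
    have h11 : cexp (-s * (l * x : ℝ)) = (Real.exp (-x) : ℝ) * cexp (-(I * (l * x : ℝ))) := by
      rw [ofReal_exp, ← Complex.exp_add, hs]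
      congr 1
      have : (l : ℂ) ≠ 0 := by exact_mod_cast hl.ne'
      push_cast
      field_simp
      ring
    rw [h11, besselU, ← h10]
    push_cast
    ring
  rw [MeasureTheory.setIntegral_congr_fun measurableSet_Ioi h9, MeasureTheory.integral_const_mul,
    h8]
  have h12 : ((√l : ℝ) : ℂ) * ((l⁻¹ : ℝ) : ℂ) = (√l⁻¹ : ℝ) := by
    rw [← ofReal_mul, Real.sqrt_inv]
    congr 1
    have : √l ≠ 0 := (Real.sqrt_pos.2 hl).ne'
    field_simp
    exact Real.sq_sqrt hl.le
  rw [real_smul, ← mul_assoc, h12]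
  generalize ((√l⁻¹ : ℝ) : ℂ) = y at hsc ⊢
  field_simp

lemma integrable_gamma_half : MeasureTheory.IntegrableOn
    (fun x : ℝ => Real.exp (-x) * x ^ ((1:ℝ) / 2 - 1)) (Set.Ioi 0) :=
  Real.GammaIntegral_convergent (by norm_num)

/-- An instance of the Riemann-Lebesgue lemma. -/
lemma tendsto_integral_gamma_mul_exp :
    Tendsto (fun l : ℝ => ∫ x in Set.Ioi (0:ℝ),
      ((Real.exp (-x) * x ^ ((1:ℝ) / 2 - 1) : ℝ) : ℂ) * cexp (-(2 * I * (l * x : ℝ))))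
      atTop (𝓝 0) := by
  have h := Real.tendsto_integral_exp_smul_cocompact (Set.indicator (Set.Ioi (0:ℝ))
    (fun x : ℝ => ((Real.exp (-x) * x ^ ((1:ℝ) / 2 - 1) : ℝ) : ℂ)))
  have h1 : Tendsto (fun l : ℝ => l / π) atTop (cocompact ℝ) := by
    refine Tendsto.mono_right (tendsto_id.atTop_div_const Real.pi_pos) ?_
    exact atTop_le_cocompact
  refine (h.comp h1).congr fun l => ?_
  simp only [Function.comp]
  rw [← MeasureTheory.integral_indicator measurableSet_Ioi]
  congr 1
  ext x
  by_cases hx : x ∈ Set.Ioi (0:ℝ)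
  · rw [Set.indicator_of_mem hx, Set.indicator_of_mem hx, Circle.smul_def, Real.fourierChar_apply,
      smul_eq_mul, mul_comm]
    congr 2
    have : (π : ℂ) ≠ 0 := by exact_mod_cast Real.pi_ne_zero
    push_cast
    field_simp
  · rw [Set.indicator_of_notMem hx, Set.indicator_of_notMem hx, smul_zero]

lemma tendsto_integral_gamma_mul_of_bounded {r : ℝ → ℝ} {K : ℝ} (hr : Continuous r)
    (hK : ∀ t, 0 < t → |r t| ≤ K) (hlim : Tendsto r atTop (𝓝 0)) :
    Tendsto (fun l : ℝ => ∫ x in Set.Ioi (0:ℝ),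
      ((Real.exp (-x) * x ^ ((1:ℝ) / 2 - 1) : ℝ) : ℂ) *
        (cexp (-(I * (l * x : ℝ))) * (r (l * x) : ℂ))) atTop (𝓝 0) := by
  rw [show (0:ℂ) = ∫ x in Set.Ioi (0:ℝ), (0:ℂ) by simp]
  have hnorm : ∀ l x : ℝ, 0 < x → ‖((Real.exp (-x) * x ^ ((1:ℝ) / 2 - 1) : ℝ) : ℂ) *
        (cexp (-(I * (l * x : ℝ))) * (r (l * x) : ℂ))‖ =
        (Real.exp (-x) * x ^ ((1:ℝ) / 2 - 1)) * |r (l * x)| := by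
    intro l x hx
    rw [norm_mul, norm_mul, norm_exp_neg_I_mul, one_mul, norm_real, norm_real, Real.norm_eq_abs,
      Real.norm_eq_abs, abs_of_nonneg (by positivity)]
  refine MeasureTheory.tendsto_integral_filter_of_dominated_convergence
    (fun x => (Real.exp (-x) * x ^ ((1:ℝ) / 2 - 1)) * K) ?_ ?_ (integrable_gamma_half.mul_const K) ?_
  · refine .of_forall fun l => ContinuousOn.aestronglyMeasurable ?_ measurableSet_Ioi
    refine ContinuousOn.mul ?_ (by fun_prop)
    refine Complex.continuous_ofReal.comp_continuousOn (ContinuousOn.mul (by fun_prop) ?_)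
    exact fun x hx => (Real.continuousAt_rpow_const x _ (Or.inl (ne_of_gt hx))).continuousWithinAt
  · filter_upwards [eventually_gt_atTop 0] with l hl
    refine (MeasureTheory.ae_restrict_iff' measurableSet_Ioi).2 (.of_forall fun x hx => ?_)
    have hx0 : 0 < x := hx
    rw [hnorm l x hx]
    exact mul_le_mul_of_nonneg_left (hK _ (mul_pos hl hx)) (by positivity)
  · refine (MeasureTheory.ae_restrict_iff' measurableSet_Ioi).2 (.of_forall fun x hx => ?_)
    have hx0 : 0 < x := hx
    rw [tendsto_zero_iff_norm_tendsto_zero]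
    simp_rw [hnorm _ x hx]
    have h1 : Tendsto (fun l : ℝ => |r (l * x)|) atTop (𝓝 0) := by
      have := (hlim.comp (tendsto_id.atTop_mul_const hx0)).abs
      simpa using this
    simpa using h1.const_mul (Real.exp (-x) * x ^ ((1:ℝ) / 2 - 1))

lemma tendsto_integral_gamma_mul_besselU (n : ℕ) :
    Tendsto (fun l : ℝ => ∫ x in Set.Ioi (0:ℝ),
      ((Real.exp (-x) * x ^ ((1:ℝ) / 2 - 1) : ℝ) : ℂ) *
        (cexp (-(I * (l * x : ℝ))) * (besselU n (l * x) : ℂ))) atTop (𝓝 (I ^ n / (1 + I))) := by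
  choose! a ha0 ha ha1 ha2 using fun l (hl : 0 < l) => exists_laplace_root hl
  have hinv : Tendsto (fun l : ℝ => l⁻¹) atTop (𝓝 0) := tendsto_inv_atTop_zero
  have hb : Tendsto (fun l : ℝ => a l⁻¹) atTop (𝓝 1) := by
    refine tendsto_of_tendsto_of_tendsto_of_le_of_le' tendsto_const_nhds
      (by simpa using hinv.const_add 1) ?_ ?_
    · filter_upwards [eventually_gt_atTop 0] with l hl using ha2 _ (inv_pos.2 hl)
    · filter_upwards [eventually_gt_atTop 0] with l hl using ha1 _ (inv_pos.2 hl)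
  have hbi : Tendsto (fun l : ℝ => (a l⁻¹)⁻¹) atTop (𝓝 1) := by
    simpa using hb.inv₀ one_ne_zero
  have hc : ∀ {f : ℝ → ℝ} {x : ℝ}, Tendsto f atTop (𝓝 x) →
      Tendsto (fun l => (f l : ℂ)) atTop (𝓝 (x : ℂ)) :=
    fun h => (Complex.continuous_ofReal.tendsto _).comp h
  have hs : Tendsto (fun l : ℝ => √l⁻¹) atTop (𝓝 0) := by
    simpa [Function.comp_def] using (Real.continuous_sqrt.tendsto 0).comp hinv
  have hq : Tendsto (fun l : ℝ => (a l⁻¹ : ℂ) + I * ((a l⁻¹)⁻¹ : ℝ)) atTop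
      (𝓝 ((1 : ℝ) + I * (1 : ℝ))) := (hc hb).add ((hc hbi).const_mul I)
  have h1I : ((1 : ℝ) + I * (1 : ℝ) : ℂ) ≠ 0 := by
    intro h; have := congrArg Complex.re h; simp at this
  have := ((((hc hinv).add_const I).sub ((hc hs).mul hq)).pow n).div hq h1I
  simp only [ofReal_zero, zero_add, zero_mul, sub_zero, ofReal_one, mul_one] at this
  refine this.congr' ?_
  filter_upwards [eventually_gt_atTop 0] with l hl
  exact (integral_gamma_mul_besselU hl (ha0 _ (inv_pos.2 hl)) (ha _ (inv_pos.2 hl)) n).symm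

lemma ofReal_im_eq (z : ℂ) : (z.im : ℂ) = (z - (starRingEnd ℂ) z) / (2 * I) := by
  rw [Complex.sub_conj]
  have := Complex.I_ne_zero
  field_simp
  push_cast; ring

lemma exp_mul_ofReal_im_exp_mul (c : ℂ) (t : ℝ) :
    cexp (-(I * t)) * ((cexp (I * t) * c).im : ℂ) =
      c / (2 * I) - (starRingEnd ℂ) c / (2 * I) * cexp (-(2 * I * t)) := by
  have h : cexp (-(I * t)) * cexp (I * t) = 1 := by rw [← Complex.exp_add]; simp
  have h2 : cexp (-(2 * I * t)) = cexp (-(I * t)) * cexp (-(I * t)) := by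
    rw [← Complex.exp_add]; congr 1; ring
  have h3 : (starRingEnd ℂ) (cexp (I * t)) = cexp (-(I * t)) := by
    rw [← Complex.exp_conj]; simp
  rw [ofReal_im_eq, map_mul, h3, h2]
  linear_combination c / (2 * I) * h

lemma eq_of_tendsto_besselU (n : ℕ) {c : ℂ}
    (hw : Tendsto (fun t : ℝ => cexp (-(I * t)) * ((besselUDeriv n t : ℂ) + I * besselU n t))
      atTop (𝓝 c)) :
    c / (2 * I) * √π = I ^ n / (1 + I) := by
  set r : ℝ → ℝ := fun t => besselU n t - (cexp (I * t) * c).im with hr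
  have hrw : ∀ t : ℝ, r t = (cexp (I * t) * (cexp (-(I * t)) *
      ((besselUDeriv n t : ℂ) + I * besselU n t) - c)).im := by
    intro t
    have h : cexp (I * t) * cexp (-(I * t)) = 1 := by rw [← Complex.exp_add]; simp
    rw [mul_sub, ← mul_assoc, h, one_mul, sub_im]
    simp [hr]
  have hnorm : ∀ t : ℝ, ‖cexp (I * t)‖ = 1 := by
    intro t; rw [Complex.norm_exp]; simp
  have hrlim : Tendsto r atTop (𝓝 0) := by
    have h0 := (hw.sub_const c).norm
    rw [sub_self, norm_zero] at h0
    refine squeeze_zero_norm (fun t => ?_) h0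
    rw [hrw, Real.norm_eq_abs]
    refine (Complex.abs_im_le_norm _).trans ?_
    rw [norm_mul, hnorm, one_mul]
  have hrc : Continuous r := (continuous_besselU n).sub (by fun_prop)
  obtain ⟨T, hT⟩ := (Metric.tendsto_atTop.1 hrlim) 1 one_pos
  have hK : ∀ t, 0 < t → |r t| ≤ 1 + √|T| + ‖c‖ := by
    intro t ht
    rcases le_total T t with h | h
    · have := hT t h
      rw [Real.dist_eq, sub_zero] at this
      have := Real.sqrt_nonneg |T|
      have := norm_nonneg c
      linarith
    · have h1 : |besselU n t| ≤ √|T| := by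
        rw [besselU, abs_mul, abs_of_nonneg (Real.sqrt_nonneg _)]
        refine (mul_le_of_le_one_right (Real.sqrt_nonneg _) (abs_realBesselJ_le_one _ _)).trans ?_
        exact Real.sqrt_le_sqrt (h.trans (le_abs_self T))
      have h2 : |(cexp (I * t) * c).im| ≤ ‖c‖ := by
        refine (Complex.abs_im_le_norm _).trans ?_
        rw [norm_mul, hnorm, one_mul]
      have := abs_sub (besselU n t) (cexp (I * t) * c).im
      simp only [hr]
      linarith
  have hφ : MeasureTheory.IntegrableOn
      (fun x : ℝ => ((Real.exp (-x) * x ^ ((1:ℝ) / 2 - 1) : ℝ) : ℂ)) (Set.Ioi 0) :=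
    integrable_gamma_half.ofReal
  have hsum := ((tendsto_const_nhds (x := c / (2 * I) * √π) (f := atTop (α := ℝ))).sub
    (tendsto_integral_gamma_mul_exp.const_mul ((starRingEnd ℂ) c / (2 * I)))).add
    (tendsto_integral_gamma_mul_of_bounded hrc hK hrlim)
  rw [mul_zero, sub_zero, add_zero] at hsum
  refine tendsto_nhds_unique (hsum.congr' ?_) (tendsto_integral_gamma_mul_besselU n)
  filter_upwards [eventually_gt_atTop 0] with l hl
  have hΓ : ∫ x in Set.Ioi (0:ℝ), ((Real.exp (-x) * x ^ ((1:ℝ) / 2 - 1) : ℝ) : ℂ) = √π := by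
    rw [integral_complex_ofReal, ← Real.Gamma_eq_integral (by norm_num), Real.Gamma_one_half_eq]
  have hi2 : MeasureTheory.IntegrableOn (fun x : ℝ =>
      ((Real.exp (-x) * x ^ ((1:ℝ) / 2 - 1) : ℝ) : ℂ) * cexp (-(2 * I * (l * x : ℝ))))
      (Set.Ioi 0) := by
    refine hφ.mul_bdd (c := 1) (by fun_prop : Continuous _).aestronglyMeasurable (.of_forall fun x => ?_)
    rw [Complex.norm_exp]; simp
  have hi3 : MeasureTheory.IntegrableOn (fun x : ℝ =>
      ((Real.exp (-x) * x ^ ((1:ℝ) / 2 - 1) : ℝ) : ℂ) *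
        (cexp (-(I * (l * x : ℝ))) * (r (l * x) : ℂ))) (Set.Ioi 0) := by
    refine MeasureTheory.Integrable.mul_bdd (c := 1 + √|T| + ‖c‖) hφ
      (by fun_prop : Continuous _).aestronglyMeasurable ?_
    refine (MeasureTheory.ae_restrict_iff' measurableSet_Ioi).2 (.of_forall fun x hx => ?_)
    rw [norm_mul, norm_exp_neg_I_mul, one_mul, norm_real]
    exact hK _ (mul_pos hl hx)
  have hi4 : MeasureTheory.IntegrableOn (fun x : ℝ =>
      c / (2 * I) * ((Real.exp (-x) * x ^ ((1:ℝ) / 2 - 1) : ℝ) : ℂ) - (starRingEnd ℂ) c / (2 * I) *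
        (((Real.exp (-x) * x ^ ((1:ℝ) / 2 - 1) : ℝ) : ℂ) * cexp (-(2 * I * (l * x : ℝ)))))
      (Set.Ioi 0) := (hφ.const_mul _).sub (hi2.const_mul _)
  rw [← hΓ, ← MeasureTheory.integral_const_mul, ← MeasureTheory.integral_const_mul,
    ← MeasureTheory.integral_sub (hφ.const_mul _) (hi2.const_mul _),
    ← MeasureTheory.integral_add hi4 hi3]
  refine MeasureTheory.integral_congr_ae (.of_forall fun x => ?_)
  have h5 := exp_mul_ofReal_im_exp_mul c (l * x)
  have h6 : (besselU n (l * x) : ℂ) = (cexp (I * (l * x : ℝ)) * c).im + (r (l * x) : ℂ) := by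
    rw [← ofReal_add]; congr 1; simp [hr]
  simp only [h6, mul_add, h5]
  ring

/-- The phase-amplitude constant of `besselU n` at infinity. -/
lemma eq_exp_of_tendsto_besselU (n : ℕ) {c : ℂ}
    (hw : Tendsto (fun t : ℝ => cexp (-(I * t)) * ((besselUDeriv n t : ℂ) + I * besselU n t))
      atTop (𝓝 c)) :
    c = √(2 / π) * cexp (-(I * (π / 4 - n * π / 2 - π / 2 : ℝ))) := by
  have h := eq_of_tendsto_besselU n hw
  have hp : ((√π : ℝ) : ℂ) ≠ 0 := by exact_mod_cast (Real.sqrt_pos.2 Real.pi_pos).ne'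
  have h2 : ((√2 : ℝ) : ℂ) ≠ 0 := by exact_mod_cast (Real.sqrt_pos.2 two_pos).ne'
  have h2s : ((√2 : ℝ) : ℂ) ^ 2 = 2 := by
    rw [← ofReal_pow, Real.sq_sqrt two_pos.le]; norm_num
  have hI := Complex.I_ne_zero
  have h1I : (1 + I : ℂ) ≠ 0 := by
    intro h; have := congrArg Complex.re h; simp at this
  have he : cexp (-(I * (π / 4 - n * π / 2 - π / 2 : ℝ))) =
      cexp (-(π / 4 : ℝ) * I) * I ^ n * I := by
    have e1 : cexp ((π / 2 : ℝ) * I) = I := by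
      rw [Complex.exp_mul_I]; push_cast; simp
    rw [← e1, ← Complex.exp_nat_mul, ← Complex.exp_add, ← Complex.exp_add, e1]
    congr 1; push_cast; ring
  have e4 : cexp (-(π / 4 : ℝ) * I) = (√2 : ℝ) / 2 * (1 - I) := by
    rw [Complex.exp_mul_I, ← ofReal_neg, ← ofReal_cos, ← ofReal_sin, Real.cos_neg, Real.sin_neg,
      Real.cos_pi_div_four, Real.sin_pi_div_four]
    push_cast; ring
  rw [he, e4, Real.sqrt_div two_pos.le]
  push_cast
  field_simp at h ⊢
  have : c * √π * (1 + I) * (1 - I) = I ^ n * (2 * I) * (1 - I) := by rw [h]; ring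
  linear_combination this + c * √π * I_sq - I ^ n * I * (1 - I) * h2s

lemma tendsto_besselU (n : ℕ) :
    Tendsto (fun t : ℝ => cexp (-(I * t)) * ((besselUDeriv n t : ℂ) + I * besselU n t))
      atTop (𝓝 (√(2 / π) * cexp (-(I * (π / 4 - n * π / 2 - π / 2 : ℝ))))) := by
  set m : ℝ := (n : ℝ) ^ 2 - 1 / 4 with hm
  suffices hex : ∃ c, Tendsto (fun t : ℝ => cexp (-(I * t)) *
      ((besselUDeriv n t : ℂ) + I * besselU n t)) atTop (𝓝 c) by
    obtain ⟨c, hc⟩ := hex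
    rwa [← eq_exp_of_tendsto_besselU n hc]
  refine exists_tendsto_of_norm_deriv_le one_pos (abs_nonneg m)
    (w' := fun t : ℝ => cexp (-(I * t)) * ((m / t ^ 2 * besselU n t : ℝ) : ℂ)) ?_ ?_ ?_
  · intro z hz
    have hz0 : 0 < z := one_pos.trans_le hz
    refine hasDerivAt_exp_mul_deriv_add (hasDerivAt_besselU n hz0)
      ((hasDerivAt_besselUDeriv n hz0).congr_deriv ?_)
    push_cast; ring
  · refine ContinuousOn.mul (by fun_prop) (Complex.continuous_ofReal.comp_continuousOn ?_)
    refine ContinuousOn.mul ?_ (continuous_besselU n).continuousOn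
    intro z hz
    have : z ^ 2 ≠ 0 := (pow_pos (one_pos.trans_le hz) 2).ne'
    exact (by fun_prop (disch := assumption) : ContinuousAt (fun z => m / z ^ 2) z).continuousWithinAt
  · intro z hz
    rw [norm_mul, norm_exp_neg_I_mul, one_mul, norm_real, Real.norm_eq_abs, abs_mul, abs_div,
      abs_of_nonneg (by positivity : 0 ≤ z ^ 2)]
    gcongr
    exact abs_le_norm_exp_mul_deriv_add _ _ _

/-- The Hankel expansion to third order, with phase `w`, parameter `m = n ^ 2 - 1 / 4` and `h = 1 / z`. -/
noncomputable def hankelTrunc (m w h : ℝ) : ℝ :=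
  Real.cos w * (1 - m * (m - 2) / 8 * h ^ 2) -
    Real.sin w * (m / 2 * h - m * (m - 2) * (m - 6) / 48 * h ^ 3)

/-- The derivative of `hankelTrunc m (z - φ) z⁻¹` in `z`. -/
noncomputable def hankelTruncDeriv (m w h : ℝ) : ℝ :=
  Real.cos w * (m * (m - 2) / 4 * h ^ 3 - (m / 2 * h - m * (m - 2) * (m - 6) / 48 * h ^ 3)) -
    Real.sin w * (1 - m * (m - 2) / 8 * h ^ 2 - m / 2 * h ^ 2 + m * (m - 2) * (m - 6) / 16 * h ^ 4)

lemma hasDerivAt_hankelTrunc (m φ : ℝ) {z : ℝ} (hz : z ≠ 0) :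
    HasDerivAt (fun z => hankelTrunc m (z - φ) z⁻¹) (hankelTruncDeriv m (z - φ) z⁻¹) z := by
  have hi := hasDerivAt_inv hz
  have hs := ((hasDerivAt_id z).sub_const φ)
  refine ((hs.cos.mul (((hi.pow 2).const_mul (m * (m - 2) / 8)).const_sub 1)).sub
    (hs.sin.mul ((hi.const_mul (m / 2)).sub
      ((hi.pow 3).const_mul (m * (m - 2) * (m - 6) / 48))))).congr_deriv ?_
  simp only [hankelTruncDeriv, id, Pi.sub_apply, Pi.pow_apply]
  rw [inv_pow]
  push_cast
  field_simp
  ring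

lemma hasDerivAt_hankelTruncDeriv (m φ : ℝ) {z : ℝ} (hz : z ≠ 0) :
    HasDerivAt (fun z => hankelTruncDeriv m (z - φ) z⁻¹)
      (-(1 - m / z ^ 2) * hankelTrunc m (z - φ) z⁻¹ +
        (12 - m) * (m * (m - 2) * (m - 6) / 48) * Real.sin (z - φ) / z ^ 5) z := by
  have hi := hasDerivAt_inv hz
  have hs := ((hasDerivAt_id z).sub_const φ)
  refine ((hs.cos.mul (((hi.pow 3).const_mul (m * (m - 2) / 4)).sub ((hi.const_mul (m / 2)).sub
      ((hi.pow 3).const_mul (m * (m - 2) * (m - 6) / 48))))).sub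
    (hs.sin.mul (((((hi.pow 2).const_mul (m * (m - 2) / 8)).const_sub 1).sub
      ((hi.pow 2).const_mul (m / 2))).add
      ((hi.pow 4).const_mul (m * (m - 2) * (m - 6) / 16))))).congr_deriv ?_
  simp only [hankelTrunc, id, Pi.sub_apply, Pi.add_apply, Pi.pow_apply]
  push_cast
  field_simp
  ring

lemma tendsto_hankelTrunc (m φ : ℝ) :
    Tendsto (fun t : ℝ => cexp (-(I * t)) *
      ((hankelTruncDeriv m (t - φ) t⁻¹ : ℂ) + I * hankelTrunc m (t - φ) t⁻¹))
      atTop (𝓝 (I * cexp (-(I * φ)))) := by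
  have hinv : Tendsto (fun l : ℝ => l⁻¹) atTop (𝓝 0) := tendsto_inv_atTop_zero
  have hp : ∀ (P : ℝ → ℝ), Continuous P → P 0 = 0 → Tendsto (fun t : ℝ => |P t⁻¹|) atTop (𝓝 0) := by
    intro P hP h0
    have := ((hP.tendsto 0).comp hinv).abs
    rwa [h0, abs_zero] at this
  have h1 := hp (fun h => m * (m - 2) / 8 * h ^ 2) (by fun_prop) (by simp)
  have h2 := hp (fun h => m / 2 * h - m * (m - 2) * (m - 6) / 48 * h ^ 3) (by fun_prop) (by simp)
  have h3 := hp (fun h => m * (m - 2) / 4 * h ^ 3 -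
    (m / 2 * h - m * (m - 2) * (m - 6) / 48 * h ^ 3)) (by fun_prop) (by simp)
  have h4 := hp (fun h => m * (m - 2) / 8 * h ^ 2 + m / 2 * h ^ 2 -
    m * (m - 2) * (m - 6) / 16 * h ^ 4) (by fun_prop) (by simp)
  have hsum := (h3.add h4).add (h1.add h2)
  simp only [add_zero] at hsum
  rw [tendsto_iff_norm_sub_tendsto_zero]
  refine squeeze_zero (fun _ => norm_nonneg _) (fun t => ?_) hsum
  have he : I * cexp (-(I * φ)) = cexp (-(I * t)) *
      (((-Real.sin (t - φ) : ℝ) : ℂ) + I * (Real.cos (t - φ) : ℝ)) := by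
    have h5 : ((-Real.sin (t - φ) : ℝ) : ℂ) + I * (Real.cos (t - φ) : ℝ) =
        I * cexp ((t - φ : ℝ) * I) := by
      rw [Complex.exp_mul_I]
      push_cast
      linear_combination (-Complex.sin (t - φ)) * I_sq
    rw [h5, mul_left_comm, ← Complex.exp_add]
    congr 2; push_cast; ring
  rw [he, ← mul_sub]
  have h6 : ((hankelTruncDeriv m (t - φ) t⁻¹ : ℂ) + I * hankelTrunc m (t - φ) t⁻¹) -
      (((-Real.sin (t - φ) : ℝ) : ℂ) + I * (Real.cos (t - φ) : ℝ)) =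
      ((hankelTruncDeriv m (t - φ) t⁻¹ + Real.sin (t - φ) : ℝ) : ℂ) +
        I * ((hankelTrunc m (t - φ) t⁻¹ - Real.cos (t - φ) : ℝ) : ℂ) := by
    push_cast; ring
  rw [h6]
  refine (norm_exp_mul_deriv_add_le _ _ _).trans (add_le_add ?_ ?_)
  · have : hankelTruncDeriv m (t - φ) t⁻¹ + Real.sin (t - φ) =
        Real.cos (t - φ) * (m * (m - 2) / 4 * t⁻¹ ^ 3 -
          (m / 2 * t⁻¹ - m * (m - 2) * (m - 6) / 48 * t⁻¹ ^ 3)) +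
        Real.sin (t - φ) * (m * (m - 2) / 8 * t⁻¹ ^ 2 + m / 2 * t⁻¹ ^ 2 -
          m * (m - 2) * (m - 6) / 16 * t⁻¹ ^ 4) := by
      unfold hankelTruncDeriv; ring
    rw [this]
    refine (abs_add_le _ _).trans (add_le_add ?_ ?_) <;> rw [abs_mul]
    · exact mul_le_of_le_one_left (abs_nonneg _) (Real.abs_cos_le_one _)
    · exact mul_le_of_le_one_left (abs_nonneg _) (Real.abs_sin_le_one _)
  · have : hankelTrunc m (t - φ) t⁻¹ - Real.cos (t - φ) =
        -(Real.cos (t - φ) * (m * (m - 2) / 8 * t⁻¹ ^ 2)) -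
        Real.sin (t - φ) * (m / 2 * t⁻¹ - m * (m - 2) * (m - 6) / 48 * t⁻¹ ^ 3) := by
      unfold hankelTrunc; ring
    rw [this]
    refine (abs_sub _ _).trans (add_le_add ?_ ?_)
    · rw [abs_neg, abs_mul]
      exact mul_le_of_le_one_left (abs_nonneg _) (Real.abs_cos_le_one _)
    · rw [abs_mul]
      exact mul_le_of_le_one_left (abs_nonneg _) (Real.abs_sin_le_one _)

lemma abs_hankel_coeff_le {n N : ℕ} (hN : 20 ≤ N) (hn : n ≤ N) {c : ℝ} (hc0 : 0 ≤ c) (hc : c ≤ 12) :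
    |(n : ℝ) ^ 2 - 1 / 4 - c| ≤ (N : ℝ) ^ 2 := by
  have h1 : (20 : ℝ) ≤ N := by exact_mod_cast hN
  have h2 : (n : ℝ) ≤ N := by exact_mod_cast hn
  have h3 : (0 : ℝ) ≤ n := by positivity
  rw [abs_le]
  constructor <;> nlinarith

/-- Error bound for the truncated Hankel expansion of `J_n`. -/
lemma abs_besselU_sub_hankelTrunc_le {n N : ℕ} (hN : 20 ≤ N) (hn : n ≤ N) {z : ℝ}
    (hz : 10 * (N : ℝ) ^ 2 ≤ z) :
    |(-1) ^ n * √(π / 2) * besselU n z -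
      hankelTrunc ((n : ℝ) ^ 2 - 1 / 4) (z - (π / 4 + n * π / 2)) z⁻¹| ≤
      (N : ℝ) ^ 8 / (144 * z ^ 4) := by
  have h1 : (20 : ℝ) ≤ N := by exact_mod_cast hN
  have hz0 : 0 < z := by nlinarith
  set φ : ℝ := π / 4 + n * π / 2 with hφ
  set m : ℝ := (n : ℝ) ^ 2 - 1 / 4 with hm
  set σ : ℝ := (-1) ^ n * √(π / 2) with hσ
  have hm0 : |m| ≤ (N : ℝ) ^ 2 := by
    have := abs_hankel_coeff_le hN hn (c := 0) le_rfl (by norm_num)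
    rwa [sub_zero] at this
  have hm2 : |m - 2| ≤ (N : ℝ) ^ 2 := abs_hankel_coeff_le hN hn (by norm_num) (by norm_num)
  have hm6 : |m - 6| ≤ (N : ℝ) ^ 2 := abs_hankel_coeff_le hN hn (by norm_num) (by norm_num)
  have hm12 : |12 - m| ≤ (N : ℝ) ^ 2 := by
    rw [abs_sub_comm]; exact abs_hankel_coeff_le hN hn (by norm_num) (by norm_num)
  set d : ℝ → ℝ := fun t => σ * besselU n t - hankelTrunc m (t - φ) t⁻¹ with hd
  set d' : ℝ → ℝ := fun t => σ * besselUDeriv n t - hankelTruncDeriv m (t - φ) t⁻¹ with hd'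
  set p : ℝ → ℝ := fun t => m / t ^ 2 * d t -
    (12 - m) * (m * (m - 2) * (m - 6) / 48) * Real.sin (t - φ) / t ^ 5 with hp
  have key := norm_le_of_norm_deriv_le_of_tendsto_zero hz0 (abs_nonneg m)
    (R := (N : ℝ) ^ 8 / 48) (by linarith) (by positivity)
    (w := fun t : ℝ => cexp (-(I * t)) * ((d' t : ℂ) + I * d t))
    (w' := fun t : ℝ => cexp (-(I * t)) * (p t : ℂ)) ?_ ?_ ?_
  · refine (abs_le_norm_exp_mul_deriv_add (d' z) (d z) z).trans (key.trans (le_of_eq ?_))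
    field_simp
    norm_num
  · intro t ht
    have ht0 : 0 < t := hz0.trans_le ht
    refine hasDerivAt_exp_mul_deriv_add (((hasDerivAt_besselU n ht0).const_mul σ).sub
      (hasDerivAt_hankelTrunc m φ ht0.ne')) ((((hasDerivAt_besselUDeriv n ht0).const_mul σ).sub
      (hasDerivAt_hankelTruncDeriv m φ ht0.ne')).congr_deriv ?_)
    simp only [hp, hd, hm]
    push_cast
    ring
  · intro t ht
    have ht0 : 0 < t := hz0.trans_le ht
    rw [norm_mul, norm_exp_neg_I_mul, one_mul, norm_real, Real.norm_eq_abs]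
    refine (abs_sub _ _).trans (add_le_add ?_ ?_)
    · rw [abs_mul, abs_div, abs_of_nonneg (by positivity : 0 ≤ t ^ 2)]
      gcongr
      exact abs_le_norm_exp_mul_deriv_add _ _ _
    · rw [abs_div, abs_of_nonneg (by positivity : 0 ≤ t ^ 5), abs_mul, abs_mul, abs_div, abs_mul,
        abs_mul, abs_of_pos (by norm_num : (0:ℝ) < 48)]
      gcongr
      calc _ ≤ (N : ℝ) ^ 2 * ((N : ℝ) ^ 2 * (N : ℝ) ^ 2 * (N : ℝ) ^ 2 / 48) * 1 := by
            gcongr; exact Real.abs_sin_le_one _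
        _ = _ := by ring
  · have := ((tendsto_besselU n).const_mul (σ : ℂ)).sub (tendsto_hankelTrunc m φ)
    have hz : (σ : ℂ) * (√(2 / π) * cexp (-(I * (π / 4 - n * π / 2 - π / 2 : ℝ)))) -
        I * cexp (-(I * φ)) = 0 := by
      have e1 : cexp ((π / 2 : ℝ) * I) = I := by
        rw [Complex.exp_mul_I]; push_cast; simp
      have e2 : √(π / 2) * √(2 / π) = 1 := by
        rw [← Real.sqrt_mul (by positivity)]
        have := Real.pi_ne_zero
        field_simp; simp
      have e3 : cexp (-(I * (π / 4 - n * π / 2 - π / 2 : ℝ))) =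
          cexp (-(I * φ)) * (-1) ^ n * I := by
        nth_rewrite 3 [← e1]
        rw [← Complex.exp_pi_mul_I, ← Complex.exp_nat_mul, ← Complex.exp_add, ← Complex.exp_add]
        congr 1; rw [hφ]; push_cast; ring
      have e4 : ((-1 : ℂ) ^ n) * (-1) ^ n = 1 := by rw [← mul_pow]; simp
      have e2' : ((√(π / 2) : ℝ) : ℂ) * ((√(2 / π) : ℝ) : ℂ) = 1 := by
        rw [← ofReal_mul, e2, ofReal_one]
      rw [e3, hσ, ofReal_mul, ofReal_pow, ofReal_neg, ofReal_one]
      linear_combination (I * cexp (-(I * φ)) * ((-1) ^ n * (-1) ^ n)) * e2' +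
        (I * cexp (-(I * φ))) * e4
    rw [hz] at this
    refine this.congr fun t => ?_
    simp only [hd, hd']
    push_cast; ring

/-- Error propagation when multiplying two third-order truncated expansions. -/
lemma abs_mul_sub_trunc_le {M y E F G p₀ p₁ p₂ p₃ q₀ q₁ q₂ q₃ : ℝ} (hM : 0 ≤ M) (hE : 0 ≤ E)
    (hy : 0 ≤ y) (hy' : y ≤ 1 / 10)
    (hp₀ : |p₀| ≤ 1) (hp₁ : |p₁| ≤ M / 2 * y) (hp₂ : |p₂| ≤ M ^ 2 / 8 * y ^ 2)
    (hp₃ : |p₃| ≤ M ^ 3 / 48 * y ^ 3)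
    (hq₀ : |q₀| ≤ 1) (hq₁ : |q₁| ≤ 1 / 2 * y) (hq₂ : |q₂| ≤ 1 / 8 * y ^ 2)
    (hq₃ : |q₃| ≤ 1 / 48 * y ^ 3)
    (hF : |F - (p₀ + p₁ + p₂ + p₃)| ≤ E * y ^ 4)
    (hG : |G - (q₀ + q₁ + q₂ + q₃)| ≤ 1 / 144 * y ^ 4) :
    |F * G - (p₀ * q₀ + (p₀ * q₁ + p₁ * q₀) + (p₀ * q₂ + p₁ * q₁ + p₂ * q₀) +
      (p₀ * q₃ + p₁ * q₂ + p₂ * q₁ + p₃ * q₀))| ≤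
      (E * (107 / 100) + (1 + M / 20 + M ^ 2 / 800 + M ^ 3 / 48000) / 144 +
        (M ^ 3 / 96 + M ^ 2 / 64 + M / 96) + (M ^ 3 / 384 + M ^ 2 / 384) / 10 +
        M ^ 3 / 2304 / 100) * y ^ 4 := by
  have hy2 : y ^ 2 ≤ (1 / 10) ^ 2 := by gcongr
  have hy3 : y ^ 3 ≤ (1 / 10) ^ 3 := by gcongr
  have hy4 : y ^ 4 ≤ (1 / 10) ^ 4 := by gcongr
  have hP : |p₀ + p₁ + p₂ + p₃| ≤ 1 + M / 20 + M ^ 2 / 800 + M ^ 3 / 48000 := by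
    calc _ ≤ |p₀| + |p₁| + |p₂| + |p₃| := by
          refine (abs_add_le _ _).trans ?_
          gcongr
          exact abs_add_three _ _ _
      _ ≤ 1 + M / 2 * (1 / 10) + M ^ 2 / 8 * (1 / 10) ^ 2 + M ^ 3 / 48 * (1 / 10) ^ 3 := by
          gcongr
          · exact hp₁.trans (by gcongr)
          · exact hp₂.trans (by gcongr)
          · exact hp₃.trans (by gcongr)
      _ = _ := by ring
  have hG' : |G| ≤ 107 / 100 := by
    calc |G| = |q₀ + q₁ + q₂ + q₃ + (G - (q₀ + q₁ + q₂ + q₃))| := by congr 1; ring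
      _ ≤ |q₀| + |q₁| + |q₂| + |q₃| + |G - (q₀ + q₁ + q₂ + q₃)| := by
          refine (abs_add_le _ _).trans ?_
          gcongr
          refine (abs_add_le _ _).trans ?_
          gcongr
          exact abs_add_three _ _ _
      _ ≤ _ := by linarith
  have htail : |p₁ * q₃ + p₂ * q₂ + p₂ * q₃ + p₃ * q₁ + p₃ * q₂ + p₃ * q₃| ≤
      ((M ^ 3 / 96 + M ^ 2 / 64 + M / 96) + (M ^ 3 / 384 + M ^ 2 / 384) / 10 +
        M ^ 3 / 2304 / 100) * y ^ 4 := by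
    calc _ ≤ |p₁| * |q₃| + |p₂| * |q₂| + |p₂| * |q₃| + |p₃| * |q₁| + |p₃| * |q₂| +
          |p₃| * |q₃| := by
          simp only [← abs_mul]
          iterate 5
            refine (abs_add_le _ _).trans ?_
            gcongr
      _ ≤ (M / 2 * y) * (1 / 48 * y ^ 3) + (M ^ 2 / 8 * y ^ 2) * (1 / 8 * y ^ 2) +
          (M ^ 2 / 8 * y ^ 2) * (1 / 48 * y ^ 3) + (M ^ 3 / 48 * y ^ 3) * (1 / 2 * y) +
          (M ^ 3 / 48 * y ^ 3) * (1 / 8 * y ^ 2) + (M ^ 3 / 48 * y ^ 3) * (1 / 48 * y ^ 3) := by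
          gcongr
      _ = ((M ^ 3 / 96 + M ^ 2 / 64 + M / 96) + (M ^ 3 / 384 + M ^ 2 / 384) * y +
          M ^ 3 / 2304 * y ^ 2) * y ^ 4 := by ring
      _ ≤ ((M ^ 3 / 96 + M ^ 2 / 64 + M / 96) + (M ^ 3 / 384 + M ^ 2 / 384) * (1 / 10) +
          M ^ 3 / 2304 * (1 / 10) ^ 2) * y ^ 4 := by gcongr
      _ = _ := by ring
  calc _ = |(F - (p₀ + p₁ + p₂ + p₃)) * G +
        (p₀ + p₁ + p₂ + p₃) * (G - (q₀ + q₁ + q₂ + q₃)) +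
        (p₁ * q₃ + p₂ * q₂ + p₂ * q₃ + p₃ * q₁ + p₃ * q₂ + p₃ * q₃)| := by congr 1; ring
    _ ≤ |F - (p₀ + p₁ + p₂ + p₃)| * |G| +
        |p₀ + p₁ + p₂ + p₃| * |G - (q₀ + q₁ + q₂ + q₃)| +
        |p₁ * q₃ + p₂ * q₂ + p₂ * q₃ + p₃ * q₁ + p₃ * q₂ + p₃ * q₃| := by
        rw [← abs_mul, ← abs_mul]; exact abs_add_three _ _ _
    _ ≤ E * y ^ 4 * (107 / 100) + (1 + M / 20 + M ^ 2 / 800 + M ^ 3 / 48000) *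
        (1 / 144 * y ^ 4) + ((M ^ 3 / 96 + M ^ 2 / 64 + M / 96) +
        (M ^ 3 / 384 + M ^ 2 / 384) / 10 + M ^ 3 / 2304 / 100) * y ^ 4 := by gcongr
    _ = _ := by ring

open PowerSeries in
lemma abs_coeff_prod_le {ι : Type*} (s : Finset ι) (f : ι → PowerSeries ℝ) {L : ℝ} (hL : 0 ≤ L)
    (hf : ∀ j ∈ s, ∀ k, |coeff k (f j)| ≤ L ^ k / k.factorial) (k : ℕ) :
    |coeff k (∏ j ∈ s, f j)| ≤ (s.card * L) ^ k / k.factorial := by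
  classical
  induction s using Finset.induction_on generalizing k with
  | empty => rcases k with _ | k <;> simp [PowerSeries.coeff_one]
  | insert a s ha ih =>
    rw [Finset.prod_insert ha, coeff_mul, Finset.card_insert_of_notMem ha]
    calc _ ≤ ∑ x ∈ Finset.HasAntidiagonal.antidiagonal k, |coeff x.1 (f a)| * |coeff x.2 (∏ j ∈ s, f j)| := by
          simp only [← abs_mul]; exact Finset.abs_sum_le_sum_abs _ _
      _ ≤ ∑ x ∈ Finset.HasAntidiagonal.antidiagonal k, L ^ x.1 / x.1.factorial *
          ((s.card * L) ^ x.2 / x.2.factorial) := by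
          gcongr with x _
          · exact hf a (Finset.mem_insert_self _ _) _
          · exact ih (fun j hj => hf j (Finset.mem_insert_of_mem hj)) _
      _ = _ := by
          rw [show ((s.card + 1 : ℕ) : ℝ) * L = L + s.card * L by push_cast; ring,
            (Commute.all L (s.card * L)).add_pow', Finset.sum_div]
          refine Finset.sum_congr rfl fun x hx => ?_
          rw [← Finset.HasAntidiagonal.mem_antidiagonal.1 hx, nsmul_eq_mul, Nat.choose_symm_add,
            Nat.add_choose, Nat.cast_div (Nat.factorial_mul_factorial_dvd_factorial_add _ _)
            (by positivity)]
          push_cast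
          field_simp

open PowerSeries in
/-- Products of at most six third-order truncated expansions. -/
lemma abs_prod_sub_coeff_le {ι : Type*} (s : Finset ι) (hs : s.card ≤ 6) (f : ι → PowerSeries ℝ)
    (F : ι → ℝ) {L h : ℝ} (hL : 0 ≤ L) (hh : 0 ≤ h) (hLh : L * h ≤ 1 / 10)
    (hf : ∀ j ∈ s, ∀ k, |coeff k (f j)| ≤ (L / 2) ^ k / k.factorial)
    (hF : ∀ j ∈ s, |F j - ∑ k ∈ Finset.range 4, coeff k (f j) * h ^ k| ≤ 1 / 144 * (L * h) ^ 4) :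
    |∏ j ∈ s, F j - ∑ k ∈ Finset.range 4, coeff k (∏ j ∈ s, f j) * h ^ k| ≤
      (s.card : ℝ) ^ 4 / 144 * (L * h) ^ 4 := by
  classical
  induction s using Finset.induction_on with
  | empty => simp [PowerSeries.coeff_one]
  | insert a s ha ih =>
    have hcard := Finset.card_insert_of_notMem ha
    have hfs : ∀ j ∈ s, ∀ k, |coeff k (f j)| ≤ (L / 2) ^ k / k.factorial :=
      fun j hj => hf j (Finset.mem_insert_of_mem hj)
    have hfa := hf a (Finset.mem_insert_self _ _)
    have hFa := hF a (Finset.mem_insert_self _ _)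
    have ih := ih (by omega) hfs fun j hj => hF j (Finset.mem_insert_of_mem hj)
    have hp := abs_coeff_prod_le s f (by positivity) hfs
    have hscale : ∀ {c b : ℝ} (k : ℕ), |c| ≤ b → |c * h ^ k| ≤ b * h ^ k := fun k hc => by
      rw [abs_mul, abs_of_nonneg (by positivity : 0 ≤ h ^ k)]; gcongr
    have p0 := hscale 0 (hp 0)
    have p1 := hscale 1 (hp 1)
    have p2 := hscale 2 (hp 2)
    have p3 := hscale 3 (hp 3)
    have q0 := hscale 0 (hfa 0)
    have q1 := hscale 1 (hfa 1)
    have q2 := hscale 2 (hfa 2)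
    have q3 := hscale 3 (hfa 3)
    simp only [Finset.sum_range_succ, Finset.range_zero, Finset.sum_empty, zero_add] at ih hFa
    have key := abs_mul_sub_trunc_le (M := s.card) (Nat.cast_nonneg _) (by positivity)
      (by positivity) hLh
      (p0.trans (by simp)) (p1.trans (le_of_eq (by simp; ring)))
      (p2.trans (le_of_eq (by simp [Nat.factorial]; ring)))
      (p3.trans (le_of_eq (by simp [Nat.factorial]; ring)))
      (q0.trans (by simp)) (q1.trans (le_of_eq (by simp; ring)))
      (q2.trans (le_of_eq (by simp [Nat.factorial]; ring)))
      (q3.trans (le_of_eq (by simp [Nat.factorial]; ring))) ih hFa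
    rw [Finset.prod_insert ha, Finset.prod_insert ha, mul_comm (F a), mul_comm (f a), hcard]
    have hnum : (s.card : ℝ) ^ 4 / 144 * (107 / 100) +
        (1 + (s.card : ℝ) / 20 + (s.card : ℝ) ^ 2 / 800 + (s.card : ℝ) ^ 3 / 48000) / 144 +
        ((s.card : ℝ) ^ 3 / 96 + (s.card : ℝ) ^ 2 / 64 + (s.card : ℝ) / 96) +
        ((s.card : ℝ) ^ 3 / 384 + (s.card : ℝ) ^ 2 / 384) / 10 +
        (s.card : ℝ) ^ 3 / 2304 / 100 ≤ ((s.card + 1 : ℕ) : ℝ) ^ 4 / 144 := by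
      have : s.card ≤ 5 := by omega
      generalize s.card = c at this
      interval_cases c <;> norm_num
    refine (le_of_eq ?_).trans (key.trans (mul_le_mul_of_nonneg_right hnum (by positivity)))
    congr 1
    simp only [Finset.sum_range_succ, Finset.range_zero, Finset.sum_empty, zero_add, coeff_mul,
      Finset.Nat.antidiagonal_succ, Finset.Nat.antidiagonal_zero, Finset.sum_cons, Finset.map_cons,
      Finset.map_singleton, Finset.sum_singleton, Function.Embedding.prodMap]
    simp
    ring

open PowerSeries in
lemma continuous_coeff_prod {ι : Type*} (s : Finset ι) (f : ι → ℝ → PowerSeries ℝ)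
    (hf : ∀ j ∈ s, ∀ k, Continuous fun z => coeff k (f j z)) (k : ℕ) :
    Continuous fun z => coeff k (∏ j ∈ s, f j z) := by
  classical
  induction s using Finset.induction_on generalizing k with
  | empty => simpa using continuous_const
  | insert a s ha ih =>
    simp only [Finset.prod_insert ha, coeff_mul]
    exact continuous_finsetSum _ fun x _ => (hf a (Finset.mem_insert_self _ _) _).mul
      (ih (fun j hj => hf j (Finset.mem_insert_of_mem hj)) _)

/-- The coefficients of `hankelTrunc` in powers of `h`. -/
noncomputable def hankelSeries (m w : ℝ) : PowerSeries ℝ :=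
  PowerSeries.mk fun
    | 0 => Real.cos w
    | 1 => -(m / 2 * Real.sin w)
    | 2 => -(m * (m - 2) / 8 * Real.cos w)
    | 3 => m * (m - 2) * (m - 6) / 48 * Real.sin w
    | _ => 0

open PowerSeries in
lemma hankelTrunc_eq_sum_coeff (m w h : ℝ) :
    hankelTrunc m w h = ∑ k ∈ Finset.range 4, coeff k (hankelSeries m w) * h ^ k := by
  simp only [hankelTrunc, hankelSeries, Finset.sum_range_succ, coeff_mk, Finset.range_zero,
    Finset.sum_empty]
  ring

open PowerSeries in
lemma continuous_coeff_hankelSeries (m φ : ℝ) (k : ℕ) :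
    Continuous fun z => coeff k (hankelSeries m (z - φ)) := by
  simp only [hankelSeries, coeff_mk]
  split <;> fun_prop

open PowerSeries in
lemma abs_coeff_hankelSeries_le {m w L : ℝ} (h0 : |m| ≤ L) (h2 : |m - 2| ≤ L) (h6 : |m - 6| ≤ L)
    (k : ℕ) : |coeff k (hankelSeries m w)| ≤ (L / 2) ^ k / k.factorial := by
  have hL : 0 ≤ L := (abs_nonneg m).trans h0
  have hc := Real.abs_cos_le_one w
  have hs := Real.abs_sin_le_one w
  simp only [hankelSeries, coeff_mk]
  split
  · simpa using hc
  · rw [abs_neg, abs_mul, abs_div, abs_of_pos (two_pos (α := ℝ))]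
    calc _ ≤ L / 2 * 1 := by gcongr
      _ = _ := by simp
  · rw [abs_neg, abs_mul, abs_div, abs_mul, abs_of_pos (by norm_num : (0 : ℝ) < 8)]
    calc _ ≤ L * L / 8 * 1 := by gcongr
      _ = _ := by simp [Nat.factorial]; ring
  · rw [abs_mul, abs_div, abs_mul, abs_mul, abs_of_pos (by norm_num : (0 : ℝ) < 48)]
    calc _ ≤ L * L * L / 48 * 1 := by gcongr
      _ = _ := by simp [Nat.factorial]; ring
  · simp only [abs_zero]; positivity

open PowerSeries in
lemma hankelSeries_add_pi (m w : ℝ) : hankelSeries m (w + π) = C (-1) * hankelSeries m w := by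
  ext k
  rw [coeff_C_mul]
  simp only [hankelSeries, coeff_mk]
  split <;> simp [Real.cos_add_pi, Real.sin_add_pi]

open PowerSeries in
lemma hankelSeries_neg (m w : ℝ) :
    hankelSeries m (-w) = rescale (-1) (hankelSeries m w) := by
  ext k
  rw [coeff_rescale]
  simp only [hankelSeries, coeff_mk]
  split <;> norm_num

lemma hankelSeries_add_nat_mul_pi (m w : ℝ) (n : ℕ) :
    hankelSeries m (w + n * π) = PowerSeries.C ((-1) ^ n) * hankelSeries m w := by
  induction n with
  | zero => simp
  | succ n ih =>
    rw [show w + (n + 1 : ℕ) * π = w + n * π + π by push_cast; ring, hankelSeries_add_pi, ih,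
      ← mul_assoc, ← map_mul, pow_succ']

lemma integrableOn_one_div_pow {T : ℝ} (hT : 0 < T) (k : ℕ) :
    MeasureTheory.IntegrableOn (fun z : ℝ => 1 / z ^ (k + 2)) (Set.Ioi T) := by
  refine (integrableOn_Ioi_rpow_of_lt (a := -(k + 2 : ℝ)) (by linarith [k.cast_nonneg (α := ℝ)])
    hT).congr_fun (fun z hz => ?_) measurableSet_Ioi
  have hz0 : 0 < z := hT.trans hz
  simp only
  rw [Real.rpow_neg hz0.le, one_div]
  exact_mod_cast congrArg _ (Real.rpow_natCast z (k + 2))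

lemma integral_one_div_pow {T : ℝ} (hT : 0 < T) (k : ℕ) :
    ∫ z in Set.Ioi T, 1 / z ^ (k + 2) = 1 / ((k + 1) * T ^ (k + 1)) := by
  have h := integral_Ioi_rpow_of_lt (a := -(k + 2 : ℝ)) (by linarith [k.cast_nonneg (α := ℝ)]) hT
  have hk : (k : ℝ) + 1 ≠ 0 := by positivity
  calc _ = ∫ z in Set.Ioi T, z ^ (-(k + 2 : ℝ)) := by
        refine MeasureTheory.setIntegral_congr_fun measurableSet_Ioi fun z hz => ?_
        have hz0 : 0 < z := hT.trans hz
        rw [Real.rpow_neg hz0.le, one_div]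
        exact_mod_cast congrArg _ (Real.rpow_natCast z (k + 2)).symm
    _ = _ := by
        rw [h, show -(k + 2 : ℝ) + 1 = -((k + 1 : ℕ) : ℝ) by push_cast; ring,
          Real.rpow_neg hT.le, Real.rpow_natCast]
        push_cast
        field_simp

lemma integrableOn_div_pow {g : ℝ → ℝ} {B T : ℝ} (hT : 0 < T) (hg : Continuous g)
    (hB : ∀ z, T ≤ z → |g z| ≤ B) (k : ℕ) :
    MeasureTheory.IntegrableOn (fun z => g z / z ^ (k + 2)) (Set.Ioi T) := by
  refine ((integrableOn_one_div_pow hT k).const_mul B).mono' ?_ ?_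
  · refine ContinuousOn.aestronglyMeasurable (fun z hz => ?_) measurableSet_Ioi
    have : z ^ (k + 2) ≠ 0 := (pow_pos (hT.trans hz) _).ne'
    exact (hg.continuousAt.div (continuousAt_id.pow (k + 2)) this).continuousWithinAt
  · refine (MeasureTheory.ae_restrict_iff' measurableSet_Ioi).2 (.of_forall fun z hz => ?_)
    rw [Real.norm_eq_abs, abs_div, abs_of_pos (pow_pos (hT.trans hz) _), mul_one_div]
    have := pow_pos (hT.trans hz) (k + 2)
    gcongr
    exact hB z (le_of_lt hz)

lemma abs_integral_div_pow_le {g : ℝ → ℝ} {B T : ℝ} (hT : 0 < T)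
    (hB : ∀ z, T ≤ z → |g z| ≤ B) (k : ℕ) :
    |∫ z in Set.Ioi T, g z / z ^ (k + 2)| ≤ B / ((k + 1) * T ^ (k + 1)) := by
  have := MeasureTheory.norm_integral_le_of_norm_le ((integrableOn_one_div_pow hT k).const_mul B)
    (f := fun z => g z / z ^ (k + 2)) ?_
  · rwa [MeasureTheory.integral_const_mul, integral_one_div_pow hT, mul_one_div] at this
  · refine (MeasureTheory.ae_restrict_iff' measurableSet_Ioi).2 (.of_forall fun z hz => ?_)
    rw [Real.norm_eq_abs, abs_div, abs_of_pos (pow_pos (hT.trans hz) _), mul_one_div]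
    have := pow_pos (hT.trans hz) (k + 2)
    gcongr
    exact hB z (le_of_lt hz)

/-- Tail integrals of a periodic function that is odd under `z ↦ c - z` against `1 / z ^ (k + 2)`. -/
lemma abs_integral_Ioi_div_pow_le_s15 {f : ℝ → ℝ} {p c K T : ℝ} (hf : Continuous f) (hp : 0 < p)
    (hper : Function.Periodic f p) (hodd : ∀ z, f (c - z) = -f z) (hK : ∀ z, |f z| ≤ K)
    (hT : 0 < T) (k : ℕ) : |∫ z in Set.Ioi T, f z / z ^ (k + 2)| ≤ p * K / T ^ (k + 2) := by
  have hf_int : ∀ a b, IntervalIntegrable f MeasureTheory.volume a b :=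
    fun a b => hf.intervalIntegrable a b
  have hzero : ∀ t, ∫ z in t..t + p, f z = 0 := by
    intro t
    have h1 : ∫ z in t..t + p, f (c - z) = ∫ z in t..t + p, f z := by
      rw [intervalIntegral.integral_comp_sub_left f c]
      have := hper.intervalIntegral_add_eq (c - (t + p)) t
      rwa [show c - (t + p) + p = c - t by ring] at this
    simp only [hodd, intervalIntegral.integral_neg] at h1
    linarith
  set H : ℝ → ℝ := fun x => ∫ z in T..x, f z with hH
  have hHper : Function.Periodic H p := by
    intro x
    simp only [hH]
    rw [← intervalIntegral.integral_add_adjacent_intervals (hf_int T x) (hf_int x (x + p)), hzero,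
      add_zero]
  have hHK : ∀ x, |H x| ≤ p * K := by
    intro x
    obtain ⟨y, hy, hxy⟩ := hHper.exists_mem_Ico hp x T
    rw [hxy]
    have := intervalIntegral.norm_integral_le_of_norm_le_const (f := f) (a := T) (b := y) (C := K)
      fun z _ => hK z
    rw [Real.norm_eq_abs] at this
    refine this.trans ?_
    rw [abs_of_nonneg (by linarith [hy.1]), mul_comm]
    have : 0 ≤ K := (abs_nonneg _).trans (hK 0)
    gcongr
    linarith [hy.2]
  have hHc : Continuous H := intervalIntegral.continuous_primitive hf_int T
  have hK0 : 0 ≤ p * K := (abs_nonneg _).trans (hHK 0)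
  have hf' := integrableOn_div_pow hT hf (fun z _ => hK z) k
  have hH' := integrableOn_div_pow hT hHc (fun z _ => hHK z) (k + 1)
  have hderiv : ∀ x ∈ Set.Ici T, HasDerivAt (fun z => H z / z ^ (k + 2))
      (f x / x ^ (k + 2) - (k + 2) * (H x / x ^ (k + 1 + 2))) x := by
    intro x hx
    have hx0 : x ≠ 0 := (hT.trans_le hx).ne'
    refine ((intervalIntegral.integral_hasDerivAt_right (hf_int T x)
      (hf.stronglyMeasurableAtFilter _ _) hf.continuousAt).div (hasDerivAt_pow (k + 2) x)
      (pow_ne_zero _ hx0)).congr_deriv ?_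
    push_cast
    simp only [hH]
    field_simp
    ring
  have hlim : Tendsto (fun z => H z / z ^ (k + 2)) atTop (𝓝 0) := by
    refine squeeze_zero_norm' (a := fun z => p * K / z ^ (k + 2)) ?_
      (tendsto_const_nhds.div_atTop (tendsto_pow_atTop (by omega)))
    filter_upwards [eventually_gt_atTop 0] with z hz
    rw [Real.norm_eq_abs, abs_div, abs_of_pos (pow_pos hz _)]
    gcongr
    exact hHK z
  have hH'' : MeasureTheory.IntegrableOn (fun z => (k + 2) * (H z / z ^ (k + 1 + 2)))
    (Set.Ioi T) := hH'.const_mul _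
  have key := MeasureTheory.integral_Ioi_of_hasDerivAt_of_tendsto'
    hderiv (hf'.sub hH'') hlim
  rw [MeasureTheory.integral_sub hf' hH'', MeasureTheory.integral_const_mul] at key
  have hHT : H T = 0 := intervalIntegral.integral_same
  rw [hHT, zero_div, sub_zero, sub_eq_zero] at key
  rw [key, abs_mul, abs_of_nonneg (by positivity)]
  calc _ ≤ (k + 2 : ℝ) * (p * K / (((k + 1 : ℕ) + 1) * T ^ (k + 1 + 1))) := by
        gcongr
        exact abs_integral_div_pow_le hT (fun z _ => hHK z) (k + 1)
    _ = _ := by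
        push_cast
        field_simp
        ring

lemma prod_erase_eq_prod_ite {ι : Type*} [Fintype ι] [DecidableEq ι] (f : ι → ℝ) (i : ι) :
    ∏ j ∈ Finset.univ.erase i, f j = ∏ j, if j = i then 1 else f j := by
  rw [← Finset.filter_ne', Finset.prod_filter]
  simp

lemma prod_erase_erase_eq_prod_ite {ι : Type*} [Fintype ι] [DecidableEq ι] (f : ι → ℝ) (i i' : ι) :
    ∏ j ∈ (Finset.univ.erase i).erase i', f j =
      ∏ j, if j = i then 1 else if j = i' then 1 else f j := by
  rw [← Finset.filter_ne', Finset.prod_filter, prod_erase_eq_prod_ite]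
  simp only [ne_eq, ite_not]

open PowerSeries in
lemma coeff_zero_prod_fin_six (f : Fin 6 → PowerSeries ℝ) :
    coeff 0 (∏ j, f j) = ∏ j, coeff 0 (f j) := by
  simp

open PowerSeries in
lemma coeff_one_prod_fin_six (f : Fin 6 → PowerSeries ℝ) :
    coeff 1 (∏ j, f j) = ∑ j', coeff 1 (f j') * ∏ j ∈ Finset.univ.erase j', coeff 0 (f j) := by
  simp only [prod_erase_eq_prod_ite, Fin.prod_univ_six, Fin.sum_univ_six]
  simp [coeff_mul, Finset.Nat.antidiagonal_succ]
  ring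

open PowerSeries in
lemma coeff_two_prod_fin_six (f : Fin 6 → PowerSeries ℝ) :
    coeff 2 (∏ j, f j) =
      (∑ j', ∑ j'' ∈ Finset.univ.filter (fun j'' => j' < j''),
        coeff 1 (f j') * coeff 1 (f j'') *
          ∏ j ∈ (Finset.univ.erase j').erase j'', coeff 0 (f j)) +
      ∑ j', coeff 2 (f j') * ∏ j ∈ Finset.univ.erase j', coeff 0 (f j) := by
  simp only [prod_erase_eq_prod_ite, prod_erase_erase_eq_prod_ite, Finset.sum_filter,
    Fin.prod_univ_six, Fin.sum_univ_six]
  simp [coeff_mul, Finset.Nat.antidiagonal_succ]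
  ring

lemma sqrt_mul_self_pow_six (x : ℝ) (hx : 0 ≤ x) : √x ^ 6 = x ^ 3 := by
  rw [show √x ^ 6 = (√x ^ 2) ^ 3 by ring, Real.sq_sqrt hx]

open PowerSeries in
lemma coeff_three_prod_hankelSeries_reflect (k : Fin 6 → ℕ) (m : Fin 6 → ℝ)
    (hk : ∏ j, (-1 : ℝ) ^ k j = 1) (z : ℝ) :
    coeff 3 (∏ j, hankelSeries (m j) (π / 2 - z - (π / 4 + k j * π / 2))) =
      -coeff 3 (∏ j, hankelSeries (m j) (z - (π / 4 + k j * π / 2))) := by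
  have h : ∀ j, hankelSeries (m j) (π / 2 - z - (π / 4 + k j * π / 2)) =
      C ((-1) ^ k j) * rescale (-1) (hankelSeries (m j) (z - (π / 4 + k j * π / 2))) := by
    intro j
    rw [show π / 2 - z - (π / 4 + k j * π / 2) = -(z - (π / 4 + k j * π / 2) + k j * π) by ring,
      hankelSeries_neg, hankelSeries_add_nat_mul_pi, map_mul]
    congr 1
    ext i
    rw [coeff_rescale, coeff_C]
    split_ifs with hi <;> simp [hi]
  simp_rw [h]
  rw [Finset.prod_mul_distrib, ← map_prod, ← map_prod, hk, map_one, one_mul, coeff_rescale]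
  norm_num

open PowerSeries in
lemma prod_hankelSeries_add_pi (φ m : Fin 6 → ℝ) (z : ℝ) :
    ∏ j, hankelSeries (m j) (z + π - φ j) = ∏ j, hankelSeries (m j) (z - φ j) := by
  have h : ∀ j, hankelSeries (m j) (z + π - φ j) =
      C (-1) * hankelSeries (m j) (z - φ j) := by
    intro j
    rw [show z + π - φ j = z - φ j + π by ring, hankelSeries_add_pi]
  simp_rw [h]
  rw [Finset.prod_mul_distrib, ← map_prod]
  norm_num

/-- Tail approximation by the asymptotic expansion: for `N ≥ 20`, `T ≥ 10N²`, integers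
`0 ≤ n_j ≤ N` with even sum, and with `ω_j = z − π/4 − n_jπ/2` and `A`, `B`, `C` as in the
paper, `|∫_T^∞ ∏_j J_{n_j}(z)·z dz − (2/π)³ ∫_T^∞ (A(z)z^{−2} + B(z)z^{−3} + C(z)z^{−4}) dz|
≤ 19N⁶T^{−5} + 0.68N⁸T^{−5} + 0.35N^{10}T^{−6} + 0.13N^{12}T^{−7} + 16N^{14}T^{−8}`. -/
theorem bessel_tail_asymptotic (N : ℕ) (hN : 20 ≤ N) (T : ℝ) (hT : 10 * (N : ℝ) ^ 2 ≤ T)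
    (n : Fin 6 → ℤ) (hn : ∀ j, 0 ≤ n j ∧ n j ≤ (N : ℤ)) (hsum : Even (∑ j, n j))
    (ω : Fin 6 → ℝ → ℝ) (hω : ∀ j z, ω j z = z - Real.pi / 4 - n j * Real.pi / 2)
    (A B C : ℝ → ℝ)
    (hA : ∀ z, A z = ∏ j, Real.cos (ω j z))
    (hB : ∀ z, B z = -∑ j' : Fin 6, (((n j' : ℝ) ^ 2 - 1 / 4) / 2) * Real.sin (ω j' z) *
      ∏ j ∈ Finset.univ.erase j', Real.cos (ω j z))
    (hC : ∀ z, C z =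
      (∑ j' : Fin 6, ∑ j'' ∈ Finset.univ.filter (fun j'' => j' < j''),
        (((n j' : ℝ) ^ 2 - 1 / 4) * ((n j'' : ℝ) ^ 2 - 1 / 4) / 4) *
          Real.sin (ω j' z) * Real.sin (ω j'' z) *
          ∏ j ∈ (Finset.univ.erase j').erase j'', Real.cos (ω j z)) -
      (1 / 8) * (∑ j : Fin 6, ((n j : ℝ) ^ 2 - 1 / 4) * ((n j : ℝ) ^ 2 - 9 / 4)) *
        ∏ j, Real.cos (ω j z)) :
    ‖(∫ z in Set.Ioi T, (∏ j, besselJ (n j) (z : ℂ)) * (z : ℂ)) -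
        ((2 / Real.pi) ^ 3 : ℝ) *
          ((∫ z in Set.Ioi T, (A z / z ^ 2 + B z / z ^ 3 + C z / z ^ 4) : ℝ) : ℂ)‖ ≤
      19 * (N : ℝ) ^ 6 / T ^ 5 + 0.68 * (N : ℝ) ^ 8 / T ^ 5 + 0.35 * (N : ℝ) ^ 10 / T ^ 6 +
        0.13 * (N : ℝ) ^ 12 / T ^ 7 + 16 * (N : ℝ) ^ 14 / T ^ 8 := by
  simp only [besselJ_ofReal]
  have hNr : (20 : ℝ) ≤ N := by exact_mod_cast hN
  have hT0 : 0 < T := by nlinarith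
  choose k hk using fun j => Int.eq_ofNat_of_zero_le (hn j).1
  obtain rfl : n = fun j => (k j : ℤ) := funext hk
  have hkN : ∀ j, k j ≤ N := fun j => Int.ofNat_le.1 (hn j).2
  have hsign : ∏ j, (-1 : ℝ) ^ k j = 1 := by
    rw [Finset.prod_pow_eq_pow_sum]
    refine Even.neg_one_pow ?_
    simp only [← Nat.cast_sum] at hsum
    exact_mod_cast hsum
  set φ : Fin 6 → ℝ := fun j => π / 4 + k j * π / 2 with hφ
  set m : Fin 6 → ℝ := fun j => (k j : ℝ) ^ 2 - 1 / 4 with hm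
  obtain rfl : ω = fun j z => z - φ j := by
    funext j z; rw [hω]; simp only [hφ]; push_cast; ring
  set c : ℕ → ℝ → ℝ := fun i z => PowerSeries.coeff i (∏ j, hankelSeries (m j) (z - φ j)) with hc
  have hS : ∀ j z i, |PowerSeries.coeff i (hankelSeries (m j) (z - φ j))| ≤
      ((N : ℝ) ^ 2 / 2) ^ i / i.factorial := fun j z i => by
    refine abs_coeff_hankelSeries_le ?_ ?_ ?_ i
    · have := abs_hankel_coeff_le hN (hkN j) (c := 0) le_rfl (by norm_num)
      rwa [sub_zero] at this
    · exact abs_hankel_coeff_le hN (hkN j) (by norm_num) (by norm_num)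
    · exact abs_hankel_coeff_le hN (hkN j) (by norm_num) (by norm_num)
  have hcc : ∀ i, Continuous (c i) := fun i =>
    continuous_coeff_prod _ (fun j z => hankelSeries (m j) (z - φ j))
      (fun j _ => continuous_coeff_hankelSeries (m j) (φ j)) i
  have hcb : ∀ i z, |c i z| ≤ (6 * ((N : ℝ) ^ 2 / 2)) ^ i / i.factorial := fun i z => by
    simpa using abs_coeff_prod_le Finset.univ (fun j => hankelSeries (m j) (z - φ j))
      (by positivity) (fun j _ => hS j z) i
  obtain rfl : A = c 0 := by
    funext z
    rw [hA]
    simp only [hc, coeff_zero_prod_fin_six, hankelSeries, PowerSeries.coeff_mk]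
  obtain rfl : B = c 1 := by
    funext z
    rw [hB]
    simp only [hc, coeff_one_prod_fin_six, hankelSeries, PowerSeries.coeff_mk, hm]
    rw [← Finset.sum_neg_distrib]
    refine Finset.sum_congr rfl fun j _ => ?_
    push_cast; ring
  obtain rfl : C = c 2 := by
    funext z
    rw [hC]
    simp only [hc, coeff_two_prod_fin_six, hankelSeries, PowerSeries.coeff_mk, hm]
    rw [sub_eq_add_neg]
    congr 1
    · refine Finset.sum_congr rfl fun j _ => Finset.sum_congr rfl fun j' _ => ?_
      push_cast; ring
    · rw [Finset.mul_sum, Finset.sum_mul, ← Finset.sum_neg_distrib]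
      refine Finset.sum_congr rfl fun j _ => ?_
      rw [← Finset.mul_prod_erase Finset.univ _ (Finset.mem_univ j)]
      push_cast; ring
  set F : Fin 6 → ℝ → ℝ := fun j z => (-1) ^ k j * √(π / 2) * besselU (k j) z with hF
  set g : ℝ → ℝ := fun z => z ^ 4 * ∏ j, F j z -
    (c 0 z * z ^ 4 + c 1 z * z ^ 3 + c 2 z * z ^ 2 + c 3 z * z) with hg
  have hgc : Continuous g := by
    have hFc : ∀ j, Continuous (F j) := fun j => (continuous_besselU _).const_mul _
    have := hcc 0
    have := hcc 1
    have := hcc 2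
    have := hcc 3
    have : Continuous fun z => ∏ j, F j z := continuous_finsetProd _ fun j _ => hFc j
    fun_prop
  have hgb : ∀ z, T ≤ z → |g z| ≤ 9 * (N : ℝ) ^ 8 := by
    intro z hz
    have hz0 : 0 < z := hT0.trans_le hz
    have h := abs_prod_sub_coeff_le Finset.univ (by simp)
      (fun j => hankelSeries (m j) (z - φ j)) (fun j => F j z) (L := (N : ℝ) ^ 2) (h := z⁻¹)
      (by positivity) (by positivity)
      (by rw [← div_eq_mul_inv, div_le_iff₀ hz0]; linarith) (fun j _ => hS j z)
      (fun j _ => by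
        rw [← hankelTrunc_eq_sum_coeff]
        refine (abs_besselU_sub_hankelTrunc_le hN (hkN j) (hT.trans hz)).trans (le_of_eq ?_)
        field_simp)
    have h4 : g z = z ^ 4 * (∏ j, F j z - ∑ i ∈ Finset.range 4, c i z * z⁻¹ ^ i) := by
      simp only [hg, Finset.sum_range_succ, Finset.range_zero, Finset.sum_empty]
      field_simp
      ring
    rw [h4, abs_mul, abs_of_pos (by positivity)]
    refine (mul_le_mul_of_nonneg_left h (by positivity)).trans (le_of_eq ?_)
    simp only [Finset.card_univ, Fintype.card_fin]
    field_simp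
    norm_num
  have hb2 := integrableOn_div_pow hT0 (hcc 0) (fun z _ => hcb 0 z) 0
  have hb3 := integrableOn_div_pow hT0 (hcc 1) (fun z _ => hcb 1 z) 1
  have hb4 := integrableOn_div_pow hT0 (hcc 2) (fun z _ => hcb 2 z) 2
  have hb5 := integrableOn_div_pow hT0 (hcc 3) (fun z _ => hcb 3 z) 3
  have hb6 := integrableOn_div_pow hT0 hgc hgb 4
  simp only [zero_add, Nat.reduceAdd] at hb2 hb3 hb4 hb5 hb6
  have hABC : MeasureTheory.IntegrableOn
      (fun z => c 0 z / z ^ 2 + c 1 z / z ^ 3 + c 2 z / z ^ 4) (Set.Ioi T) := (hb2.add hb3).add hb4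
  have hDg : MeasureTheory.IntegrableOn (fun z => c 3 z / z ^ 5 + g z / z ^ 6) (Set.Ioi T) :=
    hb5.add hb6
  have hmain : (∫ z in Set.Ioi T, (∏ j, (realBesselJ (k j) z : ℂ)) * (z : ℂ)) =
      (((2 / π) ^ 3 * ((∫ z in Set.Ioi T, (c 0 z / z ^ 2 + c 1 z / z ^ 3 + c 2 z / z ^ 4)) +
        ((∫ z in Set.Ioi T, c 3 z / z ^ 5) + ∫ z in Set.Ioi T, g z / z ^ 6)) : ℝ) : ℂ) := by
    rw [← MeasureTheory.integral_add hb5 hb6, ← MeasureTheory.integral_add hABC hDg,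
      ← MeasureTheory.integral_const_mul, ← integral_complex_ofReal]
    refine MeasureTheory.setIntegral_congr_fun measurableSet_Ioi fun z hz => ?_
    have hz0 : 0 < z := hT0.trans hz
    have hFJ : ∏ j, F j z = (π / 2) ^ 3 * z ^ 3 * ∏ j, realBesselJ (k j) z := by
      simp only [hF, besselU, Finset.prod_mul_distrib, hsign, Finset.prod_const, Finset.card_univ,
        Fintype.card_fin, sqrt_mul_self_pow_six z hz0.le,
        sqrt_mul_self_pow_six (π / 2) (by positivity)]
      ring
    simp only [← ofReal_prod, ← ofReal_mul]
    congr 1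
    simp only [hg, hFJ]
    have := Real.pi_ne_zero
    field_simp
    ring
  have hD : |∫ z in Set.Ioi T, c 3 z / z ^ 5| ≤ _ :=
    abs_integral_Ioi_div_pow_le_s15 (c := π / 2) (hcc 3) Real.pi_pos
      (fun z => by simp only [hc, prod_hankelSeries_add_pi])
      (fun z => coeff_three_prod_hankelSeries_reflect k m hsign z) (hcb 3) hT0 3
  have hR : |∫ z in Set.Ioi T, g z / z ^ 6| ≤ _ := abs_integral_div_pow_le hT0 hgb 4
  rw [hmain, ← ofReal_mul, ← ofReal_sub, norm_real, Real.norm_eq_abs, mul_add, add_sub_cancel_left,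
    abs_mul, abs_of_pos (by positivity)]
  have hpi : (2 / π) ^ 3 ≤ 0.2962963 := by
    calc (2 / π) ^ 3 ≤ (2 / 3) ^ 3 := by
          gcongr; exact Real.pi_gt_three.le
      _ ≤ _ := by norm_num
  have hsm : |(∫ z in Set.Ioi T, c 3 z / z ^ 5) + ∫ z in Set.Ioi T, g z / z ^ 6| ≤
      18 * (N : ℝ) ^ 6 / T ^ 5 + 9 / 5 * (N : ℝ) ^ 8 / T ^ 5 := by
    refine (abs_add_le _ _).trans (add_le_add (hD.trans ?_) (hR.trans (le_of_eq ?_)))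
    · have hN6 : (0 : ℝ) ≤ (N : ℝ) ^ 6 := by positivity
      refine div_le_div_of_nonneg_right ?_ (by positivity)
      simp only [Nat.factorial]
      push_cast
      nlinarith [mul_nonneg hN6 (sub_nonneg.2 Real.pi_lt_four.le)]
    · push_cast; field_simp; norm_num
  calc _ ≤ 0.2962963 * (18 * (N : ℝ) ^ 6 / T ^ 5 + 9 / 5 * (N : ℝ) ^ 8 / T ^ 5) := by gcongr
    _ = 5.3333334 * (N : ℝ) ^ 6 / T ^ 5 + 0.53333334 * (N : ℝ) ^ 8 / T ^ 5 + 0 + 0 + 0 := by ring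
    _ ≤ _ := by
      gcongr <;> first | positivity | norm_num
end

section
/- Quadrature error on [0, S]: let n ≥ 1 be a natural number, and let x_1, …, x_n ∈ (−1,1) and w_1, …, w_n be the Gauss–Legendre nodes and weights (the zeros of the monic Legendre polynomial p_n and the associated weights). Let n_1, …, n_6 be integers and set f(z) := z · ∏_{j=1}^{6} J_{n_j}(z). Let K ≥ 1 be an integer, S > 0, and d := S/(2K). Then | ∫_0^S f(z) dz − Σ_{j=0}^{K−1} d · Σ_{i=1}^{n} w_i f(d(2j+1) + d x_i) | ≤ π · 2^{−2n−1} · d^{2n} · e⁶ · (S + 2d + 1)². -/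
open Polynomial Real Complex

/-- The monic Legendre polynomial, given by Rodrigues' formula normalized to be monic. -/
noncomputable def legendreMonic (n : ℕ) : Polynomial ℝ :=
  Polynomial.C ((n.factorial : ℝ) / ((2 * n).factorial : ℝ)) *
    Polynomial.derivative^[n] ((Polynomial.X ^ 2 - 1) ^ n)

theorem differentiable_dslope {f : ℂ → ℂ} (hf : Differentiable ℂ f) (a : ℂ) :
    Differentiable ℂ (dslope f a) := by
  rw [← differentiableOn_univ] at hf ⊢
  exact (Complex.differentiableOn_dslope Filter.univ_mem).2 hf

/-- The `(m + 1)`-st derivative of an entire function in terms of its divided difference. -/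
theorem iteratedDeriv_succ_eq_dslope {f : ℂ → ℂ} (hf : Differentiable ℂ f) (a : ℂ) (m : ℕ) (z : ℂ) :
    iteratedDeriv (m + 1) f z = (z - a) * iteratedDeriv (m + 1) (dslope f a) z +
      (m + 1) * iteratedDeriv m (dslope f a) z := by
  have hg := differentiable_dslope hf a
  have hd (m : ℕ) (z : ℂ) : HasDerivAt (iteratedDeriv m (dslope f a))
      (iteratedDeriv (m + 1) (dslope f a) z) z := by
    rw [iteratedDeriv_succ]
    exact ((hg.contDiff (n := ⊤)).differentiable_iteratedDeriv m
      (by exact_mod_cast WithTop.coe_lt_top _) z).hasDerivAt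
  induction m generalizing z with
  | zero =>
    have hf' : f = fun w => f a + (w - a) * dslope f a w := by
      ext w
      have := sub_smul_dslope f a w
      rw [smul_eq_mul] at this
      rw [this]; ring
    have h := ((((hasDerivAt_id z).sub_const a).mul (hd 0 z)).const_add (f a)).deriv
    simp only [iteratedDeriv_zero] at h
    rw [iteratedDeriv_one]
    conv_lhs => rw [hf']
    refine (Eq.trans ?_ h).trans ?_
    · rfl
    · simp; ring
  | succ m ih =>
    rw [iteratedDeriv_succ, funext ih]
    have h := (((hasDerivAt_id z).sub_const a).mul (hd (m + 1) z)).add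
      ((hd m z).const_mul ((m : ℂ) + 1))
    refine (Eq.trans ?_ h.deriv).trans ?_
    · rfl
    · simp; ring

/-- Bounds for derivatives of a function pass to its divided difference. -/
theorem norm_iteratedDeriv_dslope_le {f : ℂ → ℂ} (hf : Differentiable ℂ f) {s : Set ℂ}
    (hs : Convex ℝ s) {m : ℕ} {M : ℝ} (hM : ∀ z ∈ s, ‖iteratedDeriv (m + 1) f z‖ ≤ M)
    {a x : ℂ} (ha : a ∈ s) (hx : x ∈ s) :
    ‖iteratedDeriv m (dslope f a) x‖ ≤ M / (m + 1) := by
  have hg := differentiable_dslope hf a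
  have hd (z : ℂ) : HasDerivAt (iteratedDeriv m (dslope f a))
      (iteratedDeriv (m + 1) (dslope f a) z) z := by
    rw [iteratedDeriv_succ]
    exact ((hg.contDiff (n := ⊤)).differentiable_iteratedDeriv m
      (by exact_mod_cast WithTop.coe_lt_top _) z).hasDerivAt
  have hφ (t : ℝ) : HasDerivAt
      (fun t : ℝ => (t : ℂ) ^ (m + 1) * iteratedDeriv m (dslope f a) (a + t * (x - a)))
      ((t : ℂ) ^ m * iteratedDeriv (m + 1) f (a + t * (x - a))) t := by
    have h1 : HasDerivAt (fun t : ℂ => a + t * (x - a)) (x - a) (t : ℂ) := by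
      simpa using! ((hasDerivAt_id (t : ℂ)).mul_const (x - a)).const_add a
    have h2 := ((hasDerivAt_pow (m + 1) (t : ℂ)).mul
      ((hd (a + t * (x - a))).comp (t : ℂ) h1)).comp_ofReal
    refine h2.congr_deriv ?_
    rw [iteratedDeriv_succ_eq_dslope hf a]
    simp only [Function.comp_apply, Nat.add_sub_cancel]
    push_cast
    ring
  have hB (t : ℝ) : HasDerivAt (fun t : ℝ => M / (m + 1) * t ^ (m + 1)) (M * t ^ m) t := by
    refine ((hasDerivAt_pow (m + 1) t).const_mul _).congr_deriv ?_
    have : (m : ℝ) + 1 ≠ 0 := by positivity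
    simp only [Nat.add_sub_cancel]
    push_cast
    field_simp
  have key := image_norm_le_of_norm_deriv_right_le_deriv_boundary (a := 0) (b := 1)
    (fun t _ => (hφ t).continuousAt.continuousWithinAt) (fun t _ => (hφ t).hasDerivWithinAt)
    (by simp) hB (by
      rintro t ⟨ht0, ht1⟩
      rw [norm_mul, norm_pow, Complex.norm_real, Real.norm_of_nonneg ht0, mul_comm]
      gcongr
      apply hM
      have := hs.add_smul_sub_mem ha hx ⟨ht0, ht1.le⟩
      simpa using this) (Set.right_mem_Icc.2 zero_le_one)
  simpa using key

/-- Polynomial interpolation of an entire function, with remainder in divided-difference form. -/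
theorem exists_interpolation_remainder {s : Set ℂ} (hs : Convex ℝ s) {M : ℝ} (l : List ℂ)
    (hl : ∀ a ∈ l, a ∈ s) {f : ℂ → ℂ} (hf : Differentiable ℂ f)
    (hM : ∀ z ∈ s, ‖iteratedDeriv l.length f z‖ ≤ l.length.factorial * M) :
    ∃ (q : Polynomial ℂ) (F : ℂ → ℂ), q.degree < l.length ∧ Differentiable ℂ F ∧
      (∀ z ∈ s, ‖F z‖ ≤ M) ∧ ∀ z, f z = q.eval z + (l.map (z - ·)).prod * F z := by
  induction l generalizing f with
  | nil => exact ⟨0, f, by simp, hf, by simpa using hM, by simp⟩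
  | cons a l ih =>
    simp only [List.mem_cons, forall_eq_or_imp] at hl
    have hg := differentiable_dslope hf a
    obtain ⟨q, F, hq, hF, hFM, h⟩ := ih hl.2 hg (fun z hz => by
      refine (norm_iteratedDeriv_dslope_le hf hs hM hl.1 hz).trans_eq ?_
      have : (l.length : ℝ) + 1 ≠ 0 := by positivity
      rw [List.length_cons, Nat.factorial_succ]
      push_cast
      field_simp)
    refine ⟨C (f a) + (X - C a) * q, F, ?_, hF, hFM, fun z => ?_⟩
    · refine (degree_add_le _ _).trans_lt (max_lt ?_ ?_)
      · exact degree_C_le.trans_lt (by simp; positivity)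
      · rw [degree_mul, degree_X_sub_C, List.length_cons, Nat.cast_add, add_comm]
        exact WithBot.add_lt_add_right (by simp) hq
    · have := sub_smul_dslope f a z
      rw [smul_eq_mul, h z] at this
      rw [eq_add_of_sub_eq this.symm]
      simp
      ring

/-- The nodal polynomial of a quadrature rule exact up to degree `2 n - 1` has small `L²` norm. -/
theorem integral_nodal_sq_le {n : ℕ} (hn : 1 ≤ n) {x w : Fin n → ℝ}
    (hweights : ∀ q : Polynomial ℝ, q.natDegree ≤ 2 * n - 1 →
      (∫ y in (-1:ℝ)..1, q.eval y) = ∑ i : Fin n, w i * q.eval (x i)) :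
    ∫ y in (-1:ℝ)..1, (∏ i, (y - x i)) ^ 2 ≤ 2 * Real.pi / 4 ^ n := by
  set p : Polynomial ℝ := Lagrange.nodal Finset.univ x with hp
  have hpdeg : p.degree = n := by simp [hp, Lagrange.degree_nodal]
  have hpm : p.Monic := Lagrange.nodal_monic
  set r : Polynomial ℝ := C ((2:ℝ) ^ (n - 1))⁻¹ * Chebyshev.T ℝ n with hr
  have hc : ((2:ℝ) ^ (n - 1))⁻¹ ≠ 0 := by positivity
  have hrdeg : r.degree = n := by
    rw [hr, degree_C_mul hc, Chebyshev.degree_T]; simp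
  have hrm : r.Monic := by
    rw [Monic, hr, leadingCoeff_mul, leadingCoeff_C, Chebyshev.leadingCoeff_T]
    simp
  have hs : (r - p).degree < n := by
    rw [← hrdeg]
    exact degree_sub_lt_left (hrdeg.trans hpdeg.symm) hrm.ne_zero
      (hrm.leadingCoeff.trans hpm.leadingCoeff.symm)
  have horth : ∫ y in (-1:ℝ)..1, (p * (r - p)).eval y = 0 := by
    rw [hweights]
    · refine Finset.sum_eq_zero fun i _ => ?_
      rw [eval_mul, hp, Lagrange.eval_nodal_at_node (Finset.mem_univ i)]
      simp
    · have h1 : (r - p).natDegree < n := by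
        by_cases h : r - p = 0
        · rw [h]; simpa using! hn
        · exact (natDegree_lt_iff_degree_lt h).2 hs
      have h2 : p.natDegree = n := natDegree_eq_of_degree_eq_some hpdeg
      have := natDegree_mul_le (p := p) (q := r - p)
      omega
  have hint (q : Polynomial ℝ) : IntervalIntegrable (fun y => q.eval y) MeasureTheory.volume (-1:ℝ) 1 :=
    q.continuous.intervalIntegrable _ _
  have hle : ∫ y in (-1:ℝ)..1, (p ^ 2).eval y ≤ ∫ y in (-1:ℝ)..1, (r ^ 2).eval y := by
    have h : r ^ 2 = p ^ 2 + (C 2 * (p * (r - p)) + (r - p) ^ 2) := by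
      rw [show (C (2:ℝ)) = 2 from rfl]; ring
    have h0 : 0 ≤ ∫ y in (-1:ℝ)..1, ((r - p) ^ 2).eval y :=
      intervalIntegral.integral_nonneg (by norm_num) fun y _ => by
        rw [eval_pow]; positivity
    rw [h]
    simp_rw [eval_add, eval_mul (p := C (2:ℝ)), eval_C]
    rw [intervalIntegral.integral_add (hint _) (((hint _).const_mul 2).add (hint _)),
      intervalIntegral.integral_add ((hint _).const_mul 2) (hint _),
      intervalIntegral.integral_const_mul, horth]
    linarith
  have hT : ∫ y in (-1:ℝ)..1, ((Chebyshev.T ℝ n) ^ 2).eval y ≤ Real.pi / 2 := by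
    rw [← Chebyshev.integral_T_real_mul_self_measureT_of_ne_zero (n := n) (by omega),
      Chebyshev.integral_measureT]
    refine intervalIntegral.integral_mono_on_of_le_Ioo (by norm_num) (hint _) ?_ ?_
    · exact Chebyshev.intervalIntegrable_sqrt_one_sub_sq_inv.continuousOn_mul (by fun_prop)
    · rintro y ⟨h1, h2⟩
      rw [eval_pow, sq]
      refine le_mul_of_one_le_right (mul_self_nonneg _) ?_
      have : 0 < 1 - y ^ 2 := by nlinarith
      rw [Real.one_le_sqrt]
      exact (one_le_inv₀ this).2 (by nlinarith)
  have hr2 : ∫ y in (-1:ℝ)..1, (r ^ 2).eval y =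
      (((2:ℝ) ^ (n - 1))⁻¹) ^ 2 * ∫ y in (-1:ℝ)..1, ((Chebyshev.T ℝ n) ^ 2).eval y := by
    rw [← intervalIntegral.integral_const_mul]
    simp [hr, mul_pow]
  have hpe : ∫ y in (-1:ℝ)..1, (∏ i, (y - x i)) ^ 2 = ∫ y in (-1:ℝ)..1, (p ^ 2).eval y := by
    simp [hp, Lagrange.eval_nodal]
  rw [hpe]
  refine hle.trans ?_
  rw [hr2]
  refine (mul_le_mul_of_nonneg_left hT (by positivity)).trans_eq ?_
  obtain ⟨m, rfl⟩ : ∃ m, n = m + 1 := ⟨n - 1, by omega⟩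
  rw [Nat.add_sub_cancel, pow_succ 4 m, show (4:ℝ) = 2 ^ 2 by norm_num, ← pow_mul, mul_comm 2 m,
    pow_mul]
  field_simp

theorem norm_exp_I_mul_sin_le (z : ℂ) (θ : ℝ) :
    ‖Complex.exp (Complex.I * z * (Real.sin θ : ℂ))‖ ≤ Real.exp |z.im| := by
  rw [Complex.norm_exp, Complex.re_mul_ofReal, Complex.I_mul_re]
  refine Real.exp_le_exp.2 ((le_abs_self _).trans ?_)
  rw [abs_mul, abs_neg]
  exact mul_le_of_le_one_right (abs_nonneg _) (Real.abs_sin_le_one θ)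

theorem norm_exp_I_mul_int_mul_ofReal (n : ℤ) (θ : ℝ) :
    ‖Complex.exp (Complex.I * (n : ℂ) * (θ : ℂ))‖ = 1 := by
  rw [Complex.norm_exp]
  simp

theorem norm_besselJ_le (n : ℤ) (z : ℂ) : ‖besselJ n z‖ ≤ Real.exp |z.im| := by
  have h := intervalIntegral.norm_integral_le_of_norm_le_const (a := 0) (b := 2 * Real.pi)
    (f := fun θ : ℝ => Complex.exp (Complex.I * z * (Real.sin θ : ℂ)) *
      Complex.exp (Complex.I * (n : ℂ) * (θ : ℂ))) (C := Real.exp |z.im|) (fun θ _ => by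
        rw [norm_mul, norm_exp_I_mul_int_mul_ofReal, mul_one]
        exact norm_exp_I_mul_sin_le z θ)
  have hpi := Real.pi_pos
  rw [sub_zero, abs_of_pos (show 0 < 2 * Real.pi by positivity)] at h
  rw [besselJ, norm_mul]
  refine (mul_le_mul_of_nonneg_left h (norm_nonneg _)).trans_eq ?_
  rw [norm_div, norm_mul, Complex.norm_real, Real.norm_of_nonneg hpi.le]
  simp only [norm_one, Complex.norm_ofNat]
  field_simp

theorem differentiable_besselJ (n : ℤ) : Differentiable ℂ (besselJ n) := by
  intro z₀
  refine DifferentiableAt.const_mul ?_ _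
  refine (intervalIntegral.hasDerivAt_integral_of_dominated_loc_of_deriv_le
    (F' := fun z (θ : ℝ) => Complex.exp (Complex.I * z * (Real.sin θ : ℂ)) *
      (Complex.I * (Real.sin θ : ℂ)) * Complex.exp (Complex.I * (n : ℂ) * (θ : ℂ)))
    (bound := fun _ => Real.exp (|z₀.im| + 1))
    (Metric.ball_mem_nhds z₀ one_pos) ?_ ?_ ?_ ?_ ?_ ?_).2.differentiableAt
  · exact Filter.Eventually.of_forall fun z => Continuous.aestronglyMeasurable (by fun_prop)
  · exact Continuous.intervalIntegrable (by fun_prop) _ _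
  · exact Continuous.aestronglyMeasurable (by fun_prop)
  · refine Filter.Eventually.of_forall fun θ _ z hz => ?_
    rw [norm_mul, norm_exp_I_mul_int_mul_ofReal, mul_one, norm_mul, norm_mul, Complex.norm_I,
      one_mul, Complex.norm_real]
    refine (mul_le_of_le_one_right (norm_nonneg _) (Real.abs_sin_le_one θ)).trans ?_
    refine (norm_exp_I_mul_sin_le z θ).trans (Real.exp_le_exp.2 ?_)
    rw [Metric.mem_ball, dist_eq_norm] at hz
    have h1 := (Complex.abs_im_le_norm (z - z₀)).trans hz.le
    have h2 := abs_sub_abs_le_abs_sub z.im z₀.im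
    rw [Complex.sub_im] at h1
    linarith
  · exact intervalIntegrable_const
  · refine Filter.Eventually.of_forall fun θ _ z _ => ?_
    have h := (((hasDerivAt_id z).const_mul Complex.I).mul_const (Real.sin θ : ℂ)).cexp.mul_const
      (Complex.exp (Complex.I * (n : ℂ) * (θ : ℂ)))
    simpa using! h

/-- A quadrature rule exact for real polynomials is exact for complex polynomials. -/
theorem integral_eval_complex_eq_sum {n : ℕ} (hn : 1 ≤ n) {x w : Fin n → ℝ}
    (hweights : ∀ q : Polynomial ℝ, q.natDegree ≤ 2 * n - 1 →
      (∫ y in (-1:ℝ)..1, q.eval y) = ∑ i : Fin n, w i * q.eval (x i))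
    {q : Polynomial ℂ} (hq : q.degree < (2 * n : ℕ)) :
    ∫ y in (-1:ℝ)..1, q.eval (y : ℂ) = ∑ i : Fin n, (w i : ℂ) * q.eval (x i : ℂ) := by
  have hnat : q.natDegree < 2 * n := by
    by_cases h : q = 0
    · rw [h, natDegree_zero]; omega
    · exact (natDegree_lt_iff_degree_lt h).2 hq
  have hmon (k : ℕ) (hk : k < 2 * n) :
      ∫ y in (-1:ℝ)..1, (y : ℂ) ^ k = ∑ i : Fin n, (w i : ℂ) * (x i : ℂ) ^ k := by
    have h := hweights (X ^ k) (by rw [natDegree_X_pow]; omega)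
    simp only [eval_pow, eval_X] at h
    have h' := congrArg (fun r : ℝ => (r : ℂ)) h
    rw [← intervalIntegral.integral_ofReal] at h'
    push_cast at h'
    exact h'
  simp_rw [eval_eq_sum_range' hnat]
  rw [intervalIntegral.integral_finsetSum fun k _ =>
    Continuous.intervalIntegrable (by fun_prop) _ _]
  simp_rw [Finset.mul_sum]
  rw [Finset.sum_comm]
  refine Finset.sum_congr rfl fun k hk => ?_
  rw [intervalIntegral.integral_const_mul, hmon k (Finset.mem_range.1 hk), Finset.mul_sum]
  exact Finset.sum_congr rfl fun i _ => by ring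

/-- Error bound for Gauss quadrature of an entire function on `[-1, 1]`. -/
theorem norm_integral_sub_quadrature_le {n : ℕ} (hn : 1 ≤ n) {x w : Fin n → ℝ}
    (hmem : ∀ i, x i ∈ Set.Icc (-1:ℝ) 1)
    (hweights : ∀ q : Polynomial ℝ, q.natDegree ≤ 2 * n - 1 →
      (∫ y in (-1:ℝ)..1, q.eval y) = ∑ i : Fin n, w i * q.eval (x i))
    {g : ℂ → ℂ} (hg : Differentiable ℂ g) {M : ℝ}
    (hM : ∀ y ∈ Set.Icc (-1:ℝ) 1, ‖iteratedDeriv (2 * n) g (y : ℂ)‖ ≤ (2 * n).factorial * M) :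
    ‖(∫ y in (-1:ℝ)..1, g (y : ℂ)) - ∑ i : Fin n, (w i : ℂ) * g (x i : ℂ)‖ ≤
      M * (2 * Real.pi / 4 ^ n) := by
  set s : Set ℂ := Complex.ofRealCLM '' Set.Icc (-1:ℝ) 1 with hs
  set l₀ : List ℂ := List.ofFn fun i => (x i : ℂ) with hl₀
  have hlen : (l₀ ++ l₀).length = 2 * n := by simp [hl₀, two_mul]
  have hconv : Convex ℝ s := (convex_Icc (-1:ℝ) 1).linear_image Complex.ofRealCLM.toLinearMap
  obtain ⟨q, F, hq, hF, hFM, h⟩ := exists_interpolation_remainder hconv (M := M) (l₀ ++ l₀)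
    (fun a ha => by
      obtain ⟨i, rfl⟩ : ∃ i, (x i : ℂ) = a := by simpa [hl₀, List.mem_ofFn] using ha
      exact ⟨x i, hmem i, rfl⟩) hg (by
      rw [hlen]
      rintro _ ⟨y, hy, rfl⟩
      exact hM y hy)
  rw [hlen] at hq
  have hprod (z : ℂ) : ((l₀ ++ l₀).map (z - ·)).prod = (∏ i, (z - (x i : ℂ))) ^ 2 := by
    rw [List.map_append, List.prod_append, hl₀, List.map_ofFn, List.prod_ofFn, sq]
    rfl
  simp_rw [hprod] at h
  have hnode (i : Fin n) : g (x i : ℂ) = q.eval (x i : ℂ) := by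
    rw [h, Finset.prod_eq_zero (Finset.mem_univ i) (sub_self _)]
    simp
  have hFc : Continuous F := hF.continuous
  have herr : (∫ y in (-1:ℝ)..1, g (y : ℂ)) - ∑ i : Fin n, (w i : ℂ) * g (x i : ℂ) =
      ∫ y in (-1:ℝ)..1, (∏ i, ((y : ℂ) - (x i : ℂ))) ^ 2 * F y := by
    simp_rw [hnode]
    rw [← integral_eval_complex_eq_sum hn hweights hq]
    simp_rw [h]
    rw [intervalIntegral.integral_add, add_sub_cancel_left]
    · exact (q.continuous.comp Complex.continuous_ofReal).intervalIntegrable _ _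
    · exact Continuous.intervalIntegrable (by fun_prop) _ _
  have hM0 : 0 ≤ M := (norm_nonneg _).trans (hFM _ ⟨0, by simp, rfl⟩)
  rw [herr]
  refine (intervalIntegral.norm_integral_le_of_norm_le
    (g := fun y => M * (∏ i, (y - x i)) ^ 2) (by norm_num) ?_ ?_).trans ?_
  · refine Filter.Eventually.of_forall fun y hy => ?_
    have h1 : (∏ i, ((y : ℂ) - (x i : ℂ))) ^ 2 = (((∏ i, (y - x i)) ^ 2 : ℝ) : ℂ) := by
      push_cast; rfl
    rw [norm_mul, h1, Complex.norm_real, Real.norm_of_nonneg (sq_nonneg _), mul_comm]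
    gcongr
    exact hFM _ ⟨y, ⟨hy.1.le, hy.2⟩, rfl⟩
  · exact Continuous.intervalIntegrable (by fun_prop) _ _
  · rw [intervalIntegral.integral_const_mul]
    exact mul_le_mul_of_nonneg_left (integral_nodal_sq_le hn hweights) hM0

/-- Error bound on a single panel `[c - d, c + d]` for `z ↦ z ∏ J_{k_j}(z)`. -/
theorem norm_integral_besselJ_prod_sub_quadrature_le {n : ℕ} (hn : 1 ≤ n) {x w : Fin n → ℝ}
    (hmem : ∀ i, x i ∈ Set.Icc (-1:ℝ) 1)
    (hweights : ∀ q : Polynomial ℝ, q.natDegree ≤ 2 * n - 1 →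
      (∫ y in (-1:ℝ)..1, q.eval y) = ∑ i : Fin n, w i * q.eval (x i))
    (k : Fin 6 → ℤ) {c d : ℝ} (hc : 0 ≤ c) (hd : 0 < d) :
    ‖(∫ y in (-1:ℝ)..1, ((c + d * y : ℝ) : ℂ) * ∏ j, besselJ (k j) ((c + d * y : ℝ) : ℂ)) -
        ∑ i : Fin n, (w i : ℂ) *
          (((c + d * x i : ℝ) : ℂ) * ∏ j, besselJ (k j) ((c + d * x i : ℝ) : ℂ))‖ ≤
      (c + d + 1) * Real.exp 1 ^ 6 * d ^ (2 * n) * (2 * Real.pi / 4 ^ n) := by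
  set g : ℂ → ℂ := fun z => (c + d * z) * ∏ j, besselJ (k j) (c + d * z) with hgdef
  have hg : Differentiable ℂ g := by
    have h1 : Differentiable ℂ fun z : ℂ => (c + d * z : ℂ) := by fun_prop
    refine h1.mul (Differentiable.fun_finsetProd fun j _ => ?_)
    exact (differentiable_besselJ (k j)).comp h1
  have key := norm_integral_sub_quadrature_le hn hmem hweights hg
    (M := (c + d + 1) * Real.exp 1 ^ 6 * d ^ (2 * n)) (fun y hy => by
      refine (Complex.norm_iteratedDeriv_le_of_forall_mem_sphere_norm_le (2 * n)
        (inv_pos.2 hd) hg.diffContOnCl (C := (c + d + 1) * Real.exp 1 ^ 6) ?_).trans_eq ?_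
      · intro z hz
        rw [mem_sphere_iff_norm] at hz
        have hdz : ‖(d : ℂ) * (z - y)‖ = 1 := by
          rw [norm_mul, hz, Complex.norm_real, Real.norm_of_nonneg hd.le, mul_inv_cancel₀ hd.ne']
        have hsplit : (c + d * z : ℂ) = ((c + d * y : ℝ) : ℂ) + d * (z - y) := by
          push_cast; ring
        have hnorm : ‖(c + d * z : ℂ)‖ ≤ c + d + 1 := by
          rw [hsplit]
          refine (norm_add_le _ _).trans ?_
          rw [hdz, Complex.norm_real, Real.norm_eq_abs]
          have : |c + d * y| ≤ c + d := abs_le.2 ⟨by nlinarith [hy.1], by nlinarith [hy.2]⟩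
          linarith
        have him : |(c + d * z : ℂ).im| ≤ 1 := by
          rw [hsplit, Complex.add_im, Complex.ofReal_im, zero_add]
          exact (Complex.abs_im_le_norm _).trans_eq hdz
        rw [hgdef]
        simp only [norm_mul, norm_prod]
        refine mul_le_mul hnorm ?_ (by positivity) (by positivity)
        refine (Finset.prod_le_prod (g := fun _ => Real.exp 1) (fun j _ => norm_nonneg _)
          fun j _ => ?_).trans_eq (by simp)
        exact (norm_besselJ_le _ _).trans (Real.exp_le_exp.2 him)
      · rw [inv_pow, div_inv_eq_mul]; ring)
  simpa [hgdef] using key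

/-- Quadrature error on `[0,S]` for `f(z) = z ∏_{j=1}^{6} J_{k_j}(z)`: cutting `[0,S]` into
`K` intervals of length `2d = S/K` and using `n`-point Gauss–Legendre quadrature on each,
the error is at most `π 2^{−2n−1} d^{2n} e⁶ (S+2d+1)²`. -/
theorem quadrature_error_zero_S (n : ℕ) (hn : 1 ≤ n) (x w : Fin n → ℝ)
    (hmono : StrictMono x) (hmem : ∀ i, x i ∈ Set.Ioo (-1:ℝ) 1)
    (hroot : ∀ i, (legendreMonic n).eval (x i) = 0)
    (hweights : ∀ q : Polynomial ℝ, q.natDegree ≤ 2 * n - 1 →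
      (∫ y in (-1:ℝ)..1, q.eval y) = ∑ i : Fin n, w i * q.eval (x i))
    (k : Fin 6 → ℤ) (K : ℕ) (hK : 1 ≤ K) (S : ℝ) (hS : 0 < S) (d : ℝ)
    (hd : d = S / (2 * K)) :
    ‖(∫ t in (0:ℝ)..S, (t : ℂ) * ∏ j, besselJ (k j) (t : ℂ)) -
        ∑ j ∈ Finset.range K, (d : ℂ) *
          ∑ i : Fin n, (w i : ℂ) *
            (((d * (2 * j + 1) + d * x i : ℝ) : ℂ) *
              ∏ l, besselJ (k l) ((d * (2 * j + 1) + d * x i : ℝ) : ℂ))‖ ≤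
      Real.pi * (2:ℝ) ^ (-(2 * (n:ℤ)) - 1) * d ^ (2 * n) * Real.exp 1 ^ 6 *
        (S + 2 * d + 1) ^ 2 := by
  have hK0 : (0:ℝ) < K := by exact_mod_cast hK
  have hd0 : 0 < d := by rw [hd]; positivity
  have hSK : S = 2 * d * K := by rw [hd]; field_simp
  set f : ℝ → ℂ := fun t => (t : ℂ) * ∏ j, besselJ (k j) (t : ℂ) with hf
  have hfc : Continuous f := by
    refine Complex.continuous_ofReal.mul (continuous_finsetProd _ fun j _ => ?_)
    exact (differentiable_besselJ (k j)).continuous.comp Complex.continuous_ofReal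
  have hpanel : ∫ t in (0:ℝ)..S, f t =
      ∑ j ∈ Finset.range K, (d : ℂ) * ∫ y in (-1:ℝ)..1, f (d * (2 * j + 1) + d * y) := by
    have h := intervalIntegral.sum_integral_adjacent_intervals (f := f)
      (μ := MeasureTheory.volume) (a := fun j : ℕ => 2 * d * j) (n := K)
      fun j _ => hfc.intervalIntegrable _ _
    simp only [Nat.cast_zero, mul_zero, ← hSK] at h
    rw [← h]
    refine Finset.sum_congr rfl fun j _ => ?_
    have h2 := intervalIntegral.smul_integral_comp_add_mul (a := -1) (b := 1) f d
      (d * (2 * j + 1))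
    rw [Complex.real_smul] at h2
    rw [h2]
    congr 1 <;> push_cast <;> ring
  rw [hpanel, ← Finset.sum_sub_distrib]
  have hbound (j : ℕ) : ‖(d : ℂ) * (∫ y in (-1:ℝ)..1, f (d * (2 * j + 1) + d * y)) -
      (d : ℂ) * ∑ i : Fin n, (w i : ℂ) * f (d * (2 * j + 1) + d * x i)‖ ≤
      d * ((d * (2 * j + 1) + d + 1) * Real.exp 1 ^ 6 * d ^ (2 * n) *
        (2 * Real.pi / 4 ^ n)) := by
    rw [← mul_sub, norm_mul, Complex.norm_real, Real.norm_of_nonneg hd0.le]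
    gcongr
    exact norm_integral_besselJ_prod_sub_quadrature_le hn
      (fun i => Set.Ioo_subset_Icc_self (hmem i)) hweights k (by positivity) hd0
  refine (norm_sum_le_of_le _ fun j _ => hbound j).trans ?_
  have hsum : ∑ j ∈ Finset.range K, d * (d * (2 * (j : ℝ) + 1) + d + 1) =
      S ^ 2 / 4 + S * (d + 1) / 2 := by
    have h (m : ℕ) : ∑ j ∈ Finset.range m, d * (d * (2 * (j : ℝ) + 1) + d + 1) =
        d ^ 2 * m ^ 2 + d * m * (d + 1) := by
      induction m with
      | zero => simp
      | succ m ih => rw [Finset.sum_range_succ, ih]; push_cast; ring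
    rw [h, hSK]
    ring
  have hpow : (2:ℝ) ^ (-(2 * (n:ℤ)) - 1) = 1 / (2 * 4 ^ n) := by
    rw [zpow_sub₀ two_ne_zero, zpow_neg, zpow_mul, zpow_one]
    norm_cast
    simp [mul_comm, div_eq_mul_inv]
  have hfac : ∑ j ∈ Finset.range K, d * ((d * (2 * (j : ℝ) + 1) + d + 1) * Real.exp 1 ^ 6 *
      d ^ (2 * n) * (2 * Real.pi / 4 ^ n)) =
      (Real.pi * (1 / (2 * 4 ^ n)) * d ^ (2 * n) * Real.exp 1 ^ 6) *
        (4 * (S ^ 2 / 4 + S * (d + 1) / 2)) := by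
    rw [← hsum, Finset.mul_sum, Finset.mul_sum]
    refine Finset.sum_congr rfl fun j _ => ?_
    field_simp
    ring
  rw [hfac, hpow]
  have := Real.pi_pos
  refine mul_le_mul_of_nonneg_left ?_ (by positivity)
  nlinarith [mul_pos hS hd0]
end
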